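/- (Adiprasito–Huh–Katz, Hodge–Riemann relations) Let M be a loopless matroid of rank d+1 on a finite ground set E, let ℓ ∈ A¹(M)_ℝ be an ample class, and let 0 ≤ k ≤ d/2. Define the bilinear form Q_ℓ^k : A^k(M)_ℝ × A^k(M)_ℝ → ℝ by Q_ℓ^k(a, b) = (−1)^k deg(a · ℓ^{d−2k} · b). Then Q_ℓ^k is positive definite on the subspace of primitive classes {a ∈ A^k(M)_ℝ : ℓ^{d−2k+1} · a = 0}. -/

import Mathlib

structure FinMatroid (E : Type*) [Fintype E] [DecidableEq E] where
  Indep : Finset E → Prop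
  indep_empty : Indep ∅
  indep_subset : ∀ ⦃I J : Finset E⦄, Indep J → I ⊆ J → Indep I
  indep_exchange : ∀ ⦃I J : Finset E⦄, Indep I → Indep J → I.card < J.card →
    ∃ e ∈ J, e ∉ I ∧ Indep (insert e I)

namespace FinMatroid

variable {E : Type*} [Fintype E] [DecidableEq E]

open Classical in
noncomputable def rank (M : FinMatroid E) (A : Finset E) : ℕ :=
  (A.powerset.filter fun I => M.Indep I).sup Finset.card

noncomputable def rk (M : FinMatroid E) : ℕ := M.rank Finset.univ

noncomputable def closure (M : FinMatroid E) (A : Finset E) : Finset E :=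
  Finset.univ.filter fun x => M.rank (insert x A) = M.rank A

def IsFlat (M : FinMatroid E) (F : Finset E) : Prop := M.closure F = F

def Loopless (M : FinMatroid E) : Prop := M.closure ∅ = ∅

/-- The type of nonempty proper flats of `M`. -/
def ProperFlat (M : FinMatroid E) : Type _ :=
  {F : Finset E // M.IsFlat F ∧ F ≠ ∅ ∧ F ≠ Finset.univ}

instance (M : FinMatroid E) : Finite (ProperFlat M) := Subtype.finite

noncomputable instance (M : FinMatroid E) : Fintype (ProperFlat M) := Fintype.ofFinite _

variable (R : Type*) [CommRing R]

/-- The ideal of relations defining the Chow ring of a matroid: the linear relations (CH1)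
`Σ_{F ∋ a} x_F = Σ_{F ∋ b} x_F` for `a, b ∈ E`, and the quadratic relations (CH2)
`x_F · x_{F'} = 0` for incomparable proper flats `F, F'`. -/
noncomputable def chowIdeal (M : FinMatroid E) : Ideal (MvPolynomial (ProperFlat M) R) :=
  Ideal.span
    ((Set.range fun ab : E × E =>
        (∑ F : ProperFlat M, if ab.1 ∈ F.1 then MvPolynomial.X F else 0) -
        (∑ F : ProperFlat M, if ab.2 ∈ F.1 then MvPolynomial.X F else 0)) ∪
     {p | ∃ F F' : ProperFlat M, ¬F.1 ⊆ F'.1 ∧ ¬F'.1 ⊆ F.1 ∧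
        p = MvPolynomial.X F * MvPolynomial.X F'})

/-- The Chow ring `A*(M)` (with coefficients in `R`). -/
abbrev ChowRing (M : FinMatroid E) := MvPolynomial (ProperFlat M) R ⧸ chowIdeal R M

/-- The quotient map from the polynomial ring onto the Chow ring. -/
noncomputable def chowMk (M : FinMatroid E) :
    MvPolynomial (ProperFlat M) R →ₐ[R] ChowRing R M :=
  Ideal.Quotient.mkₐ R (chowIdeal R M)

/-- The degree-`k` graded piece `A^k(M)` of the Chow ring: the image of the homogeneous
degree-`k` polynomials. -/
noncomputable def piece (M : FinMatroid E) (k : ℕ) : Submodule R (ChowRing R M) :=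
  (MvPolynomial.homogeneousSubmodule (ProperFlat M) R k).map (chowMk R M).toLinearMap

lemma mk_mem_piece {M : FinMatroid E} {p : MvPolynomial (ProperFlat M) R} {k : ℕ}
    (hp : p.IsHomogeneous k) : chowMk R M p ∈ piece R M k :=
  ⟨p, (MvPolynomial.mem_homogeneousSubmodule _ _).2 hp, rfl⟩

lemma mul_mem_piece {M : FinMatroid E} {k l : ℕ} {a b : ChowRing R M}
    (ha : a ∈ piece R M k) (hb : b ∈ piece R M l) : a * b ∈ piece R M (k + l) := by
  obtain ⟨p, hp, rfl⟩ := ha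
  obtain ⟨q, hq, rfl⟩ := hb
  refine ⟨p * q, ?_, by simp⟩
  simp only [SetLike.mem_coe, MvPolynomial.mem_homogeneousSubmodule] at hp hq ⊢
  exact hp.mul hq

lemma pow_mem_piece {M : FinMatroid E} {a : ChowRing R M} (ha : a ∈ piece R M 1) (m : ℕ) :
    a ^ m ∈ piece R M m := by
  induction m with
  | zero =>
      refine ⟨1, ?_, by simp⟩
      simp only [SetLike.mem_coe, MvPolynomial.mem_homogeneousSubmodule]
      simpa using MvPolynomial.isHomogeneous_one (ProperFlat M) R
  | succ n ih =>
      have h := mul_mem_piece R ih ha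
      simpa [pow_succ] using h

/-- The image in the Chow ring of the monomial attached to a flag of `d` proper flats lies in
the degree-`d` graded piece. -/
lemma flagMonomial_mem (M : FinMatroid E) (d : ℕ) (flag : Fin d → ProperFlat M) :
    chowMk R M (∏ i, MvPolynomial.X (flag i)) ∈ piece R M d := by
  refine mk_mem_piece R ?_
  have h := MvPolynomial.IsHomogeneous.prod (R := R) Finset.univ
    (fun i => MvPolynomial.X (flag i)) (fun _ => 1)
    (fun i _ => MvPolynomial.isHomogeneous_X R (flag i))
  simpa using h

/-- Homogeneity (of degree one) of an `R`-linear combination of the variables. -/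
lemma isHomogeneous_comb (M : FinMatroid E) (P : ProperFlat M → Prop) [DecidablePred P]
    (c : ProperFlat M → R) :
    MvPolynomial.IsHomogeneous
      (∑ F : ProperFlat M, if P F then MvPolynomial.C (c F) * MvPolynomial.X F else 0) 1 := by
  refine MvPolynomial.IsHomogeneous.sum _ _ _ (fun F _ => ?_)
  by_cases h : P F
  · simp only [h, if_true]
    simpa using (MvPolynomial.isHomogeneous_C (ProperFlat M) (c F)).mul
      (MvPolynomial.isHomogeneous_X R F)
  · simp [h, MvPolynomial.isHomogeneous_zero]

end FinMatroid

namespace FinMatroid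

variable {E : Type*} [Fintype E] [DecidableEq E]

/-- A strictly submodular function `c : 2^E → ℝ_{≥0}`: it is nonnegative, vanishes on `∅`
and `E`, and satisfies `c(A ∪ B) + c(A ∩ B) < c(A) + c(B)` for incomparable `A, B ⊆ E`. -/
def StrictlySubmodular (c : Finset E → ℝ) : Prop :=
  (∀ A : Finset E, 0 ≤ c A) ∧ c ∅ = 0 ∧ c Finset.univ = 0 ∧
  ∀ A B : Finset E, ¬A ⊆ B → ¬B ⊆ A → c (A ∪ B) + c (A ∩ B) < c A + c B

/-- An element of `A¹(M)_ℝ` is ample if it is of the form `ℓ(c) = Σ_F c(F)·x_F` for some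
strictly submodular function `c`. -/
def Ample (M : FinMatroid E) (l : ChowRing ℝ M) : Prop :=
  ∃ c : Finset E → ℝ, StrictlySubmodular c ∧
    l = chowMk ℝ M (∑ F : ProperFlat M, MvPolynomial.C (c F.1) * MvPolynomial.X F)

lemma Ample.mem_piece_one {M : FinMatroid E} {l : ChowRing ℝ M} (h : M.Ample l) :
    l ∈ piece ℝ M 1 := by
  obtain ⟨c, -, rfl⟩ := h
  exact mk_mem_piece ℝ (by
    simpa using isHomogeneous_comb ℝ M (fun _ => True) (fun F => c F.1))

end FinMatroid


namespace HRProof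

open Matrix Set in
/-- Positive definiteness on moving kernels propagates along a nondegenerate path. -/
theorem path_posdef {n m : ℕ} (L : ℝ → Matrix (Fin m) (Fin n) ℝ) (B : ℝ → Matrix (Fin n) (Fin n) ℝ)
    (hL : Continuous L) (hB : Continuous B)
    (hsymm : ∀ t, ∀ v w : Fin n → ℝ, v ⬝ᵥ (B t *ᵥ w) = w ⬝ᵥ (B t *ᵥ v))
    (hsurj : ∀ t ∈ Icc (0:ℝ) 1, ∀ w, ∃ v, L t *ᵥ v = w)
    (hnd : ∀ t ∈ Icc (0:ℝ) 1, ∀ v, L t *ᵥ v = 0 →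
      (∀ w, L t *ᵥ w = 0 → v ⬝ᵥ (B t *ᵥ w) = 0) → v = 0)
    (h0 : ∀ v, L 0 *ᵥ v = 0 → v ≠ 0 → 0 < v ⬝ᵥ (B 0 *ᵥ v)) :
    ∀ v, L 1 *ᵥ v = 0 → v ≠ 0 → 0 < v ⬝ᵥ (B 1 *ᵥ v) := by
  set K : Set (ℝ × (Fin n → ℝ)) := {p | p.1 ∈ Icc (0:ℝ) 1 ∧ ‖p.2‖ = 1 ∧ L p.1 *ᵥ p.2 = 0 ∧
    p.2 ⬝ᵥ (B p.1 *ᵥ p.2) ≤ 0} with hK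
  have hKc : IsCompact K := by
    have h1 : IsCompact ((Icc (0:ℝ) 1) ×ˢ (Metric.sphere (0 : Fin n → ℝ) 1)) :=
      isCompact_Icc.prod (isCompact_sphere _ _)
    refine h1.of_isClosed_subset ?_ ?_
    · have e1 : IsClosed {p : ℝ × (Fin n → ℝ) | p.1 ∈ Icc (0:ℝ) 1} :=
        isClosed_Icc.preimage continuous_fst
      have e2 : IsClosed {p : ℝ × (Fin n → ℝ) | ‖p.2‖ = 1} :=
        isClosed_eq (by fun_prop) (by fun_prop)
      have e3 : IsClosed {p : ℝ × (Fin n → ℝ) | L p.1 *ᵥ p.2 = 0} :=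
        isClosed_eq ((hL.comp continuous_fst).matrix_mulVec continuous_snd) continuous_const
      have e4 : IsClosed {p : ℝ × (Fin n → ℝ) | p.2 ⬝ᵥ (B p.1 *ᵥ p.2) ≤ 0} :=
        isClosed_le (continuous_snd.dotProduct
          ((hB.comp continuous_fst).matrix_mulVec continuous_snd)) continuous_const
      exact e1.inter (e2.inter (e3.inter e4))
    · rintro ⟨t, v⟩ ⟨h1, h2, -⟩
      exact ⟨h1, by simpa using h2⟩
  -- normalization
  have hnorm : ∀ t ∈ Icc (0:ℝ) 1, (∀ v, (t, v) ∉ K) →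
      ∀ v, L t *ᵥ v = 0 → v ≠ 0 → 0 < v ⬝ᵥ (B t *ᵥ v) := by
    intro t ht hno v hv hv0
    by_contra hcon
    push Not at hcon
    have hpos : 0 < ‖v‖ := norm_pos_iff.2 hv0
    refine hno (‖v‖⁻¹ • v) ⟨ht, ?_, ?_, ?_⟩
    · simp [norm_smul, hpos.ne']
    · simp [Matrix.mulVec_smul, hv]
    · simp only [Matrix.mulVec_smul, smul_dotProduct, dotProduct_smul, smul_eq_mul]
      have : 0 < ‖v‖⁻¹ := inv_pos.2 hpos
      exact mul_nonpos_of_nonneg_of_nonpos this.le (mul_nonpos_of_nonneg_of_nonpos this.le hcon)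
  rcases K.eq_empty_or_nonempty with hKe | hKne
  · exact hnorm 1 (by simp) (by simp [hKe])
  exfalso
  obtain ⟨ts, ⟨⟨⟨t, v⟩, hp, rfl⟩, hmin⟩⟩ := (hKc.image continuous_fst).exists_isLeast (hKne.image _)
  obtain ⟨ht, hv1, hLv, hBv⟩ := hp
  simp only at ht hv1 hLv hBv hmin
  have hv0 : v ≠ 0 := by rintro rfl; simp at hv1
  have htpos : 0 < t := by
    rcases eq_or_lt_of_le ht.1 with h | h
    · subst h; exact absurd (h0 v hLv hv0) (not_lt.2 hBv)
    · exact h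
  -- right inverse
  choose r hr using hsurj t ht
  let R : Matrix (Fin n) (Fin m) ℝ := Matrix.of fun i j => r (Pi.single j 1) i
  have hLR : L t * R = 1 := by
    ext i j
    have := congrFun (hr (Pi.single j 1)) i
    simp only [Matrix.mul_apply, R, Matrix.of_apply]
    simp only [Matrix.mulVec, dotProduct] at this
    rw [this]
    simp [Matrix.one_apply, Pi.single_apply]
  have hpsd : ∀ w, L t *ᵥ w = 0 → 0 ≤ w ⬝ᵥ (B t *ᵥ w) := by
    intro w hw
    let ws : ℝ → (Fin n → ℝ) := fun s =>
      (L s * R).det • w - R *ᵥ ((L s * R).adjugate *ᵥ (L s *ᵥ w))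
    have hLR' : Continuous fun s => L s * R := hL.matrix_mul continuous_const
    have hwc : Continuous ws := by
      have a1 : Continuous fun s => (L s * R).det • w := hLR'.matrix_det.smul continuous_const
      have a2 : Continuous fun s => R *ᵥ ((L s * R).adjugate *ᵥ (L s *ᵥ w)) :=
        continuous_const.matrix_mulVec (hLR'.matrix_adjugate.matrix_mulVec
          (hL.matrix_mulVec continuous_const))
      exact a1.sub a2
    have hwt : ws t = w := by simp only [ws, hLR, hw]; simp
    have hLw : ∀ s, L s *ᵥ ws s = 0 := by
      intro s
      simp only [ws, Matrix.mulVec_sub, Matrix.mulVec_smul]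
      rw [Matrix.mulVec_mulVec (M := L s) (N := R), Matrix.mulVec_mulVec, Matrix.mul_adjugate]
      simp [Matrix.smul_mulVec]
    have hcont : Continuous fun s => ws s ⬝ᵥ (B s *ᵥ ws s) :=
      hwc.dotProduct (hB.matrix_mulVec hwc)
    have hge : ∀ s ∈ Ico (0:ℝ) t, 0 ≤ ws s ⬝ᵥ (B s *ᵥ ws s) := by
      intro s hs
      by_cases h : ws s = 0
      · simp [h]
      · refine (hnorm s ⟨hs.1, hs.2.le.trans ht.2⟩ ?_ _ (hLw s) h).le
        intro u hu
        exact absurd (hmin ⟨(s, u), hu, rfl⟩) (not_le.2 hs.2)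
    have hlim : Filter.Tendsto (fun s => ws s ⬝ᵥ (B s *ᵥ ws s)) (nhdsWithin t (Iio t))
        (nhds (ws t ⬝ᵥ (B t *ᵥ ws t))) := hcont.continuousAt.tendsto.mono_left nhdsWithin_le_nhds
    rw [hwt] at hlim
    refine ge_of_tendsto hlim ?_
    filter_upwards [Ico_mem_nhdsLT htpos] with s hs using hge s hs
  have hBv0 : v ⬝ᵥ (B t *ᵥ v) = 0 := le_antisymm hBv (hpsd v hLv)
  refine hv0 (hnd t ht v hLv fun w hw => ?_)
  by_contra hne
  set b := v ⬝ᵥ (B t *ᵥ w)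
  set c := w ⬝ᵥ (B t *ᵥ w)
  have key : ∀ s : ℝ, 0 ≤ 2 * s * b + s * s * c := by
    intro s
    have := hpsd (v + s • w) (by simp [Matrix.mulVec_add, Matrix.mulVec_smul, hLv, hw])
    simp only [Matrix.mulVec_add, Matrix.mulVec_smul, add_dotProduct, dotProduct_add,
      smul_dotProduct, dotProduct_smul, smul_eq_mul, hBv0, hsymm t w v] at this
    simp only [b, c]; linarith
  have hc : 0 ≤ c := hpsd w hw
  have := key (-b / (c + 1))
  have hc1 : 0 < c + 1 := by linarith
  have e : 2 * (-b / (c + 1)) * b + (-b / (c + 1)) * (-b / (c + 1)) * c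
      = -(b^2 * (c + 2)) / (c+1)^2 := by field_simp; ring
  rw [e] at this
  have : 0 < b^2 * (c+2) / (c+1)^2 := by positivity
  rw [neg_div] at *
  linarith

end HRProof


namespace HRProof

/-- A finite-dimensional graded algebra with Poincaré duality of dimension `d`. -/
structure PA {A : Type*} [CommRing A] [Algebra ℝ A] (𝒜 : ℕ → Submodule ℝ A)
    (deg : A →ₗ[ℝ] ℝ) (d : ℕ) : Prop where
  one_mem : (1 : A) ∈ 𝒜 0
  mul_mem : ∀ i j : ℕ, ∀ a b : A, a ∈ 𝒜 i → b ∈ 𝒜 j → a * b ∈ 𝒜 (i + j)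
  fin : ∀ k, Module.Finite ℝ (𝒜 k)
  top : ∀ k, d < k → ∀ a ∈ 𝒜 k, a = 0
  pd : ∀ k k', k + k' = d → ∀ a ∈ 𝒜 k, (∀ b ∈ 𝒜 k', deg (a * b) = 0) → a = 0

/-- Hard Lefschetz (injectivity form). -/
def HL {A : Type*} [CommRing A] [Algebra ℝ A] (𝒜 : ℕ → Submodule ℝ A) (d : ℕ) (l : A) : Prop :=
  ∀ k m, 2 * k + m = d → ∀ a ∈ 𝒜 k, l ^ m * a = 0 → a = 0

/-- Hodge–Riemann relations. -/
def HR {A : Type*} [CommRing A] [Algebra ℝ A] (𝒜 : ℕ → Submodule ℝ A)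
    (deg : A →ₗ[ℝ] ℝ) (d : ℕ) (l : A) : Prop :=
  ∀ k m, 2 * k + m = d → ∀ a ∈ 𝒜 k, l ^ (m + 1) * a = 0 → a ≠ 0 →
    0 < (-1 : ℝ) ^ k * deg (a * a * l ^ m)

section
variable {A : Type*} [CommRing A] [Algebra ℝ A] {𝒜 : ℕ → Submodule ℝ A}
    {deg : A →ₗ[ℝ] ℝ} {d : ℕ}

theorem HR.hl {l : A} (h : HR 𝒜 deg d l) : HL 𝒜 d l := by
  intro k m hkm a ha hla
  by_contra ha0
  have := h k m hkm a ha (by rw [pow_succ', mul_assoc, hla, mul_zero]) ha0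
  rw [mul_assoc, mul_comm a (l ^ m), hla] at this
  simp at this

theorem PA.pow_mem (hA : PA 𝒜 deg d) {l : A} (hl : l ∈ 𝒜 1) (m : ℕ) : l ^ m ∈ 𝒜 m := by
  induction m with
  | zero => simpa using hA.one_mem
  | succ n ih => rw [pow_succ]; exact hA.mul_mem _ _ _ _ ih hl

/-- pairing map into the dual -/
noncomputable def pairing (𝒜 : ℕ → Submodule ℝ A) (deg : A →ₗ[ℝ] ℝ) (k k' : ℕ) :
    𝒜 k →ₗ[ℝ] Module.Dual ℝ (𝒜 k') :=
  LinearMap.mk₂ ℝ (fun a b => deg ((a : A) * (b : A)))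
    (by intros; simp [add_mul]) (by intros; simp) (by intros; simp [mul_add]) (by intros; simp)

theorem PA.finrank_le (hA : PA 𝒜 deg d) {k k' : ℕ} (h : k + k' = d) :
    Module.finrank ℝ (𝒜 k) ≤ Module.finrank ℝ (𝒜 k') := by
  haveI := hA.fin k
  haveI := hA.fin k'
  rw [← Subspace.dual_finrank_eq (K := ℝ) (V := 𝒜 k')]
  refine LinearMap.finrank_le_finrank_of_injective (f := pairing 𝒜 deg k k') ?_
  rw [injective_iff_map_eq_zero]
  intro a ha
  refine Subtype.ext (hA.pd k k' h a a.2 fun b hb => ?_)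
  exact LinearMap.congr_fun ha ⟨b, hb⟩

theorem PA.finrank_eq (hA : PA 𝒜 deg d) {k k' : ℕ} (h : k + k' = d) :
    Module.finrank ℝ (𝒜 k) = Module.finrank ℝ (𝒜 k') :=
  le_antisymm (hA.finrank_le h) (hA.finrank_le (by omega))

/-- multiplication as a map between pieces -/
noncomputable def mulPiece (𝒜 : ℕ → Submodule ℝ A) (x : A) (k j : ℕ)
    (h : ∀ a ∈ 𝒜 k, x * a ∈ 𝒜 j) : 𝒜 k →ₗ[ℝ] 𝒜 j :=
  ((LinearMap.mulLeft ℝ x).comp (𝒜 k).subtype).codRestrict (𝒜 j) (fun a => h a a.2)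

theorem PA.lefschetz_surj (hA : PA 𝒜 deg d) {l : A} (hl : l ∈ 𝒜 1) (hHL : HL 𝒜 d l)
    {k m : ℕ} (hkm : 2 * k + m = d) (w : A) (hw : w ∈ 𝒜 (k + m + 1)) :
    ∃ u, w = l ^ (m + 2) * u ∧ ((k = 0 ∧ u = 0) ∨ ∃ k', k = k' + 1 ∧ u ∈ 𝒜 k') := by
  rcases k with _ | k'
  · exact ⟨0, by simpa using hA.top _ (by omega) w hw, Or.inl ⟨rfl, rfl⟩⟩
  · have e : (m + 2) + k' = k' + 1 + m + 1 := by omega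
    let f := mulPiece 𝒜 (l ^ (m+2)) k' (k' + 1 + m + 1)
      (fun a ha => e ▸ hA.mul_mem _ _ _ _ (hA.pow_mem hl _) ha)
    haveI := hA.fin k'
    haveI := hA.fin (k' + 1 + m + 1)
    have hinj : Function.Injective f := by
      rw [injective_iff_map_eq_zero]
      intro a ha
      exact Subtype.ext (hHL k' (m+2) (by omega) a a.2 (congrArg Subtype.val ha))
    have hfr := hA.finrank_eq (k := k') (k' := k' + 1 + m + 1) (by omega)
    have hsurj := (LinearMap.injective_iff_surjective_of_finrank_eq_finrank hfr).1 hinj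
    obtain ⟨u, hu⟩ := hsurj ⟨w, hw⟩
    exact ⟨u, (congrArg Subtype.val hu).symm, Or.inr ⟨k', rfl, u.2⟩⟩

/-- primitive decomposition, one step -/
theorem PA.prim_decomp (hA : PA 𝒜 deg d) {l : A} (hl : l ∈ 𝒜 1) (hHL : HL 𝒜 d l)
    {k m : ℕ} (hkm : 2 * k + m = d) (b : A) (hb : b ∈ 𝒜 k) :
    ∃ p u, b = p + l * u ∧ p ∈ 𝒜 k ∧ l ^ (m + 1) * p = 0 ∧
      ((k = 0 ∧ u = 0) ∨ ∃ k', k = k' + 1 ∧ u ∈ 𝒜 k') := by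
  have hw : l ^ (m + 1) * b ∈ 𝒜 (k + m + 1) := by
    have := hA.mul_mem _ _ _ _ (hA.pow_mem hl (m+1)) hb
    rwa [show m + 1 + k = k + m + 1 by omega] at this
  obtain ⟨u, hu, hu'⟩ := hA.lefschetz_surj hl hHL hkm _ hw
  refine ⟨b - l * u, u, by ring, ?_, ?_, hu'⟩
  · refine Submodule.sub_mem _ hb ?_
    rcases hu' with ⟨-, rfl⟩ | ⟨k', rfl, hk'⟩
    · simp
    · rw [add_comm]; exact hA.mul_mem _ _ _ _ hl hk'
  · rw [mul_sub, hu]; ring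

theorem continuous_path (f : A →ₗ[ℝ] ℝ) (l0 l1 : A) (m : ℕ) : ∀ a : A,
    Continuous fun t : ℝ => f (((1 - t) • l0 + t • l1) ^ m * a) := by
  induction m with
  | zero => intro a; simpa using continuous_const
  | succ m ih =>
    intro a
    have : (fun t : ℝ => f (((1 - t) • l0 + t • l1) ^ (m + 1) * a)) =
        fun t : ℝ => (1 - t) * f (((1 - t) • l0 + t • l1) ^ m * (l0 * a))
          + t * f (((1 - t) • l0 + t • l1) ^ m * (l1 * a)) := by
      funext t
      rw [pow_succ, mul_assoc, add_mul, mul_add, smul_mul_assoc, smul_mul_assoc,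
        mul_smul_comm, mul_smul_comm, map_add, map_smul, map_smul, smul_eq_mul, smul_eq_mul]
    rw [this]
    have h0 := ih (l0 * a)
    have h1 := ih (l1 * a)
    exact ((continuous_const.sub continuous_id).mul h0).add (continuous_id.mul h1)

open Matrix in
theorem PA.hr_path (hA : PA 𝒜 deg d) {l0 l1 : A} (hl0 : l0 ∈ 𝒜 1) (hl1 : l1 ∈ 𝒜 1)
    (hHL : ∀ t ∈ Set.Icc (0:ℝ) 1, HL 𝒜 d ((1 - t) • l0 + t • l1))
    (h0 : HR 𝒜 deg d l0) : HR 𝒜 deg d l1 := by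
  intro k m hkm
  haveI := hA.fin k
  haveI := hA.fin (k + m + 1)
  let l : ℝ → A := fun t => (1 - t) • l0 + t • l1
  have hl : ∀ t, l t ∈ 𝒜 1 := fun t =>
    Submodule.add_mem _ (Submodule.smul_mem _ _ hl0) (Submodule.smul_mem _ _ hl1)
  let bV := Module.finBasis ℝ (𝒜 k)
  let bW := Module.finBasis ℝ (𝒜 (k + m + 1))
  have hmap : ∀ t, ∀ a ∈ 𝒜 k, l t ^ (m + 1) * a ∈ 𝒜 (k + m + 1) := by
    intro t a ha
    have := hA.mul_mem _ _ _ _ (hA.pow_mem (hl t) (m+1)) ha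
    rwa [show m + 1 + k = k + m + 1 by omega] at this
  let F : ∀ t, 𝒜 k →ₗ[ℝ] 𝒜 (k + m + 1) := fun t => mulPiece 𝒜 (l t ^ (m+1)) k _ (hmap t)
  let L : ℝ → Matrix (Fin _) (Fin _) ℝ := fun t => LinearMap.toMatrix bV bW (F t)
  let B : ℝ → Matrix (Fin (Module.finrank ℝ (𝒜 k))) (Fin (Module.finrank ℝ (𝒜 k))) ℝ :=
    fun t => Matrix.of fun i j => (-1) ^ k * deg ((bV i : A) * bV j * l t ^ m)
  let el : (Fin (Module.finrank ℝ (𝒜 k)) → ℝ) → 𝒜 k := fun v => bV.equivFun.symm v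
  have helsum : ∀ v, (el v : A) = ∑ i, v i • (bV i : A) := by
    intro v; simp [el, Module.Basis.equivFun_symm_apply]
  have hLv : ∀ t v, L t *ᵥ v = bW.repr (F t (el v)) := by
    intro t v
    have := LinearMap.toMatrix_mulVec_repr bV bW (F t) (el v)
    rw [← this]
    congr 1
    funext i
    exact (congrFun (bV.equivFun.apply_symm_apply v) i).symm
  have hL0 : ∀ t v, L t *ᵥ v = 0 ↔ l t ^ (m+1) * (el v : A) = 0 := by
    intro t v
    rw [hLv]
    constructor
    · intro h
      have h2 : bW.repr (F t (el v)) = 0 := DFunLike.coe_injective h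
      have h3 : F t (el v) = 0 := by simpa using h2
      exact congrArg Subtype.val h3
    · intro h
      have h3 : F t (el v) = 0 := Subtype.ext h
      rw [h3]; simp
  have hBv : ∀ t v w, v ⬝ᵥ (B t *ᵥ w) = (-1) ^ k * deg ((el v : A) * el w * l t ^ m) := by
    intro t v w
    rw [helsum, helsum, Finset.sum_mul_sum]
    simp only [dotProduct, Matrix.mulVec, B, Matrix.of_apply, Finset.sum_mul, Finset.mul_sum,
      map_sum, smul_mul_assoc, mul_smul_comm, map_smul, smul_eq_mul]
    refine Finset.sum_congr rfl fun i _ => Finset.sum_congr rfl fun j _ => ?_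
    ring
  have hLc : Continuous L := by
    refine continuous_matrix fun i j => ?_
    obtain ⟨f, hf⟩ := LinearMap.exists_extend (bW.coord i)
    have : (fun t => L t i j) = fun t => f (l t ^ (m+1) * (bV j : A)) := by
      funext t
      have h1 : L t i j = bW.coord i (F t (bV j)) := by
        simp [L, LinearMap.toMatrix_apply]
      rw [h1, ← hf]
      rfl
    rw [this]
    exact continuous_path f l0 l1 _ _
  have hBc : Continuous B := by
    refine continuous_matrix fun i j => ?_
    have := (continuous_path deg l0 l1 m ((bV i : A) * bV j)).const_smul ((-1:ℝ)^k)
    refine this.congr fun t => ?_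
    simp [B, l, mul_comm]
  have hres := path_posdef L B hLc hBc
    (fun t v w => by rw [hBv, hBv, mul_comm (el v : A)])
    (fun t ht w => by
      obtain ⟨u, hu, hu'⟩ := hA.lefschetz_surj (hl t) (hHL t ht) hkm
        (bW.equivFun.symm w : 𝒜 (k + m + 1)) (Subtype.mem _)
      have hmem : l t * u ∈ 𝒜 k := by
        rcases hu' with ⟨-, rfl⟩ | ⟨k', rfl, hk'⟩
        · simp
        · rw [add_comm]; exact hA.mul_mem _ _ _ _ (hl t) hk'
      refine ⟨bV.equivFun ⟨l t * u, hmem⟩, ?_⟩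
      rw [hLv]
      have : F t (el (bV.equivFun ⟨l t * u, hmem⟩)) = bW.equivFun.symm w := by
        apply Subtype.ext
        rw [hu]
        simp only [el, LinearEquiv.symm_apply_apply]
        change l t ^ (m+1) * (l t * u) = _
        ring
      rw [this]
      funext i
      exact congrFun (bW.equivFun.apply_symm_apply w) i)
    (fun t ht v hv hw => by
      have hv' := (hL0 t v).1 hv
      have : (el v : A) = 0 := by
        refine hHL t ht k m hkm _ (el v).2 ?_
        have hmem : l t ^ m * (el v : A) ∈ 𝒜 (m + k) :=
          hA.mul_mem _ _ _ _ (hA.pow_mem (hl t) m) (el v).2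
        refine hA.pd (m + k) k (by omega) _ hmem fun b hb => ?_
        obtain ⟨p, u, hbe, hp, hp0, -⟩ := hA.prim_decomp (hl t) (hHL t ht) hkm b hb
        have h1 := hw (bV.equivFun ⟨p, hp⟩) ((hL0 _ _).2 (by simpa [el] using hp0))
        rw [hBv] at h1
        have h2 : deg ((el v : A) * p * l t ^ m) = 0 := by
          simpa [el] using h1
        have h3 : l t ^ m * (el v : A) * b = (el v : A) * p * l t ^ m
            + (l t ^ (m + 1) * (el v : A)) * u := by rw [hbe]; ring
        rw [h3, hv', map_add, h2]; simp
      have h4 : el v = 0 := Subtype.ext this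
      exact (LinearEquiv.map_eq_zero_iff bV.equivFun.symm).1 h4)
    (fun v hv hv0 => by
      rw [hBv]
      have e0 : l 0 = l0 := by simp [l]
      rw [e0]
      refine h0 k m hkm _ (el v).2 ?_ ?_
      · rw [← e0]; exact (hL0 0 v).1 hv
      · intro h
        apply hv0
        have h4 : el v = 0 := Subtype.ext h
        exact (LinearEquiv.map_eq_zero_iff bV.equivFun.symm).1 h4)
  intro a ha hla ha0
  have e1 : l 1 = l1 := by simp [l]
  have hel : (el (bV.equivFun ⟨a, ha⟩) : A) = a := by simp [el]
  have := hres (bV.equivFun ⟨a, ha⟩) ((hL0 _ _).2 (by rw [hel, e1]; exact hla))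
    (by intro h; apply ha0; rw [← hel, h]; simp [el])
  rw [hBv, hel, e1] at this
  exact this

end

end HRProof


namespace HRProof

/-- shifted pieces -/
def shift {A : Type*} [CommRing A] [Algebra ℝ A] (𝒜 : ℕ → Submodule ℝ A) : ℕ → Submodule ℝ A
  | 0 => ⊥
  | k + 1 => 𝒜 k

section links
variable {A : Type*} [CommRing A] [Algebra ℝ A] {𝒜 : ℕ → Submodule ℝ A}
    {deg : A →ₗ[ℝ] ℝ} {d : ℕ}

/-- Hard Lefschetz from Hodge–Riemann on links. -/
theorem hl_of_links {ι : Type*} (s : Finset ι) (x : ι → A) (C : ι → Type*)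
    [∀ F, CommRing (C F)] [∀ F, Algebra ℝ (C F)] (𝒞 : ∀ F, ℕ → Submodule ℝ (C F))
    (g : ∀ F, C F →ₗ[ℝ] A) (l : A) (hl : l ∈ 𝒜 1) (lF : ∀ F, C F)
    (hA : PA 𝒜 deg (d + 1))
    (hC : ∀ F ∈ s, PA (𝒞 F) (deg ∘ₗ g F) d)
    (hlF : ∀ F ∈ s, lF F ∈ 𝒞 F 1)
    (hHR : ∀ F ∈ s, HR (𝒞 F) (deg ∘ₗ g F) d (lF F))
    (hg1 : ∀ F ∈ s, g F 1 = x F)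
    (hgl : ∀ F ∈ s, ∀ c, g F (lF F * c) = l * g F c)
    (hga : ∀ F ∈ s, ∀ k, ∀ a ∈ 𝒜 k, ∃ c ∈ 𝒞 F k, ∀ c', g F (c * c') = a * g F c')
    (hpos : ∀ F0 ∈ s, ∃ f : ι → ℝ, (∀ F ∈ s, 0 ≤ f F) ∧ 0 < f F0 ∧ l = ∑ F ∈ s, f F • x F)
    (hspan : ∀ k, ∀ z ∈ 𝒜 (k + 1), z ∈ Submodule.span ℝ {z | ∃ F ∈ s, ∃ b, z = x F * b}) :
    HL 𝒜 (d + 1) l := by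
  intro k m hkm a ha hla
  rcases m with _ | m
  · simpa using hla
  have hgpow : ∀ F ∈ s, ∀ j c, g F (lF F ^ j * c) = l ^ j * g F c := by
    intro F hF j
    induction j with
    | zero => simp
    | succ j ih => intro c; rw [pow_succ, mul_assoc, ih, hgl F hF]; ring
  have hxa : ∀ F0 ∈ s, a * x F0 = 0 := by
    intro F0 hF0
    -- nonnegativity
    have key : ∀ F ∈ s, ∃ c ∈ 𝒞 F k, (∀ c', g F (c * c') = a * g F c') ∧
        (-1 : ℝ) ^ k * deg (a * a * l ^ m * x F) = (-1) ^ k * (deg ∘ₗ g F) (c * c * lF F ^ m) ∧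
        (c ≠ 0 → 0 < (-1 : ℝ) ^ k * (deg ∘ₗ g F) (c * c * lF F ^ m)) := by
      intro F hF
      obtain ⟨c, hc, hcc⟩ := hga F hF k a ha
      refine ⟨c, hc, hcc, ?_, ?_⟩
      · congr 1
        rw [LinearMap.comp_apply, mul_assoc c, hcc, hcc]
        have := hgpow F hF m 1
        rw [mul_one, hg1 F hF] at this
        rw [this]; congr 1; ring
      · refine hHR F hF k m (by omega) c hc ?_
        have hm : lF F ^ (m + 1) * c ∈ 𝒞 F (m + 1 + k) :=
          (hC F hF).mul_mem _ _ _ _ ((hC F hF).pow_mem (hlF F hF) _) hc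
        have hkk : m + 1 + k + k = d + 1 := by omega
        rcases k with _ | k
        · exact (hC F hF).top _ (by omega) _ hm
        · refine (hC F hF).pd _ k (by omega) _ hm fun b hb => ?_
          rw [LinearMap.comp_apply, mul_assoc, hgpow F hF, hcc, ← mul_assoc, hla]
          simp
    obtain ⟨f, hf0, hfpos, hlf⟩ := hpos F0 hF0
    have hsum : ∑ F ∈ s, f F * ((-1 : ℝ) ^ k * deg (a * a * l ^ m * x F)) = 0 := by
      have h1 : (-1 : ℝ) ^ k * deg (a * a * l ^ m * l) = 0 := by
        have : a * a * l ^ m * l = (l ^ (m + 1) * a) * a := by ring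
        rw [this, hla]; simp
      rw [← h1]
      have h2 : a * a * l ^ m * l = a * a * l ^ m * ∑ F ∈ s, f F • x F := by rw [← hlf]
      rw [h2, Finset.mul_sum, map_sum, Finset.mul_sum]
      refine Finset.sum_congr rfl fun F _ => ?_
      rw [mul_smul_comm, map_smul, smul_eq_mul]; ring
    have hterm := (Finset.sum_eq_zero_iff_of_nonneg (fun F hF => ?_)).1 hsum F0 hF0
    · obtain ⟨c, hc, hcc, he, hp⟩ := key F0 hF0
      have h0 : (-1 : ℝ) ^ k * deg (a * a * l ^ m * x F0) = 0 := by
        rcases mul_eq_zero.1 hterm with h | h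
        · exact absurd h hfpos.ne'
        · exact h
      have hc0 : c = 0 := by
        by_contra hne
        have := hp hne
        rw [← he, h0] at this
        exact lt_irrefl _ this
      rw [← hg1 F0 hF0, ← hcc 1, hc0]; simp
    · obtain ⟨c, hc, hcc, he, hp⟩ := key F hF
      refine mul_nonneg (hf0 F hF) ?_
      rw [he]
      by_cases h : c = 0
      · simp [h]
      · exact (hp h).le
  refine hA.pd k (k + m + 1) (by omega) a ha fun b hb => ?_
  have : ∀ z ∈ Submodule.span ℝ {z | ∃ F ∈ s, ∃ b, z = x F * b}, a * z = 0 := by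
    intro z hz
    induction hz using Submodule.span_induction with
    | mem z hz =>
      obtain ⟨F, hF, b, rfl⟩ := hz
      rw [← mul_assoc, hxa F hF, zero_mul]
    | zero => simp
    | add y z _ _ h1 h2 => rw [mul_add, h1, h2, add_zero]
    | smul t z _ h => rw [mul_smul_comm, h, smul_zero]
  rw [this b (hspan _ b hb), map_zero]

end links

section decomp
variable {A : Type*} [CommRing A] [Algebra ℝ A] {𝒜 : ℕ → Submodule ℝ A}
    {deg : A →ₗ[ℝ] ℝ} {d : ℕ}
  {B : Type*} [CommRing B] [Algebra ℝ B] {ℬ : ℕ → Submodule ℝ B} {degB : B →ₗ[ℝ] ℝ}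
  {ι : Type*} [DecidableEq ι] {s : Finset ι} {C : ι → Type*}
    [∀ F, CommRing (C F)] [∀ F, Algebra ℝ (C F)] {𝒞 : ∀ F, ℕ → Submodule ℝ (C F)}
    {degC : ∀ F, C F →ₗ[ℝ] ℝ} {e : ℕ}
    {φ : B →ₗ[ℝ] A} {g : ∀ F, C F →ₗ[ℝ] A}

/-- data of an orthogonal decomposition -/
structure Decomp (𝒜 : ℕ → Submodule ℝ A) (deg : A →ₗ[ℝ] ℝ) (d : ℕ)
    (ℬ : ℕ → Submodule ℝ B) (degB : B →ₗ[ℝ] ℝ) (s : Finset ι)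
    (𝒞 : ∀ F, ℕ → Submodule ℝ (C F)) (degC : ∀ F, C F →ₗ[ℝ] ℝ) (e : ℕ)
    (φ : B →ₗ[ℝ] A) (g : ∀ F, C F →ₗ[ℝ] A) : Prop where
  one_mem : (1 : A) ∈ 𝒜 0
  mul_mem : ∀ i j : ℕ, ∀ a b : A, a ∈ 𝒜 i → b ∈ 𝒜 j → a * b ∈ 𝒜 (i + j)
  fin : ∀ k, Module.Finite ℝ (𝒜 k)
  hB : PA ℬ degB d
  hC : ∀ F ∈ s, PA (𝒞 F) (degC F) e
  hde : ∀ F ∈ s, e + 2 = d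
  φ_mem : ∀ k, ∀ b ∈ ℬ k, φ b ∈ 𝒜 k
  g_mem : ∀ F ∈ s, ∀ k, ∀ c ∈ 𝒞 F k, g F c ∈ 𝒜 (k + 1)
  BB : ∀ i j, i + j = d → ∀ b ∈ ℬ i, ∀ b' ∈ ℬ j, deg (φ b * φ b') = degB (b * b')
  BC : ∀ i j, i + (j + 1) = d → ∀ F ∈ s, ∀ b ∈ ℬ i, ∀ c ∈ 𝒞 F j, deg (φ b * g F c) = 0
  CC : ∀ i j, i + j = e → ∀ F ∈ s, ∀ c ∈ 𝒞 F i, ∀ c' ∈ 𝒞 F j,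
    deg (g F c * g F c') = - degC F (c * c')
  CC' : ∀ i j, i + j = e → ∀ F ∈ s, ∀ F' ∈ s, F ≠ F' → ∀ c ∈ 𝒞 F i, ∀ c' ∈ 𝒞 F' j,
    deg (g F c * g F' c') = 0
  span : ∀ k, ∀ a ∈ 𝒜 k, ∃ b ∈ ℬ k, ∃ c : ∀ F, C F, (∀ F ∈ s, c F ∈ shift (𝒞 F) k) ∧
    a = φ b + ∑ F ∈ s, g F (c F)

theorem Decomp.uniq (D : Decomp 𝒜 deg d ℬ degB s 𝒞 degC e φ g) {k k' : ℕ} (hk : k + k' = d)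
    {b : B} (hb : b ∈ ℬ k) {c : ∀ F, C F} (hc : ∀ F ∈ s, c F ∈ shift (𝒞 F) k)
    (h : ∀ a ∈ 𝒜 k', deg ((φ b + ∑ F ∈ s, g F (c F)) * a) = 0) :
    b = 0 ∧ ∀ F ∈ s, c F = 0 := by
  constructor
  · refine D.hB.pd k k' hk b hb fun b' hb' => ?_
    have := h (φ b') (D.φ_mem _ _ hb')
    rw [add_mul, map_add, D.BB k k' hk b hb b' hb', Finset.sum_mul, map_sum,
      Finset.sum_eq_zero, add_zero] at this
    · exact this
    · intro F hF
      have hcF := hc F hF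
      rcases k with _ | k
      · have : c F = 0 := by simpa [shift] using hcF
        rw [this]; simp
      · rw [mul_comm]; exact D.BC k' k (by omega) F hF b' hb' _ hcF
  · intro F hF
    have hcF := hc F hF
    have hde := D.hde F hF
    rcases k with _ | k
    · simpa [shift] using hcF
    rcases k' with _ | k'
    · exact (D.hC F hF).top k (by omega) _ hcF
    refine (D.hC F hF).pd k k' (by omega) _ hcF fun c' hc' => ?_
    have := h (g F c') (D.g_mem F hF _ _ hc')
    rw [add_mul, map_add, D.BC (k+1) k' (by omega) F hF b hb c' hc', zero_add, Finset.sum_mul,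
      map_sum, Finset.sum_eq_single F] at this
    · rw [D.CC k k' (by omega) F hF _ hcF c' hc'] at this
      linarith
    · intro F' hF' hne
      exact D.CC' k k' (by omega) F' hF' F hF hne _ (hc F' hF') _ hc'
    · intro h; exact absurd hF h

theorem Decomp.pa (D : Decomp 𝒜 deg d ℬ degB s 𝒞 degC e φ g) : PA 𝒜 deg d where
  one_mem := D.one_mem
  mul_mem := D.mul_mem
  fin := D.fin
  top := by
    intro k hk a ha
    obtain ⟨b, hb, c, hc, rfl⟩ := D.span k a ha
    rw [D.hB.top k hk b hb, map_zero, zero_add]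
    refine Finset.sum_eq_zero fun F hF => ?_
    have hde := D.hde F hF
    have hcF := hc F hF
    rcases k with _ | k
    · omega
    · rw [(D.hC F hF).top k (by omega) _ hcF, map_zero]
  pd := by
    intro k k' hk a ha h
    obtain ⟨b, hb, c, hc, rfl⟩ := D.span k a ha
    obtain ⟨h1, h2⟩ := D.uniq hk hb hc h
    rw [h1, map_zero, zero_add]
    exact Finset.sum_eq_zero fun F hF => by rw [h2 F hF, map_zero]

theorem Decomp.hr (D : Decomp 𝒜 deg d ℬ degB s 𝒞 degC e φ g) {l : A} {lB : B} {lC : ∀ F, C F}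
    (hlB : lB ∈ ℬ 1) (hlC : ∀ F ∈ s, lC F ∈ 𝒞 F 1)
    (hφ : ∀ b, φ (lB * b) = l * φ b) (hg : ∀ F ∈ s, ∀ c, g F (lC F * c) = l * g F c)
    (hHB : HR ℬ degB d lB) (hHC : ∀ F ∈ s, HR (𝒞 F) (degC F) e (lC F)) : HR 𝒜 deg d l := by
  intro k m hkm a ha hla ha0
  have hφp : ∀ j b, φ (lB ^ j * b) = l ^ j * φ b := by
    intro j
    induction j with
    | zero => simp
    | succ j ih => intro b; rw [pow_succ, mul_assoc, ih, hφ]; ring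
  have hgp : ∀ F ∈ s, ∀ j c, g F (lC F ^ j * c) = l ^ j * g F c := by
    intro F hF j
    induction j with
    | zero => simp
    | succ j ih => intro c; rw [pow_succ, mul_assoc, ih, hg F hF]; ring
  obtain ⟨b, hb, c, hc, rfl⟩ := D.span k a ha
  have hlb : ∀ j, lB ^ j * b ∈ ℬ (j + k) := fun j =>
    D.hB.mul_mem _ _ _ _ (D.hB.pow_mem hlB j) hb
  have hlc : ∀ F ∈ s, ∀ j, lC F ^ j * c F ∈ shift (𝒞 F) (j + k) := by
    intro F hF j
    have hcF := hc F hF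
    rcases k with _ | k
    · have : c F = 0 := by simpa [shift] using hcF
      rw [this]; simp
    · exact (D.hC F hF).mul_mem _ _ _ _ ((D.hC F hF).pow_mem (hlC F hF) j) hcF
  have hmul : ∀ j, l ^ j * (φ b + ∑ F ∈ s, g F (c F)) =
      φ (lB ^ j * b) + ∑ F ∈ s, g F (lC F ^ j * c F) := by
    intro j
    rw [mul_add, hφp, Finset.mul_sum]
    congr 1
    exact Finset.sum_congr rfl fun F hF => (hgp F hF j _).symm
  have hprim : lB ^ (m+1) * b = 0 ∧ ∀ F ∈ s, lC F ^ (m+1) * c F = 0 := by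
    rcases k with _ | k
    · refine ⟨D.hB.top _ (by omega) _ (hlb (m+1)), fun F hF => ?_⟩
      have hcF := hc F hF
      have : c F = 0 := by simpa [shift] using hcF
      rw [this]; simp
    · refine D.uniq (k := m + 1 + (k + 1)) (k' := k) (by omega) (hlb _)
        (c := fun F => lC F ^ (m+1) * c F) (fun F hF => hlc F hF _) fun a' _ => ?_
      rw [← hmul, hla]; simp
  have hQ : deg ((φ b + ∑ F ∈ s, g F (c F)) * (φ b + ∑ F ∈ s, g F (c F)) * l ^ m) =
      degB (b * b * lB ^ m) - ∑ F ∈ s, degC F (c F * c F * lC F ^ m) := by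
    have e1 : (φ b + ∑ F ∈ s, g F (c F)) * (φ b + ∑ F ∈ s, g F (c F)) * l ^ m =
      (φ b + ∑ F ∈ s, g F (c F)) * (φ (lB ^ m * b) + ∑ F ∈ s, g F (lC F ^ m * c F)) := by
      rw [← hmul]; ring
    rw [e1, add_mul, mul_add, map_add, map_add, D.BB k (m + k) (by omega) b hb _ (hlb m)]
    have h1 : deg (φ b * ∑ F ∈ s, g F (lC F ^ m * c F)) = 0 := by
      rw [Finset.mul_sum, map_sum]
      refine Finset.sum_eq_zero fun F hF => ?_
      have := hlc F hF m
      have hcF := hc F hF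
      rcases k with _ | k
      · have : c F = 0 := by simpa [shift] using hcF
        rw [this]; simp
      · exact D.BC (k+1) (m+k) (by omega) F hF b hb _ this
    have h2 : deg ((∑ F ∈ s, g F (c F)) * (φ (lB ^ m * b) + ∑ F ∈ s, g F (lC F ^ m * c F)))
        = - ∑ F ∈ s, degC F (c F * c F * lC F ^ m) := by
      rw [Finset.sum_mul, map_sum, ← Finset.sum_neg_distrib]
      refine Finset.sum_congr rfl fun F hF => ?_
      have hcF := hc F hF
      have hde := D.hde F hF
      rcases k with _ | k
      · have : c F = 0 := by simpa [shift] using hcF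
        rw [this]; simp
      rw [mul_add, map_add, mul_comm (g F (c F)), D.BC (m + (k+1)) k (by omega) F hF _ (hlb m) _ hcF,
        zero_add, Finset.mul_sum, map_sum, Finset.sum_eq_single F]
      · rw [D.CC k (m+k) (by omega) F hF _ hcF _ (hlc F hF m)]
        congr 2; ring
      · intro F' hF' hne
        exact D.CC' k (m+k) (by omega) F hF F' hF' (Ne.symm hne) _ hcF _ (hlc F' hF' m)
      · intro h; exact absurd hF h
    rw [h1, h2, add_zero, ← sub_eq_add_neg]
    congr 2; ring
  rw [hQ, mul_sub, sub_eq_add_neg, Finset.mul_sum, ← Finset.sum_neg_distrib]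
  have hbn : 0 ≤ (-1 : ℝ) ^ k * degB (b * b * lB ^ m) ∧
      (b ≠ 0 → 0 < (-1 : ℝ) ^ k * degB (b * b * lB ^ m)) := by
    have := hHB k m hkm b hb hprim.1
    refine ⟨?_, this⟩
    by_cases h : b = 0
    · simp [h]
    · exact (this h).le
  have hcn : ∀ F ∈ s, 0 ≤ -((-1 : ℝ) ^ k * degC F (c F * c F * lC F ^ m)) ∧
      (c F ≠ 0 → 0 < -((-1 : ℝ) ^ k * degC F (c F * c F * lC F ^ m))) := by
    intro F hF
    have hcF := hc F hF
    have hde := D.hde F hF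
    rcases k with _ | k
    · have : c F = 0 := by simpa [shift] using hcF
      simp [this]
    · have := hHC F hF k m (by omega) _ hcF (hprim.2 F hF)
      have e2 : -((-1 : ℝ) ^ (k+1) * degC F (c F * c F * lC F ^ m)) =
        (-1 : ℝ) ^ k * degC F (c F * c F * lC F ^ m) := by rw [pow_succ]; ring
      rw [e2]
      refine ⟨?_, this⟩
      by_cases h : c F = 0
      · simp [h]
      · exact (this h).le
  by_cases hb0 : b = 0
  · have : ∃ F ∈ s, c F ≠ 0 := by
      by_contra hcon
      push Not at hcon
      apply ha0
      rw [hb0, map_zero, zero_add]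
      exact Finset.sum_eq_zero fun F hF => by rw [hcon F hF, map_zero]
    obtain ⟨F, hF, hne⟩ := this
    exact add_pos_of_nonneg_of_pos hbn.1
      (Finset.sum_pos' (fun F hF => (hcn F hF).1) ⟨F, hF, (hcn F hF).2 hne⟩)
  · exact add_pos_of_pos_of_nonneg (hbn.2 hb0) (Finset.sum_nonneg fun F hF => (hcn F hF).1)

end decomp

section dual
variable {B : Type*} [CommRing B] [Algebra ℝ B] {ℬ : ℕ → Submodule ℝ B} {degB : B →ₗ[ℝ] ℝ} {d : ℕ}

/-- second component as a real-linear map -/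
noncomputable def sndL (B : Type*) [CommRing B] [Algebra ℝ B] : DualNumber B →ₗ[ℝ] B where
  toFun := TrivSqZeroExt.snd
  map_add' := by intros; rfl
  map_smul' := by intros; rfl

noncomputable def fstL (B : Type*) [CommRing B] [Algebra ℝ B] : DualNumber B →ₗ[ℝ] B where
  toFun := TrivSqZeroExt.fst
  map_add' := by intros; rfl
  map_smul' := by intros; rfl

noncomputable def dualPiece (ℬ : ℕ → Submodule ℝ B) (k : ℕ) : Submodule ℝ (DualNumber B) :=
  (ℬ k).comap (fstL B) ⊓ (shift ℬ k).comap (sndL B)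

theorem mem_dualPiece {k : ℕ} {z : DualNumber B} :
    z ∈ dualPiece ℬ k ↔ z.fst ∈ ℬ k ∧ z.snd ∈ shift ℬ k := Iff.rfl

noncomputable def dualDeg (degB : B →ₗ[ℝ] ℝ) : DualNumber B →ₗ[ℝ] ℝ := degB ∘ₗ sndL B

theorem snd_mul' (z w : DualNumber B) : (z * w).snd = z.fst * w.snd + w.fst * z.snd := by
  simp [TrivSqZeroExt.snd_mul, mul_comm]

theorem PA.dual (hB : PA ℬ degB d) : PA (dualPiece ℬ) (dualDeg degB) (d + 1) where
  one_mem := ⟨hB.one_mem, Submodule.zero_mem (shift ℬ 0)⟩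
  mul_mem := by
    rintro i j a b ⟨ha1, ha2⟩ ⟨hb1, hb2⟩
    refine ⟨hB.mul_mem _ _ _ _ ha1 hb1, ?_⟩
    show (a * b).snd ∈ shift ℬ (i + j)
    rw [snd_mul']
    change a.fst ∈ ℬ i at ha1
    change b.fst ∈ ℬ j at hb1
    change a.snd ∈ shift ℬ i at ha2
    change b.snd ∈ shift ℬ j at hb2
    refine Submodule.add_mem _ ?_ ?_
    · rcases j with _ | j
      · have : b.snd = 0 := by simpa [shift] using hb2
        rw [this]; simp
      · exact hB.mul_mem _ _ _ _ ha1 hb2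
    · rcases i with _ | i
      · have : a.snd = 0 := by simpa [shift] using ha2
        rw [this]; simp
      · have := hB.mul_mem _ _ _ _ hb1 ha2
        rw [show j + i = i + j by omega] at this
        rw [show i + 1 + j = (i + j) + 1 by omega]
        exact this
  fin := by
    intro k
    have := hB.fin k
    have h2 : Module.Finite ℝ (shift ℬ k) := by
      rcases k with _ | k
      · exact inferInstanceAs (Module.Finite ℝ (⊥ : Submodule ℝ B))
      · exact hB.fin k
    let f : dualPiece ℬ k →ₗ[ℝ] (ℬ k × shift ℬ k) :=
      LinearMap.prod (((fstL B).comp (dualPiece ℬ k).subtype).codRestrict _ (fun z => z.2.1))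
        (((sndL B).comp (dualPiece ℬ k).subtype).codRestrict _ (fun z => z.2.2))
    refine Module.Finite.of_injective f ?_
    intro z w h
    have h1 := congrArg (fun p => (p.1 : B)) h
    have h2 := congrArg (fun p => (p.2 : B)) h
    exact Subtype.ext (TrivSqZeroExt.ext h1 h2)
  top := by
    rintro k hk a ⟨h1, h2⟩
    refine TrivSqZeroExt.ext (hB.top k (by omega) _ h1) ?_
    rcases k with _ | k
    · omega
    · exact hB.top k (by omega) _ h2
  pd := by
    rintro k k' hk a ⟨h1, h2⟩ h
    change a.fst ∈ ℬ k at h1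
    change a.snd ∈ shift ℬ k at h2
    refine TrivSqZeroExt.ext ?_ ?_
    · rcases k' with _ | k'
      · exact hB.top k (by omega) _ h1
      · refine hB.pd k k' (by omega) _ h1 fun b hb => ?_
        have := h (TrivSqZeroExt.inr b) ⟨Submodule.zero_mem (ℬ (k'+1)), hb⟩
        change degB ((a * _).snd) = 0 at this
        rw [snd_mul'] at this
        simpa using this
    · rcases k with _ | k
      · simpa [shift] using h2
      · refine hB.pd k k' (by omega) _ h2 fun b hb => ?_
        have := h (TrivSqZeroExt.inl b) ⟨hb, Submodule.zero_mem (shift ℬ k')⟩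
        change degB ((a * _).snd) = 0 at this
        rw [snd_mul'] at this
        simpa [mul_comm] using this

theorem dual_pow (l : B) (m : ℕ) :
    ((TrivSqZeroExt.inl l + TrivSqZeroExt.inr 1 : DualNumber B) ^ m).fst = l ^ m ∧
    l * ((TrivSqZeroExt.inl l + TrivSqZeroExt.inr 1 : DualNumber B) ^ m).snd = m * l ^ m ∧
    ((TrivSqZeroExt.inl l + TrivSqZeroExt.inr 1 : DualNumber B) ^ (m + 1)).snd
      = (m + 1) * l ^ m := by
  induction m with
  | zero => simp
  | succ m ih =>
    obtain ⟨h1, h2, h3⟩ := ih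
    have h1' : ((TrivSqZeroExt.inl l + TrivSqZeroExt.inr 1 : DualNumber B) ^ (m+1)).fst
      = l ^ (m+1) := by rw [pow_succ, TrivSqZeroExt.fst_mul, h1]; simp [pow_succ]
    refine ⟨h1', ?_, ?_⟩
    · rw [h3]; push_cast; ring
    · rw [pow_succ, snd_mul', h1', h3]; simp; ring

theorem HR.dual (hB : PA ℬ degB d) {l : B} (hl : l ∈ ℬ 1) (h : HR ℬ degB d l) :
    HR (dualPiece ℬ) (dualDeg degB) (d + 1)
      (TrivSqZeroExt.inl l + TrivSqZeroExt.inr 1 : DualNumber B) := by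
  rintro k m hkm z ⟨ha, hb⟩ hz hz0
  change z.fst ∈ ℬ k at ha
  change z.snd ∈ shift ℬ k at hb
  obtain ⟨p1, p2, p3⟩ := dual_pow l m
  obtain ⟨q1, q2, q3⟩ := dual_pow l (m + 1)
  set a := z.fst with hadef
  set b := z.snd with hbdef
  have z1 : l ^ (m + 1) * a = 0 := by
    have := congrArg TrivSqZeroExt.fst hz
    rwa [TrivSqZeroExt.fst_mul, q1] at this
  have z2 : l ^ (m + 1) * b + a * ((m + 1) * l ^ m) = 0 := by
    have := congrArg TrivSqZeroExt.snd hz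
    rwa [snd_mul', q1, p3] at this
  have hab : a ≠ 0 ∨ b ≠ 0 := by
    by_contra hcon
    push Not at hcon
    exact hz0 (TrivSqZeroExt.ext hcon.1 hcon.2)
  show 0 < (-1 : ℝ) ^ k * degB ((z * z * _ ^ m).snd)
  rw [snd_mul', p1, TrivSqZeroExt.fst_mul, snd_mul']
  rcases m with _ | m
  · rcases k with _ | k
    · omega
    change b ∈ ℬ k at hb
    have ea : a = -(l * b) := by
      have : l * b + a = 0 := by simpa using z2
      linear_combination this
    have hb0 : b ≠ 0 := by
      rcases hab with h | h
      · intro hb; apply h; rw [ea, hb]; simp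
      · exact h
    have h2 : l ^ 2 * b = 0 := by
      have : l * a = 0 := by simpa using z1
      rw [ea] at this; linear_combination -this
    have := h k 1 (by omega) b hb h2 hb0
    simp only [pow_zero, TrivSqZeroExt.snd_one, mul_zero, zero_add, one_mul]
    rw [← hadef, ← hbdef]
    have e : a * b + a * b = (-2 : ℝ) • (b * b * l ^ 1) := by
      rw [ea, Algebra.smul_def, map_neg, map_ofNat]; ring
    rw [e, map_smul, smul_eq_mul, pow_succ]
    nlinarith
  · obtain ⟨-, -, p3'⟩ := dual_pow l m
    rw [p3', ← hadef, ← hbdef]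
    set M : ℝ := (m : ℝ) + 2 with hM
    have hMpos : 0 < M := by positivity
    set q : B := -(M⁻¹) • b with hq
    have hbq : b = -(M • q) := by
      rw [hq, smul_smul, ← neg_smul]; field_simp; simp
    set p : B := a - l * q with hp
    have hap : a = p + l * q := by rw [hp]; ring
    have hMa : (algebraMap ℝ B M) = (m : B) + 2 := by
      rw [hM, map_add, map_natCast, map_ofNat]
    have hMs : ∀ y : B, M • y = ((m : B) + 2) * y := by
      intro y; rw [Algebra.smul_def, hMa]
    have hinj : ∀ y : B, ((m:B) + 2) * y = 0 → y = 0 := by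
      intro y hy
      rw [← hMs] at hy
      exact (smul_eq_zero.1 hy).resolve_left hMpos.ne'
    have hp0 : l ^ (m + 1) * p = 0 := by
      apply hinj
      rw [hbq, hMs, hap] at z2
      push_cast at z2
      linear_combination z2
    have hq0 : l ^ (m + 3) * q = 0 := by
      rw [hap] at z1
      linear_combination z1 - l * hp0
    have hqm : q ∈ shift ℬ k := Submodule.smul_mem _ _ hb
    have hpm : p ∈ ℬ k := by
      refine Submodule.sub_mem _ ha ?_
      rcases k with _ | k
      · have : q = 0 := by simpa [shift] using hqm
        rw [this]; simp
      · rw [add_comm]; exact hB.mul_mem _ _ _ _ hl hqm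
    have hP := h k m (by omega) p hpm hp0
    have hP' : 0 ≤ (-1 : ℝ) ^ k * degB (p * p * l ^ m) := by
      by_cases h0 : p = 0
      · simp [h0]
      · exact (hP h0).le
    have hQ : q ≠ 0 → 0 < -((-1 : ℝ) ^ k * degB (q * q * l ^ (m+2))) := by
      intro h0
      rcases k with _ | k
      · exact absurd (by simpa [shift] using hqm) h0
      · have := h k (m+2) (by omega) q hqm hq0 h0
        rw [pow_succ]; linarith
    have hQ' : 0 ≤ -((-1 : ℝ) ^ k * degB (q * q * l ^ (m+2))) := by
      by_cases h0 : q = 0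
      · simp [h0]
      · exact (hQ h0).le
    have e : a * a * (((m : B) + 1) * l ^ m) + l ^ (m + 1) * (a * b + a * b) =
        ((m : ℝ) + 1) • (p * p * l ^ m) - ((m : ℝ) + 3) • (q * q * l ^ (m + 2)) := by
      rw [hbq, hMs, hap]
      simp only [Algebra.smul_def, map_add, map_natCast, map_one, map_ofNat]
      linear_combination (-2 * q * (m + 2) + 2 * (m + 1) * q ) * hp0
    rw [e, map_sub, map_smul, map_smul, smul_eq_mul, smul_eq_mul]
    have hm0 : (0:ℝ) ≤ m := Nat.cast_nonneg m
    by_cases hq00 : q = 0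
    · have hp00 : p ≠ 0 := by
        intro hp00
        rcases hab with h | h
        · apply h; rw [hap, hp00, hq00]; simp
        · apply h; rw [hbq, hq00]; simp
      have := hP hp00
      nlinarith
    · have := hQ hq00
      nlinarith

end dual

end HRProof


namespace HRProof

section comb
variable {E : Type*} [Fintype E] [DecidableEq E]

/-- comparability -/
def cmp (S T : Finset E) : Prop := S ⊆ T ∨ T ⊆ S

theorem cmp.symm {S T : Finset E} (h : cmp S T) : cmp T S := Or.symm h
theorem cmp_refl (S : Finset E) : cmp S S := Or.inl (Finset.Subset.refl S)

structure FlatFam (L : Set (Finset E)) : Prop where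
  univ_mem : Finset.univ ∈ L
  inter_mem : ∀ S ∈ L, ∀ T ∈ L, S ∩ T ∈ L
  cover : ∀ F ∈ L, ∀ a, a ∉ F → ∃ G ∈ L, F ⊆ G ∧ a ∈ G ∧
    ∀ H ∈ L, F ⊆ H → ∀ b ∈ H, b ∈ G → b ∉ F → G ⊆ H

structure IsFlag (L : Set (Finset E)) (σ : Finset (Finset E)) : Prop where
  mem : ∀ S ∈ σ, S ∈ L
  chain : ∀ S ∈ σ, ∀ T ∈ σ, cmp S T

/-- every maximal flag has `N` elements -/
def Graded (L : Set (Finset E)) (N : ℕ) : Prop :=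
  ∀ σ, IsFlag L σ → (∀ S ∈ L, (∀ T ∈ σ, cmp S T) → S ∈ σ) → σ.card = N

structure Base (L : Set (Finset E)) (σ : Finset (Finset E)) : Prop extends IsFlag L σ where
  univ_mem : Finset.univ ∈ σ
  bot : ∃ P ∈ σ, ∀ S ∈ L, P ⊆ S

/-- link of a flag -/
def Lk (L : Set (Finset E)) (σ : Finset (Finset E)) : Set (Finset E) :=
  {S | S ∈ L ∧ S ∉ σ ∧ ∀ T ∈ σ, cmp S T}

theorem IsFlag.insert {L : Set (Finset E)} {σ : Finset (Finset E)} (h : IsFlag L σ)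
    {S : Finset E} (hS : S ∈ L) (hc : ∀ T ∈ σ, cmp S T) : IsFlag L (insert S σ) := by
  refine ⟨?_, ?_⟩
  · intro T hT
    rcases Finset.mem_insert.1 hT with rfl | hT
    · exact hS
    · exact h.mem T hT
  · intro T hT U hU
    rcases Finset.mem_insert.1 hT with hT' | hT' <;> rcases Finset.mem_insert.1 hU with hU' | hU'
    · rw [hT', hU']; exact cmp_refl _
    · rw [hT']; exact hc _ hU'
    · rw [hU']; exact (hc _ hT').symm
    · exact h.chain _ hT' _ hU'

theorem Graded.card_le {L : Set (Finset E)} {N : ℕ} (hN : Graded L N) {σ : Finset (Finset E)}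
    (h : IsFlag L σ) : σ.card ≤ N := by
  -- induct on number of sets outside
  generalize hn : (Finset.univ \ σ).card = n
  induction n using Nat.strong_induction_on generalizing σ with
  | _ n ih =>
    by_cases hmax : ∀ S ∈ L, (∀ T ∈ σ, cmp S T) → S ∈ σ
    · exact (hN σ h hmax).le
    · push Not at hmax
      obtain ⟨S, hS, hc, hSσ⟩ := hmax
      have hlt : (Finset.univ \ insert S σ).card < n := by
        rw [← hn]
        apply Finset.card_lt_card
        refine ⟨Finset.sdiff_subset_sdiff le_rfl (Finset.subset_insert _ _), ?_⟩
        intro hsub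
        have := hsub (show S ∈ Finset.univ \ σ by simp [hSσ])
        simp at this
      have := ih _ hlt (h.insert hS hc) rfl
      rw [Finset.card_insert_of_notMem hSσ] at this
      omega

theorem Base.insert {L : Set (Finset E)} {σ : Finset (Finset E)} (h : Base L σ)
    {S : Finset E} (hS : S ∈ Lk L σ) : Base L (insert S σ) where
  toIsFlag := h.toIsFlag.insert hS.1 hS.2.2
  univ_mem := Finset.mem_insert_of_mem h.univ_mem
  bot := by
    obtain ⟨P, hP, h'⟩ := h.bot
    exact ⟨P, Finset.mem_insert_of_mem hP, h'⟩

theorem Graded.card_eq {L : Set (Finset E)} {N : ℕ} (hN : Graded L N) {σ : Finset (Finset E)}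
    (h : IsFlag L σ) (hL : Lk L σ = ∅) : σ.card = N := by
  refine hN σ h fun S hS hc => ?_
  by_contra hcon
  have : S ∈ Lk L σ := ⟨hS, hcon, hc⟩
  rw [hL] at this
  exact this

theorem Graded.card_lt {L : Set (Finset E)} {N : ℕ} (hN : Graded L N) {σ : Finset (Finset E)}
    (h : Base L σ) {S : Finset E} (hS : S ∈ Lk L σ) : σ.card < N := by
  have := hN.card_le (h.insert hS).toIsFlag
  rw [Finset.card_insert_of_notMem hS.2.1] at this
  omega

/-- flags obtained by adding a chain of the link -/
theorem Graded.card_union_le {L : Set (Finset E)} {N : ℕ} (hN : Graded L N)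
    {σ : Finset (Finset E)} (h : Base L σ) {c : Finset (Finset E)} (hc : ∀ S ∈ c, S ∈ Lk L σ)
    (hcc : ∀ S ∈ c, ∀ T ∈ c, cmp S T) : c.card + σ.card ≤ N := by
  have hd : Disjoint c σ := Finset.disjoint_left.2 fun S hS => (hc S hS).2.1
  rw [← Finset.card_union_of_disjoint hd]
  refine hN.card_le ⟨?_, ?_⟩
  · intro S hS
    rcases Finset.mem_union.1 hS with hS | hS
    · exact (hc S hS).1
    · exact h.mem S hS
  · intro S hS T hT
    rcases Finset.mem_union.1 hS with hS | hS <;> rcases Finset.mem_union.1 hT with hT | hT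
    · exact hcc S hS T hT
    · exact (hc S hS).2.2 T hT
    · exact ((hc T hT).2.2 S hS).symm
    · exact h.chain S hS T hT

theorem chain_min {c : Finset (Finset E)} (hcc : ∀ S ∈ c, ∀ T ∈ c, cmp S T) (hne : c.Nonempty) :
    ∃ S ∈ c, ∀ T ∈ c, S ⊆ T := by
  obtain ⟨S, hS, hmin⟩ := Finset.exists_min_image c Finset.card hne
  refine ⟨S, hS, fun T hT => ?_⟩
  rcases hcc S hS T hT with h | h
  · exact h
  · exact (Finset.eq_of_subset_of_card_le h (hmin T hT)).symm ▸ Finset.Subset.refl _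

theorem chain_max {c : Finset (Finset E)} (hcc : ∀ S ∈ c, ∀ T ∈ c, cmp S T) (hne : c.Nonempty) :
    ∃ S ∈ c, ∀ T ∈ c, T ⊆ S := by
  obtain ⟨S, hS, hmin⟩ := Finset.exists_max_image c Finset.card hne
  refine ⟨S, hS, fun T hT => ?_⟩
  rcases hcc S hS T hT with h | h
  · exact (Finset.eq_of_subset_of_card_le h (hmin T hT)) ▸ Finset.Subset.refl _
  · exact h

/-- a gap of a flag around an element `i` -/
structure Gap (σ : Finset (Finset E)) (i : E) (P Q : Finset E) : Prop where
  P_mem : P ∈ σ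
  Q_mem : Q ∈ σ
  iP : i ∉ P
  iQ : i ∈ Q
  lo : ∀ T ∈ σ, i ∉ T → T ⊆ P
  hi : ∀ T ∈ σ, i ∈ T → Q ⊆ T

theorem Gap.PQ {L : Set (Finset E)} {σ : Finset (Finset E)} {i : E} {P Q : Finset E}
    (h : IsFlag L σ) (g : Gap σ i P Q) : P ⊆ Q := by
  rcases h.chain P g.P_mem Q g.Q_mem with h | h
  · exact h
  · exact absurd (h g.iQ) g.iP

theorem exists_gap {L : Set (Finset E)} {σ : Finset (Finset E)} (h : Base L σ) {i : E}
    {P0 : Finset E} (hP0 : P0 ∈ σ) (hi : i ∉ P0) : ∃ P Q, Gap σ i P Q := by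
  classical
  obtain ⟨P, hP, hPm⟩ := chain_max (c := σ.filter fun T => i ∉ T)
    (fun S hS T hT => h.chain S (Finset.mem_filter.1 hS).1 T (Finset.mem_filter.1 hT).1)
    ⟨P0, by simp [hP0, hi]⟩
  obtain ⟨Q, hQ, hQm⟩ := chain_min (c := σ.filter fun T => i ∈ T)
    (fun S hS T hT => h.chain S (Finset.mem_filter.1 hS).1 T (Finset.mem_filter.1 hT).1)
    ⟨Finset.univ, by simp [h.univ_mem]⟩
  rw [Finset.mem_filter] at hP hQ
  exact ⟨P, Q, hP.1, hQ.1, hP.2, hQ.2, fun T hT hi => hPm T (by simp [hT, hi]),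
    fun T hT hi => hQm T (by simp [hT, hi])⟩

/-- gap around a link element -/
theorem exists_gap_of_link {L : Set (Finset E)} {σ : Finset (Finset E)} (h : Base L σ)
    {F : Finset E} (hF : F ∈ Lk L σ) : ∃ i P Q, Gap σ i P Q ∧ i ∈ F ∧ P ⊂ F ∧ F ⊂ Q := by
  classical
  obtain ⟨P0, hP0, hbot⟩ := h.bot
  obtain ⟨P, hP, hPm⟩ := chain_max (c := σ.filter fun T => T ⊆ F)
    (fun S hS T hT => h.chain S (Finset.mem_filter.1 hS).1 T (Finset.mem_filter.1 hT).1)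
    ⟨P0, by simp [hP0, hbot F hF.1]⟩
  rw [Finset.mem_filter] at hP
  have hPF : P ⊂ F := lt_of_le_of_ne hP.2 (by rintro rfl; exact hF.2.1 hP.1)
  obtain ⟨i, hiF, hiP⟩ := Finset.exists_of_ssubset hPF
  obtain ⟨P', Q, g⟩ := exists_gap h hP.1 hiP
  have e : P' = P := by
    refine Finset.Subset.antisymm (hPm P' ?_) (g.lo P hP.1 hiP)
    rw [Finset.mem_filter]
    refine ⟨g.P_mem, ?_⟩
    rcases hF.2.2 P' g.P_mem with h | h
    · exact absurd (h hiF) g.iP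
    · exact h
  subst e
  refine ⟨i, P', Q, g, hiF, hPF, ?_⟩
  rcases hF.2.2 Q g.Q_mem with h | h
  · exact lt_of_le_of_ne h (by rintro rfl; exact hF.2.1 g.Q_mem)
  · exact absurd (hPm Q (by simp [g.Q_mem, h]) g.iQ) hiP

/-- where link elements sit relative to a gap -/
theorem Gap.trichotomy {L : Set (Finset E)} {σ : Finset (Finset E)} {i : E} {P Q : Finset E}
    (g : Gap σ i P Q) {S : Finset E} (hS : S ∈ Lk L σ) :
    S ⊂ P ∨ (P ⊂ S ∧ S ⊂ Q) ∨ Q ⊂ S := by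
  have hne : ∀ T ∈ σ, S ≠ T := by rintro T hT rfl; exact hS.2.1 hT
  rcases hS.2.2 P g.P_mem with h | h
  · exact Or.inl (lt_of_le_of_ne h (hne P g.P_mem))
  · have hP := lt_of_le_of_ne h (hne P g.P_mem).symm
    rcases hS.2.2 Q g.Q_mem with h | h
    · exact Or.inr (Or.inl ⟨hP, lt_of_le_of_ne h (hne Q g.Q_mem)⟩)
    · exact Or.inr (Or.inr (lt_of_le_of_ne h (hne Q g.Q_mem).symm))

/-- sets of the gap are comparable to everything in the flag -/
theorem Gap.mem_link {L : Set (Finset E)} {σ : Finset (Finset E)} {i : E} {P Q : Finset E}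
    (g : Gap σ i P Q) {S : Finset E} (hS : S ∈ L) (h1 : P ⊂ S) (h2 : S ⊂ Q) :
    S ∈ Lk L σ := by
  refine ⟨hS, ?_, ?_⟩
  · intro hSσ
    by_cases hi : i ∈ S
    · exact h2.2 (g.hi S hSσ hi)
    · exact h1.2 (g.lo S hSσ hi)
  · intro T hT
    by_cases hi : i ∈ T
    · exact Or.inl (h2.1.trans (g.hi T hT hi))
    · exact Or.inr ((g.lo T hT hi).trans h1.1)

/-! Deletion -/

/-- flats of the deletion of `i`, encoded as sets containing `i` -/
def del (L : Set (Finset E)) (i : E) : Set (Finset E) := {S | i ∈ S ∧ (S ∈ L ∨ S.erase i ∈ L)}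

theorem erase_mem_of_subset {L : Set (Finset E)} (hL : FlatFam L) {i : E} {S T : Finset E}
    (hST : S ⊆ T) (hS : S ∈ L ∨ S.erase i ∈ L) (hT : T.erase i ∈ L) : S.erase i ∈ L := by
  rcases hS with h | h
  · have := hL.inter_mem S h _ hT
    convert this using 1
    ext e; simp only [Finset.mem_erase, Finset.mem_inter]
    exact ⟨fun h => ⟨h.2, h.1, hST h.2⟩, fun h => ⟨h.2.1, h.1⟩⟩
  · exact h

theorem FlatFam.del {L : Set (Finset E)} (hL : FlatFam L) (i : E) : FlatFam (del L i) where
  univ_mem := ⟨Finset.mem_univ _, Or.inl hL.univ_mem⟩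
  inter_mem := by
    rintro S ⟨hiS, hS⟩ T ⟨hiT, hT⟩
    refine ⟨Finset.mem_inter.2 ⟨hiS, hiT⟩, ?_⟩
    have e1 : (S ∩ T).erase i = S.erase i ∩ T.erase i := by
      ext e; simp only [Finset.mem_erase, Finset.mem_inter]; tauto
    have e2 : (S ∩ T).erase i = S ∩ T.erase i := by
      ext e; simp only [Finset.mem_erase, Finset.mem_inter]; tauto
    have e3 : (S ∩ T).erase i = S.erase i ∩ T := by
      ext e; simp only [Finset.mem_erase, Finset.mem_inter]; tauto
    rcases hS with hS | hS <;> rcases hT with hT | hT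
    · exact Or.inl (hL.inter_mem _ hS _ hT)
    · exact Or.inr (e2 ▸ hL.inter_mem _ hS _ hT)
    · exact Or.inr (e3 ▸ hL.inter_mem _ hS _ hT)
    · exact Or.inr (e1 ▸ hL.inter_mem _ hS _ hT)
  cover := by
    rintro S ⟨hiS, hS⟩ a ha
    have hai : a ≠ i := by rintro rfl; exact ha hiS
    by_cases hSi : S.erase i ∈ L
    · obtain ⟨G, hG, hSG, haG, hcov⟩ := hL.cover _ hSi a (by simp [ha])
      refine ⟨insert i G, ⟨Finset.mem_insert_self _ _, ?_⟩, ?_, by simp [haG], ?_⟩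
      · by_cases hiG : i ∈ G
        · left; rwa [Finset.insert_eq_of_mem hiG]
        · right; rwa [Finset.erase_insert hiG]
      · intro e he
        by_cases hei : e = i
        · simp [hei]
        · exact Finset.mem_insert_of_mem (hSG (by simp [hei, he]))
      · rintro H ⟨hiH, hH⟩ hSH b hbH hbG hbS
        have hbi : b ≠ i := by rintro rfl; exact hbS hiS
        have hbG' : b ∈ G := by simpa [hbi] using hbG
        have hGH : G ⊆ H := by
          rcases hH with hH | hH
          · exact hcov H hH ((Finset.erase_subset _ _).trans hSH) b hbH hbG' (by simp [hbS])
          · exact (hcov _ hH (Finset.erase_subset_erase _ hSH) b (by simp [hbH, hbi]) hbG'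
              (by simp [hbS])).trans (Finset.erase_subset _ _)
        exact Finset.insert_subset hiH hGH
    · have hSL : S ∈ L := hS.resolve_right hSi
      obtain ⟨G, hG, hSG, haG, hcov⟩ := hL.cover _ hSL a ha
      refine ⟨G, ⟨hSG hiS, Or.inl hG⟩, hSG, haG, ?_⟩
      rintro H ⟨hiH, hH⟩ hSH b hbH hbG hbS
      rcases hH with hH | hH
      · exact hcov H hH hSH b hbH hbG hbS
      · exact absurd (erase_mem_of_subset hL hSH (Or.inl hSL) hH) hSi

open Classical in
/-- lift of a deletion flat to a flat -/
noncomputable def lift (L : Set (Finset E)) (i : E) (S : Finset E) : Finset E :=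
  if S.erase i ∈ L then S.erase i else S

theorem lift_mem {L : Set (Finset E)} {i : E} {S : Finset E} (hS : S ∈ del L i) :
    lift L i S ∈ L := by
  unfold lift
  split_ifs with h
  · exact h
  · exact hS.2.resolve_right h

theorem insert_lift {L : Set (Finset E)} {i : E} {S : Finset E} (hS : i ∈ S) :
    insert i (lift L i S) = S := by
  unfold lift
  split_ifs with h
  · exact Finset.insert_erase hS
  · exact Finset.insert_eq_of_mem hS

theorem lift_mono {L : Set (Finset E)} (hL : FlatFam L) {i : E} {S T : Finset E}
    (hS : S ∈ del L i) (hST : S ⊆ T) : lift L i S ⊆ lift L i T := by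
  unfold lift
  by_cases hT : T.erase i ∈ L
  · rw [if_pos hT, if_pos (erase_mem_of_subset hL hST hS.2 hT)]
    exact Finset.erase_subset_erase _ hST
  · rw [if_neg hT]
    split_ifs
    · exact (Finset.erase_subset _ _).trans hST
    · exact hST

theorem cmp_insert {S T : Finset E} (i : E) (h : cmp S T) : cmp (insert i S) (insert i T) :=
  h.imp (Finset.insert_subset_insert i) (Finset.insert_subset_insert i)

theorem Graded.del {L : Set (Finset E)} (hL : FlatFam L) {N : ℕ} (hN : Graded L N) {i : E}
    (hi : Finset.univ.erase i ∉ L) : Graded (del L i) N := by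
  classical
  intro τ hτ hmax
  have hinj : Set.InjOn (lift L i) τ := by
    intro S hS T hT h
    rw [← insert_lift (L := L) (hτ.mem S hS).1, ← insert_lift (L := L) (hτ.mem T hT).1, h]
  rw [← Finset.card_image_of_injOn hinj]
  refine hN _ ⟨?_, ?_⟩ ?_
  · intro S hS
    obtain ⟨T, hT, rfl⟩ := Finset.mem_image.1 hS
    exact lift_mem (hτ.mem T hT)
  · intro S hS S' hS'
    obtain ⟨T, hT, rfl⟩ := Finset.mem_image.1 hS
    obtain ⟨T', hT', rfl⟩ := Finset.mem_image.1 hS'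
    exact (hτ.chain T hT T' hT').imp (lift_mono hL (hτ.mem T hT)) (lift_mono hL (hτ.mem T' hT'))
  · intro S hS hc
    by_contra hSn
    have hins : insert i S ∈ τ := by
      refine hmax _ ⟨Finset.mem_insert_self _ _, ?_⟩ ?_
      · by_cases hiS : i ∈ S
        · left; rwa [Finset.insert_eq_of_mem hiS]
        · right; rwa [Finset.erase_insert hiS]
      · intro T hT
        rw [← insert_lift (L := L) (hτ.mem T hT).1]
        exact cmp_insert i (hc _ (Finset.mem_image_of_mem _ hT))
    have hiS : i ∈ S := by
      by_contra hiS
      apply hSn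
      refine Finset.mem_image.2 ⟨_, hins, ?_⟩
      unfold lift
      rw [Finset.erase_insert hiS, if_pos hS]
    rw [Finset.insert_eq_of_mem hiS] at hins
    have hSi : S.erase i ∈ L := by
      by_contra hSi
      apply hSn
      exact Finset.mem_image.2 ⟨_, hins, by unfold lift; rw [if_neg hSi]⟩
    -- `S` is the maximum of those `T` with `T \ i` flat
    have hSmax : ∀ T ∈ τ, T.erase i ∈ L → T ⊆ S := by
      intro T hT hTi
      have hiT := (hτ.mem T hT).1
      have h1 := hc _ (Finset.mem_image_of_mem _ hT)
      unfold lift at h1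
      rw [if_pos hTi] at h1
      rcases h1 with h1 | h1
      · exact absurd (h1 hiS) (by simp)
      · intro e he
        by_cases hei : e = i
        · rwa [hei]
        · exact h1 (by simp [hei, he])
    have hunivτ : Finset.univ ∈ τ :=
      hmax _ ⟨Finset.mem_univ _, Or.inl hL.univ_mem⟩ fun T _ => Or.inr (Finset.subset_univ _)
    have hSu : S ≠ Finset.univ := by rintro rfl; exact hi hSi
    obtain ⟨T, hT, hTm⟩ := chain_min (c := τ.filter fun T => S ⊂ T)
      (fun S hS T hT => hτ.chain S (Finset.mem_filter.1 hS).1 T (Finset.mem_filter.1 hT).1)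
      ⟨Finset.univ, by
        rw [Finset.mem_filter]; exact ⟨hunivτ, lt_of_le_of_ne (Finset.subset_univ _) hSu⟩⟩
    rw [Finset.mem_filter] at hT
    obtain ⟨hTτ, hST⟩ := hT
    have hTi : T.erase i ∉ L := fun h => hST.2 (hSmax T hTτ h)
    have hTL : T ∈ L := (hτ.mem T hTτ).2.resolve_right hTi
    obtain ⟨a, haT, haS⟩ := Finset.exists_of_ssubset hST
    obtain ⟨G, hG, hSG, haG, hcov⟩ := hL.cover _ hSi a (by simp [haS])
    have hai : a ≠ i := by rintro rfl; exact haS hiS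
    have hGT : G ⊆ T := hcov T hTL ((Finset.erase_subset _ _).trans hST.1) a haT haG (by simp [haS])
    have hiG : i ∉ G := by
      intro hiG
      exact haS (hcov S hS (Finset.erase_subset _ _) i hiS hiG (by simp) haG)
    have hSG' : S ⊂ insert i G := by
      refine ⟨?_, fun h => haS (h (by simp [haG]))⟩
      rw [← Finset.insert_erase hiS]
      exact Finset.insert_subset_insert i hSG
    have hGT' : insert i G ⊆ T := Finset.insert_subset (hST.1 hiS) hGT
    have hGτ : insert i G ∈ τ := by
      refine hmax _ ⟨by simp, Or.inr (by rwa [Finset.erase_insert hiG])⟩ fun U hU => ?_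
      rcases hτ.chain S hins U hU with h | h
      · by_cases hSU : S = U
        · rw [← hSU]; exact Or.inr hSG'.1
        · left
          refine hGT'.trans (hTm U ?_)
          rw [Finset.mem_filter]; exact ⟨hU, lt_of_le_of_ne h hSU⟩
      · exact Or.inr (h.trans hSG'.1)
    have := hSmax _ hGτ (by rwa [Finset.erase_insert hiG])
    exact hSG'.2 this

end comb

end HRProof


namespace HRProof

open MvPolynomial

section ring
variable {E : Type*} [Fintype E] [DecidableEq E]

/-- affine functions on sets -/
def Aff (μ : Finset E → ℝ) : Prop := ∃ (c : ℝ) (w : E → ℝ), ∀ S, μ S = c + ∑ e ∈ S, w e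

/-- defining relations -/
def rel (L : Set (Finset E)) (σ : Finset (Finset E)) : Set (MvPolynomial (Finset E) ℝ) :=
  {p | (∃ S, S ∉ Lk L σ ∧ p = X S) ∨ (∃ S T, ¬ cmp S T ∧ p = X S * X T) ∨
    (∃ μ, Aff μ ∧ (∀ T ∈ σ, μ T = 0) ∧ p = ∑ S, C (μ S) * X S)}

/-- Chow ring of a flag in a flat family -/
def CR (L : Set (Finset E)) (σ : Finset (Finset E)) : Type _ :=
  MvPolynomial (Finset E) ℝ ⧸ Ideal.span (rel L σ)

noncomputable instance (L : Set (Finset E)) (σ : Finset (Finset E)) : CommRing (CR L σ) :=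
  inferInstanceAs (CommRing (MvPolynomial (Finset E) ℝ ⧸ Ideal.span (rel L σ)))

noncomputable instance (L : Set (Finset E)) (σ : Finset (Finset E)) : Algebra ℝ (CR L σ) :=
  inferInstanceAs (Algebra ℝ (MvPolynomial (Finset E) ℝ ⧸ Ideal.span (rel L σ)))

noncomputable def mk (L : Set (Finset E)) (σ : Finset (Finset E)) :
    MvPolynomial (Finset E) ℝ →ₐ[ℝ] CR L σ := Ideal.Quotient.mkₐ ℝ (Ideal.span (rel L σ))

theorem mk_surj (L : Set (Finset E)) (σ : Finset (Finset E)) : Function.Surjective (mk L σ) :=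
  Ideal.Quotient.mkₐ_surjective ℝ _

theorem mk_eq_zero {L : Set (Finset E)} {σ : Finset (Finset E)} {p : MvPolynomial (Finset E) ℝ} :
    mk L σ p = 0 ↔ p ∈ Ideal.span (rel L σ) := Ideal.Quotient.eq_zero_iff_mem

noncomputable def xx (L : Set (Finset E)) (σ : Finset (Finset E)) (S : Finset E) : CR L σ :=
  mk L σ (X S)

noncomputable def ell (L : Set (Finset E)) (σ : Finset (Finset E)) (c : Finset E → ℝ) : CR L σ :=
  ∑ S, c S • xx L σ S

noncomputable def piece (L : Set (Finset E)) (σ : Finset (Finset E)) (k : ℕ) :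
    Submodule ℝ (CR L σ) := (homogeneousSubmodule (Finset E) ℝ k).map (mk L σ).toLinearMap

variable {L : Set (Finset E)} {σ : Finset (Finset E)}

theorem aeval_xx (p : MvPolynomial (Finset E) ℝ) : aeval (xx L σ) p = mk L σ p := by
  have : aeval (xx L σ) = mk L σ := by
    apply MvPolynomial.algHom_ext
    intro S; simp [xx]
  rw [this]

theorem xx_eq_zero {S : Finset E} (h : S ∉ Lk L σ) : xx L σ S = 0 :=
  mk_eq_zero.2 (Ideal.subset_span (Or.inl ⟨S, h, rfl⟩))

theorem xx_mul_eq_zero {S T : Finset E} (h : ¬ cmp S T) : xx L σ S * xx L σ T = 0 := by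
  rw [xx, xx, ← map_mul]
  exact mk_eq_zero.2 (Ideal.subset_span (Or.inr (Or.inl ⟨S, T, h, rfl⟩)))

theorem mk_lin (c : Finset E → ℝ) : mk L σ (∑ S, C (c S) * X S) = ell L σ c := by
  rw [map_sum, ell]
  refine Finset.sum_congr rfl fun S _ => ?_
  rw [C_mul', map_smul, xx]

theorem ell_aff {μ : Finset E → ℝ} (h : Aff μ) (h0 : ∀ T ∈ σ, μ T = 0) : ell L σ μ = 0 := by
  rw [← mk_lin]
  exact mk_eq_zero.2 (Ideal.subset_span (Or.inr (Or.inr ⟨μ, h, h0, rfl⟩)))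

theorem ell_add (c c' : Finset E → ℝ) : ell L σ (fun S => c S + c' S) = ell L σ c + ell L σ c' := by
  simp [ell, add_smul, Finset.sum_add_distrib]

theorem ell_sub (c c' : Finset E → ℝ) : ell L σ (fun S => c S - c' S) = ell L σ c - ell L σ c' := by
  simp [ell, sub_smul, Finset.sum_sub_distrib]

theorem ell_smul (r : ℝ) (c : Finset E → ℝ) : ell L σ (fun S => r * c S) = r • ell L σ c := by
  simp [ell, mul_smul, Finset.smul_sum]

theorem ell_congr {c c' : Finset E → ℝ} (h : ∀ S ∈ Lk L σ, c S = c' S) :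
    ell L σ c = ell L σ c' := by
  refine Finset.sum_congr rfl fun S _ => ?_
  by_cases hS : S ∈ Lk L σ
  · rw [h S hS]
  · rw [xx_eq_zero hS]; simp

theorem mk_mem {k : ℕ} {p : MvPolynomial (Finset E) ℝ} (h : p.IsHomogeneous k) :
    mk L σ p ∈ piece L σ k := ⟨p, h, rfl⟩

theorem xx_mem (S : Finset E) : xx L σ S ∈ piece L σ 1 := mk_mem (isHomogeneous_X ℝ S)

theorem ell_mem (c : Finset E → ℝ) : ell L σ c ∈ piece L σ 1 :=
  Submodule.sum_mem _ fun S _ => Submodule.smul_mem _ _ (xx_mem S)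

theorem piece_one_mem : (1 : CR L σ) ∈ piece L σ 0 := by
  have := mk_mem (L := L) (σ := σ) (isHomogeneous_one (Finset E) ℝ)
  simpa using this

theorem piece_mul_mem (i j : ℕ) (a b : CR L σ) (ha : a ∈ piece L σ i) (hb : b ∈ piece L σ j) :
    a * b ∈ piece L σ (i + j) := by
  obtain ⟨p, hp, rfl⟩ := ha
  obtain ⟨q, hq, rfl⟩ := hb
  refine ⟨p * q, ?_, by simp⟩
  exact IsHomogeneous.mul hp hq

theorem hom_ind {Pr : ℕ → MvPolynomial (Finset E) ℝ → Prop} (h1 : Pr 0 1)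
    (h0 : ∀ k, Pr k 0) (hadd : ∀ k p q, Pr k p → Pr k q → Pr k (p + q))
    (hsmul : ∀ k (r : ℝ) p, Pr k p → Pr k (r • p))
    (hX : ∀ k p S, Pr k p → Pr (k + 1) (X S * p)) :
    ∀ k p, IsHomogeneous p k → Pr k p := by
  have hmon : ∀ k, ∀ m : Finset E →₀ ℕ, m.degree = k → Pr k (monomial m 1) := by
    intro k
    induction k with
    | zero =>
      intro m hm
      rw [Finsupp.degree_eq_zero_iff] at hm
      subst hm
      simpa using h1
    | succ k ih =>
      intro m hm
      have hne : m ≠ 0 := by rintro rfl; simp at hm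
      obtain ⟨S, hS⟩ := Finsupp.support_nonempty_iff.2 hne
      have hle : Finsupp.single S 1 ≤ m := by
        rw [Finsupp.single_le_iff]
        exact Nat.one_le_iff_ne_zero.2 (Finsupp.mem_support_iff.1 hS)
      have hsplit : Finsupp.single S 1 + (m - Finsupp.single S 1) = m := add_tsub_cancel_of_le hle
      have hd : (m - Finsupp.single S 1).degree = k := by
        have := congrArg Finsupp.degree hsplit
        rw [map_add, hm, Finsupp.degree_single] at this
        omega
      have := hX k _ S (ih _ hd)
      rw [X, monomial_mul, hsplit] at this
      simpa using this
  intro k p hp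
  have hsum : ∀ t : Finset (Finset E →₀ ℕ), t ⊆ p.support →
      Pr k (∑ m ∈ t, monomial m (p.coeff m)) := by
    intro t
    induction t using Finset.induction_on with
    | empty => intro _; simpa using h0 k
    | insert m t hm ih =>
      intro ht
      rw [Finset.sum_insert hm]
      refine hadd _ _ _ ?_ (ih ((Finset.subset_insert _ _).trans ht))
      have hmk : m.degree = k := by
        have hc := ht (Finset.mem_insert_self m t)
        rw [mem_support_iff] at hc
        have := hp hc
        rw [Finsupp.degree_eq_weight_one]
        exact this
      have := hsmul k (p.coeff m) _ (hmon k m hmk)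
      rwa [smul_monomial, smul_eq_mul, mul_one] at this
  have := hsum _ (Finset.Subset.refl _)
  rwa [support_sum_monomial_coeff] at this

theorem piece_ind {Pr : ℕ → CR L σ → Prop} (h1 : Pr 0 1)
    (h0 : ∀ k, Pr k 0) (hadd : ∀ k p q, Pr k p → Pr k q → Pr k (p + q))
    (hsmul : ∀ k (r : ℝ) p, Pr k p → Pr k (r • p))
    (hX : ∀ k p, ∀ S ∈ Lk L σ, Pr k p → Pr (k + 1) (xx L σ S * p)) :
    ∀ k, ∀ a ∈ piece L σ k, Pr k a := by
  rintro k _ ⟨p, hp, rfl⟩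
  refine hom_ind (Pr := fun k p => Pr k (mk L σ p)) ?_ ?_ ?_ ?_ ?_ k p hp
  · simpa using h1
  · intro k; simpa using h0 k
  · intro k p q hp hq; simpa using hadd k _ _ hp hq
  · intro k r p hp; simpa using hsmul k r _ hp
  · intro k p S hp
    by_cases hS : S ∈ Lk L σ
    · simpa [xx] using hX k _ S hS hp
    · have := xx_eq_zero hS
      rw [xx] at this
      simpa [this] using h0 (k + 1)

theorem piece_succ_le (k : ℕ) : piece L σ (k + 1) ≤
    ⨆ S : Finset E, (piece L σ k).map (LinearMap.mulLeft ℝ (xx L σ S)) := by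
  intro a ha
  have := piece_ind (L := L) (σ := σ) (Pr := fun k a => a ∈ piece L σ k ∧ ∀ k', k = k' + 1 →
    a ∈ ⨆ S : Finset E, (piece L σ k').map (LinearMap.mulLeft ℝ (xx L σ S)))
    ⟨piece_one_mem, by intro k' h; omega⟩ (fun k => ⟨Submodule.zero_mem _, fun _ _ =>
      Submodule.zero_mem _⟩) ?_ ?_ ?_ (k + 1) a ha
  · exact this.2 k rfl
  · rintro k p q ⟨h1, h2⟩ ⟨h3, h4⟩
    exact ⟨Submodule.add_mem _ h1 h3, fun k' h => Submodule.add_mem _ (h2 k' h) (h4 k' h)⟩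
  · rintro k r p ⟨h1, h2⟩
    exact ⟨Submodule.smul_mem _ _ h1, fun k' h => Submodule.smul_mem _ _ (h2 k' h)⟩
  · rintro k p S hS ⟨h1, h2⟩
    refine ⟨by rw [add_comm k 1]; exact piece_mul_mem _ _ _ _ (xx_mem S) h1, fun k' h => ?_⟩
    obtain rfl : k = k' := by omega
    exact Submodule.mem_iSup_of_mem S ⟨p, h1, rfl⟩

theorem piece_zero_le : piece L σ 0 ≤ Submodule.span ℝ {1} := by
  intro a ha
  have := piece_ind (L := L) (σ := σ) (Pr := fun k a => k = 0 → a ∈ Submodule.span ℝ {1})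
    (fun _ => Submodule.mem_span_singleton_self _) (fun _ _ => Submodule.zero_mem _)
    (fun k p q hp hq h => Submodule.add_mem _ (hp h) (hq h))
    (fun k r p hp h => Submodule.smul_mem _ _ (hp h)) (fun k p S _ _ h => by omega) 0 a ha
  exact this rfl

theorem piece_fin (k : ℕ) : Module.Finite ℝ (piece L σ k) := by
  induction k with
  | zero =>
    have : Module.Finite ℝ (Submodule.span ℝ {(1 : CR L σ)}) := inferInstance
    exact Submodule.finiteDimensional_of_le piece_zero_le
  | succ k ih =>
    have : ∀ S : Finset E, Module.Finite ℝ
      ((piece L σ k).map (LinearMap.mulLeft ℝ (xx L σ S))) := fun S => inferInstance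
    exact Submodule.finiteDimensional_of_le (piece_succ_le k)

theorem piece_span (k : ℕ) (z : CR L σ) (hz : z ∈ piece L σ (k + 1)) (s : Finset (Finset E))
    (hs : ∀ S ∈ Lk L σ, S ∈ s) :
    z ∈ Submodule.span ℝ {z | ∃ F ∈ s, ∃ b, z = xx L σ F * b} := by
  refine (iSup_le ?_ : (⨆ S : Finset E, (piece L σ k).map (LinearMap.mulLeft ℝ (xx L σ S))) ≤ _)
    (piece_succ_le k hz)
  rintro S _ ⟨b, hb, rfl⟩
  by_cases hS : S ∈ Lk L σ
  · exact Submodule.subset_span ⟨S, hs S hS, b, rfl⟩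
  · simp [xx_eq_zero hS]

/-! push maps -/

section push
variable {R : Type*} [CommRing R] [Algebra ℝ R]

theorem push_wd {w : R} {y : Finset E → R} (h : ∀ p ∈ rel L σ, w * aeval y p = 0)
    {p q : MvPolynomial (Finset E) ℝ} (hpq : mk L σ p = mk L σ q) :
    w * aeval y p = w * aeval y q := by
  have h1 : p - q ∈ Ideal.span (rel L σ) := by
    rw [← mk_eq_zero, map_sub, hpq, sub_self]
  have h2 : w * aeval y (p - q) = 0 := by
    refine Submodule.span_induction (p := fun r _ => w * aeval y r = 0) h ?_ ?_ ?_ h1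
    · simp
    · intro a b _ _ ha hb; rw [map_add, mul_add, ha, hb, add_zero]
    · intro a b _ hb
      rw [smul_eq_mul, map_mul, mul_left_comm, hb, mul_zero]
  rw [map_sub, mul_sub] at h2
  exact sub_eq_zero.1 h2

/-- the linear map `p ↦ w * p(y)` -/
noncomputable def push (w : R) (y : Finset E → R) (h : ∀ p ∈ rel L σ, w * aeval y p = 0) :
    CR L σ →ₗ[ℝ] R where
  toFun a := w * aeval y (Function.surjInv (mk_surj L σ) a)
  map_add' a b := by
    rw [← mul_add, ← map_add]
    refine push_wd h ?_
    have e := Function.surjInv_eq (mk_surj L σ)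
    rw [map_add, e, e, e]
  map_smul' r a := by
    rw [RingHom.id_apply, ← mul_smul_comm, ← map_smul]
    refine push_wd h ?_
    have e := Function.surjInv_eq (mk_surj L σ)
    rw [map_smul, e, e]

variable {w : R} {y : Finset E → R} (h : ∀ p ∈ rel L σ, w * aeval y p = 0)

theorem push_mk (p : MvPolynomial (Finset E) ℝ) : push w y h (mk L σ p) = w * aeval y p :=
  push_wd h (Function.surjInv_eq (mk_surj L σ) _)

theorem push_mk_mul (p : MvPolynomial (Finset E) ℝ) (b : CR L σ) :
    push w y h (mk L σ p * b) = aeval y p * push w y h b := by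
  obtain ⟨q, rfl⟩ := mk_surj L σ b
  rw [← map_mul, push_mk, push_mk, map_mul]; ring

theorem push_one : push w y h 1 = w := by
  have := push_mk h 1
  simpa using this

theorem push_xx_mul (S : Finset E) (b : CR L σ) :
    push w y h (xx L σ S * b) = y S * push w y h b := by
  rw [xx, push_mk_mul, aeval_X]

theorem push_ell_mul (c : Finset E → ℝ) (b : CR L σ) :
    push w y h (ell L σ c * b) = (∑ S, c S • y S) * push w y h b := by
  rw [ell, Finset.sum_mul, map_sum, Finset.sum_mul]
  refine Finset.sum_congr rfl fun S _ => ?_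
  rw [smul_mul_assoc, map_smul, push_xx_mul, smul_mul_assoc]

theorem push_mem (ℛ : ℕ → Submodule ℝ R)
    (hm : ∀ i j : ℕ, ∀ a b : R, a ∈ ℛ i → b ∈ ℛ j → a * b ∈ ℛ (i + j))
    {n : ℕ} (hw : w ∈ ℛ n) (hy : ∀ S, y S ∈ ℛ 1) (k : ℕ) (a : CR L σ) (ha : a ∈ piece L σ k) :
    push w y h a ∈ ℛ (k + n) := by
  refine piece_ind (L := L) (σ := σ) (Pr := fun k a => push w y h a ∈ ℛ (k + n)) ?_ ?_ ?_ ?_ ?_ k a ha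
  · rw [push_one, zero_add]; exact hw
  · intro k; rw [map_zero]; exact Submodule.zero_mem _
  · intro k p q hp hq; rw [map_add]; exact Submodule.add_mem _ hp hq
  · intro k r p hp; rw [map_smul]; exact Submodule.smul_mem _ _ hp
  · intro k p S _ hp
    rw [push_xx_mul, show k + 1 + n = 1 + (k + n) by ring]
    exact hm _ _ _ _ (hy S) hp

end push

/-- lifting multiplications through a linear map -/
theorem lift_mul {R K : Type*} [CommRing R] [Algebra ℝ R] [CommRing K] [Algebra ℝ K]
    (𝒦 : ℕ → Submodule ℝ K) (h1 : (1 : K) ∈ 𝒦 0)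
    (hm : ∀ i j : ℕ, ∀ a b : K, a ∈ 𝒦 i → b ∈ 𝒦 j → a * b ∈ 𝒦 (i + j))
    (g : K →ₗ[ℝ] R) (y : Finset E → R)
    (hy : ∀ S, ∃ c1 ∈ 𝒦 1, ∀ c, g (c1 * c) = y S * g c) :
    ∀ (k : ℕ) (p : MvPolynomial (Finset E) ℝ), IsHomogeneous p k → ∃ c1 ∈ 𝒦 k, ∀ c, g (c1 * c) = aeval y p * g c := by
  refine hom_ind (Pr := fun k p => ∃ c1 ∈ 𝒦 k, ∀ c, g (c1 * c) = aeval y p * g c)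
    ⟨1, h1, by simp⟩ (fun k => ⟨0, Submodule.zero_mem _, by simp⟩) ?_ ?_ ?_
  · rintro k p q ⟨c1, h1, h2⟩ ⟨c3, h3, h4⟩
    exact ⟨c1 + c3, Submodule.add_mem _ h1 h3, fun c => by
      rw [add_mul, map_add, h2, h4, map_add, add_mul]⟩
  · rintro k r p ⟨c1, h1, h2⟩
    exact ⟨r • c1, Submodule.smul_mem _ _ h1, fun c => by
      rw [smul_mul_assoc, map_smul, h2, map_smul, smul_mul_assoc]⟩
  · rintro k p S ⟨c1, h1, h2⟩
    obtain ⟨c3, h3, h4⟩ := hy S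
    refine ⟨c3 * c1, by rw [add_comm k 1]; exact hm _ _ _ _ h3 h1, fun c => ?_⟩
    rw [mul_assoc, h4, h2, map_mul, aeval_X, mul_assoc]

/-! affine functions -/

theorem Aff.zero : Aff (fun _ : Finset E => (0 : ℝ)) := ⟨0, 0, by simp⟩

theorem Aff.const (r : ℝ) : Aff (fun _ : Finset E => r) := ⟨r, 0, by simp⟩

theorem Aff.add {μ ν : Finset E → ℝ} (h : Aff μ) (h' : Aff ν) : Aff (fun S => μ S + ν S) := by
  obtain ⟨c, w, h⟩ := h
  obtain ⟨c', w', h'⟩ := h'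
  exact ⟨c + c', fun e => w e + w' e, fun S => by
    simp only []; rw [h, h', Finset.sum_add_distrib]; ring⟩

theorem Aff.smul {μ : Finset E → ℝ} (r : ℝ) (h : Aff μ) : Aff (fun S => r * μ S) := by
  obtain ⟨c, w, h⟩ := h
  exact ⟨r * c, fun e => r * w e, fun S => by
    simp only []; rw [h, ← Finset.mul_sum]; ring⟩

theorem Aff.sub {μ ν : Finset E → ℝ} (h : Aff μ) (h' : Aff ν) : Aff (fun S => μ S - ν S) := by
  have := h.add (h'.smul (-1))
  convert this using 2; ring

theorem Aff.ind (j : E) : Aff (fun S : Finset E => if j ∈ S then (1 : ℝ) else 0) :=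
  ⟨0, fun e => if e = j then 1 else 0, fun S => by simp⟩

/-- difference of two indicators -/
noncomputable def dif (j j' : E) (S : Finset E) : ℝ :=
  (if j ∈ S then (1 : ℝ) else 0) - (if j' ∈ S then (1 : ℝ) else 0)

theorem Aff.dif (j j' : E) : Aff (dif j j') := (Aff.ind j).sub (Aff.ind j')

theorem Aff.insert {μ : Finset E → ℝ} (h : Aff μ) (i : E) : Aff (fun S => μ (insert i S)) := by
  obtain ⟨c, w, h⟩ := h
  refine ⟨c + w i, fun e => if e = i then 0 else w e, fun S => ?_⟩
  simp only []
  rw [h]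
  by_cases hi : i ∈ S
  · rw [Finset.insert_eq_of_mem hi, ← Finset.add_sum_erase _ _ hi, ← Finset.add_sum_erase _ _ hi]
    rw [if_pos rfl, zero_add, add_assoc]
    congr 2
    exact Finset.sum_congr rfl fun e he => by rw [if_neg (Finset.ne_of_mem_erase he)]
  · rw [Finset.sum_insert hi, add_assoc]
    congr 2
    exact Finset.sum_congr rfl fun e he => by rw [if_neg (by rintro rfl; exact hi he)]

theorem dif_gap {i j j' : E} {P Q : Finset E} (g : Gap σ i P Q) (hj : j ∉ P) (hjQ : j ∈ Q)
    (hj' : j' ∉ P) (hjQ' : j' ∈ Q) : ∀ T ∈ σ, dif j j' T = 0 := by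
  intro T hT
  by_cases hi : i ∈ T
  · have := g.hi T hT hi
    simp [dif, this hjQ, this hjQ']
  · have := g.lo T hT hi
    simp [dif, show j ∉ T from fun h => hj (this h), show j' ∉ T from fun h => hj' (this h)]

/-! Gysin maps -/

theorem not_link_insert {F S : Finset E} (hSF : S ≠ F) (h : S ∉ Lk L (insert F σ)) :
    xx L σ F * xx L σ S = 0 := by
  by_cases hS : S ∈ Lk L σ
  · refine xx_mul_eq_zero fun hc => h ⟨hS.1, ?_, ?_⟩
    · simp [hSF, hS.2.1]
    · intro T hT
      rcases Finset.mem_insert.1 hT with h' | h'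
      · rw [h']; exact hc.symm
      · exact hS.2.2 T h'
  · rw [xx_eq_zero hS, mul_zero]

open Classical in
theorem gys_rel (F : Finset E) : ∀ p ∈ rel L (insert F σ), xx L σ F *
    aeval (fun S => if S ∈ Lk L (insert F σ) then xx L σ S else 0) p = 0 := by
  rintro p (⟨S, hS, rfl⟩ | ⟨S, T, hST, rfl⟩ | ⟨μ, hμ, hμ0, rfl⟩)
  · simp [hS]
  · rw [map_mul, aeval_X, aeval_X]
    split_ifs
    · rw [xx_mul_eq_zero hST, mul_zero]
    all_goals simp
  · have h0 : ell L σ μ = 0 := ell_aff hμ fun T hT => hμ0 T (Finset.mem_insert_of_mem hT)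
    have : xx L σ F * ell L σ μ = 0 := by rw [h0, mul_zero]
    refine Eq.trans ?_ this
    rw [map_sum, ell, Finset.mul_sum, Finset.mul_sum]
    refine Finset.sum_congr rfl fun S _ => ?_
    rw [map_mul, aeval_X, aeval_C, Algebra.algebraMap_eq_smul_one, smul_mul_assoc, one_mul]
    by_cases hSF : S = F
    · rw [hSF, hμ0 F (Finset.mem_insert_self _ _)]; simp
    · split_ifs with h
      · rfl
      · rw [mul_smul_comm, mul_smul_comm, not_link_insert hSF h, mul_zero]

/-- Gysin map of `F` -/
noncomputable def gys (L : Set (Finset E)) (σ : Finset (Finset E)) (F : Finset E) :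
    CR L (insert F σ) →ₗ[ℝ] CR L σ := push _ _ (gys_rel (L := L) (σ := σ) F)

theorem gys_one (F : Finset E) : gys L σ F 1 = xx L σ F := push_one _

theorem gys_dvd (F : Finset E) (b : CR L (insert F σ)) : ∃ b', gys L σ F b = xx L σ F * b' := by
  obtain ⟨p, rfl⟩ := mk_surj _ _ b
  exact ⟨_, push_mk _ p⟩

theorem gys_xx_mul {F S : Finset E} (hSF : S ≠ F) (b : CR L (insert F σ)) :
    gys L σ F (xx L _ S * b) = xx L σ S * gys L σ F b := by
  rw [gys, push_xx_mul]
  split_ifs with h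
  · rfl
  · obtain ⟨b', hb'⟩ := gys_dvd F b
    rw [gys] at hb'
    rw [hb', zero_mul, ← mul_assoc, mul_comm (xx L σ S) (xx L σ F), not_link_insert hSF h, zero_mul]

theorem gys_ell_mul (F : Finset E) (c : Finset E → ℝ) (b : CR L (insert F σ)) :
    gys L σ F (ell L _ c * b) = (ell L σ c - c F • xx L σ F) * gys L σ F b := by
  have h1 : ell L σ c - c F • xx L σ F = ∑ S ∈ Finset.univ.erase F, c S • xx L σ S := by
    rw [ell, ← Finset.add_sum_erase _ _ (Finset.mem_univ F), add_sub_cancel_left]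
  have h2 : ell L (insert F σ) c = ∑ S ∈ Finset.univ.erase F, c S • xx L (insert F σ) S := by
    rw [ell, ← Finset.add_sum_erase _ _ (Finset.mem_univ F),
      xx_eq_zero (S := F) (by simp [Lk]), smul_zero, zero_add]
  rw [h1, h2, Finset.sum_mul, map_sum, Finset.sum_mul]
  refine Finset.sum_congr rfl fun S hS => ?_
  rw [smul_mul_assoc, map_smul, gys_xx_mul (Finset.ne_of_mem_erase hS), smul_mul_assoc]

theorem gys_mem (F : Finset E) (k : ℕ) (a : CR L (insert F σ)) (ha : a ∈ piece L _ k) :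
    gys L σ F a ∈ piece L σ (k + 1) := by
  refine push_mem _ (piece L σ) piece_mul_mem (xx_mem F) ?_ k a ha
  intro S
  split_ifs
  · exact xx_mem S
  · exact Submodule.zero_mem _

theorem exists_sep (h : Base L σ) {F : Finset E} (hF : F ∈ Lk L σ) :
    ∃ μ : Finset E → ℝ, Aff μ ∧ (∀ T ∈ σ, μ T = 0) ∧ μ F = 1 := by
  obtain ⟨i, P, Q, g, hi, hPF, hFQ⟩ := exists_gap_of_link h hF
  obtain ⟨j, hjQ, hjF⟩ := Finset.exists_of_ssubset hFQ
  exact ⟨dif i j, Aff.dif i j, dif_gap g g.iP g.iQ (fun h => hjF (hPF.1 h)) hjQ,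
    by simp [dif, hi, hjF]⟩

theorem gys_lift (h : Base L σ) {F : Finset E} (hF : F ∈ Lk L σ) (k : ℕ) (a : CR L σ)
    (ha : a ∈ piece L σ k) :
    ∃ c ∈ piece L (insert F σ) k, ∀ c', gys L σ F (c * c') = a * gys L σ F c' := by
  obtain ⟨p, hp, rfl⟩ := ha
  have := lift_mul (piece L (insert F σ)) piece_one_mem piece_mul_mem (gys L σ F) (xx L σ) ?_ k p hp
  · obtain ⟨c, hc, h⟩ := this
    exact ⟨c, hc, fun c' => by rw [h, aeval_xx]; rfl⟩
  · intro S
    by_cases hSF : S = F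
    · subst hSF
      obtain ⟨μ, hμ, hμ0, hμF⟩ := exists_sep h hF
      refine ⟨-ell L _ μ, Submodule.neg_mem _ (ell_mem μ), fun c => ?_⟩
      rw [neg_mul, map_neg, gys_ell_mul, ell_aff hμ hμ0, hμF]
      simp
    · exact ⟨xx L _ S, xx_mem S, fun c => gys_xx_mul hSF c⟩

/-- normalized degree maps -/
def Nrm (L : Set (Finset E)) (σ : Finset (Finset E)) (N : ℕ) (deg : CR L σ →ₗ[ℝ] ℝ) : Prop :=
  ∀ c : Finset (Finset E), (∀ S ∈ c, S ∈ Lk L σ) → (∀ S ∈ c, ∀ T ∈ c, cmp S T) →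
    c.card + σ.card = N → deg (∏ S ∈ c, xx L σ S) = 1

theorem gys_prod {F : Finset E} (c : Finset (Finset E)) (hc : ∀ S ∈ c, S ≠ F) :
    gys L σ F (∏ S ∈ c, xx L _ S) = xx L σ F * ∏ S ∈ c, xx L σ S := by
  induction c using Finset.induction_on with
  | empty => simp [gys_one]
  | insert S c hS ih =>
    rw [Finset.prod_insert hS, Finset.prod_insert hS, gys_xx_mul (hc S (by simp)),
      ih fun T hT => hc T (by simp [hT])]
    ring

theorem Lk_of_insert {F S : Finset E} (hS : S ∈ Lk L (insert F σ)) :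
    S ∈ Lk L σ ∧ S ≠ F ∧ cmp S F :=
  ⟨⟨hS.1, fun h => hS.2.1 (Finset.mem_insert_of_mem h),
    fun T hT => hS.2.2 T (Finset.mem_insert_of_mem hT)⟩,
    by rintro rfl; exact hS.2.1 (Finset.mem_insert_self _ _),
    hS.2.2 F (Finset.mem_insert_self _ _)⟩

theorem mem_Lk_insert {F S : Finset E} :
    S ∈ Lk L (insert F σ) ↔ S ∈ Lk L σ ∧ S ≠ F ∧ cmp S F := by
  refine ⟨Lk_of_insert, fun h => ⟨h.1.1, ?_, ?_⟩⟩
  · simp [h.2.1, h.1.2.1]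
  · intro T hT
    rcases Finset.mem_insert.1 hT with h' | h'
    · rw [h']; exact h.2.2
    · exact h.1.2.2 T h'

theorem Nrm.gys {N : ℕ} {deg : CR L σ →ₗ[ℝ] ℝ} (h : Nrm L σ N deg) {F : Finset E}
    (hF : F ∈ Lk L σ) : Nrm L (insert F σ) N (deg ∘ₗ gys L σ F) := by
  intro c hc hcc hcard
  have hne : ∀ S ∈ c, S ≠ F := fun S hS => (Lk_of_insert (hc S hS)).2.1
  have hFc : F ∉ c := fun h => hne F h rfl
  rw [LinearMap.comp_apply, gys_prod c hne, ← Finset.prod_insert hFc]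
  refine h _ ?_ ?_ ?_
  · intro S hS
    rcases Finset.mem_insert.1 hS with h' | h'
    · rw [h']; exact hF
    · exact (Lk_of_insert (hc S h')).1
  · intro S hS T hT
    rcases Finset.mem_insert.1 hS with h' | h' <;> rcases Finset.mem_insert.1 hT with h'' | h''
    · rw [h', h'']; exact cmp_refl _
    · rw [h']; exact (Lk_of_insert (hc T h'')).2.2.symm
    · rw [h'']; exact (Lk_of_insert (hc S h')).2.2
    · exact hcc S h' T h''
  · rw [Finset.card_insert_of_notMem hFc]
    rw [Finset.card_insert_of_notMem hF.2.1] at hcard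
    omega

end ring

end HRProof


namespace HRProof

section ample
variable {E : Type*} [Fintype E] [DecidableEq E] {L : Set (Finset E)} {σ : Finset (Finset E)}

/-- supporting affine function along a flag -/
structure Supp (L : Set (Finset E)) (τ : Finset (Finset E)) (c μ : Finset E → ℝ) : Prop where
  aff : Aff μ
  eq : ∀ T ∈ τ, μ T = c T
  le : ∀ S ∈ Lk L τ, μ S ≤ c S

structure Nef (L : Set (Finset E)) (σ : Finset (Finset E)) (c : Finset E → ℝ) : Prop where
  zero : ∀ T ∈ σ, c T = 0
  supp : ∀ τ, IsFlag L τ → σ ⊆ τ → ∃ μ, Supp L τ c μ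

structure Kc (L : Set (Finset E)) (σ : Finset (Finset E)) (c : Finset E → ℝ) : Prop
    extends Nef L σ c where
  strict : ∀ τ, IsFlag L τ → σ ⊆ τ → ∀ S ∈ Lk L τ, ∃ μ, Supp L τ c μ ∧ μ S < c S

theorem Supp.add {τ : Finset (Finset E)} {c μ c' μ' : Finset E → ℝ} (h : Supp L τ c μ)
    (h' : Supp L τ c' μ') : Supp L τ (fun S => c S + c' S) (fun S => μ S + μ' S) :=
  ⟨h.aff.add h'.aff, fun T hT => by simp only [h.eq T hT, h'.eq T hT],
    fun S hS => add_le_add (h.le S hS) (h'.le S hS)⟩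

theorem Supp.smul {τ : Finset (Finset E)} {c μ : Finset E → ℝ} (h : Supp L τ c μ) {r : ℝ}
    (hr : 0 ≤ r) : Supp L τ (fun S => r * c S) (fun S => r * μ S) :=
  ⟨h.aff.smul r, fun T hT => by simp only [h.eq T hT],
    fun S hS => mul_le_mul_of_nonneg_left (h.le S hS) hr⟩

theorem Nef.add {c c' : Finset E → ℝ} (h : Nef L σ c) (h' : Nef L σ c') :
    Nef L σ (fun S => c S + c' S) where
  zero T hT := by simp only [h.zero T hT, h'.zero T hT, add_zero]
  supp τ hτ hs := by
    obtain ⟨μ, hμ⟩ := h.supp τ hτ hs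
    obtain ⟨μ', hμ'⟩ := h'.supp τ hτ hs
    exact ⟨_, hμ.add hμ'⟩

theorem Nef.mix {c c' : Finset E → ℝ} (h : Nef L σ c) (h' : Kc L σ c') {t : ℝ} (ht : 0 < t)
    (ht1 : t ≤ 1) : Kc L σ (fun S => (1 - t) * c S + t * c' S) where
  zero T hT := by simp only [h.zero T hT, h'.zero T hT]; ring
  supp τ hτ hs := by
    obtain ⟨μ, hμ⟩ := h.supp τ hτ hs
    obtain ⟨μ', hμ'⟩ := h'.supp τ hτ hs
    exact ⟨_, (hμ.smul (sub_nonneg.2 ht1)).add (hμ'.smul ht.le)⟩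
  strict τ hτ hs S hS := by
    obtain ⟨μ, hμ⟩ := h.supp τ hτ hs
    obtain ⟨μ', hμ', hlt⟩ := h'.strict τ hτ hs S hS
    exact ⟨_, (hμ.smul (sub_nonneg.2 ht1)).add (hμ'.smul ht.le),
      add_lt_add_of_le_of_lt (mul_le_mul_of_nonneg_left (hμ.le S hS) (sub_nonneg.2 ht1))
        (mul_lt_mul_of_pos_left hlt ht)⟩

theorem Supp.sub {τ : Finset (Finset E)} {c μ ν : Finset E → ℝ} (h : Supp L τ c μ)
    (hν : Aff ν) : Supp L τ (fun S => c S - ν S) (fun S => μ S - ν S) :=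
  ⟨h.aff.sub hν, fun T hT => by simp only [h.eq T hT],
    fun S hS => sub_le_sub_right (h.le S hS) _⟩

theorem Kc.link {c : Finset E → ℝ} (h : Kc L σ c) {F : Finset E} {μ : Finset E → ℝ}
    (hμ : Supp L (insert F σ) c μ) : Kc L (insert F σ) (fun S => c S - μ S) where
  zero T hT := by simp only [hμ.eq T hT, sub_self]
  supp τ hτ hs := by
    obtain ⟨ν, hν⟩ := h.supp τ hτ ((Finset.subset_insert _ _).trans hs)
    exact ⟨_, hν.sub hμ.aff⟩
  strict τ hτ hs S hS := by
    obtain ⟨ν, hν, hlt⟩ := h.strict τ hτ ((Finset.subset_insert _ _).trans hs) S hS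
    exact ⟨_, hν.sub hμ.aff, sub_lt_sub_right hlt _⟩

theorem ell_sub_aff {c μ : Finset E → ℝ} (hμ : Aff μ) (h0 : ∀ T ∈ σ, μ T = 0) :
    ell L σ (fun S => c S - μ S) = ell L σ c := by
  rw [ell_sub, ell_aff hμ h0, sub_zero]

/-- the inductive statement -/
def TT (L : Set (Finset E)) (σ : Finset (Finset E)) (N : ℕ) : Prop :=
  ∀ deg, Nrm L σ N deg → PA (piece L σ) deg (N - σ.card) ∧
    ∀ c, Kc L σ c → HR (piece L σ) deg (N - σ.card) (ell L σ c)

theorem HL_of_K {N : ℕ} (hσ : Base L σ) {deg : CR L σ →ₗ[ℝ] ℝ}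
    (hdeg : Nrm L σ N deg) {d : ℕ} (hd : N - σ.card = d) (hPA : PA (piece L σ) deg d)
    (ih : ∀ F ∈ Lk L σ, TT L (insert F σ) N) {c : Finset E → ℝ} (hc : Kc L σ c) :
    HL (piece L σ) d (ell L σ c) := by
  classical
  rcases d with _ | d
  · intro k m hkm a ha hla
    obtain ⟨rfl, rfl⟩ : k = 0 ∧ m = 0 := by omega
    simpa using hla
  have hsup : ∀ F, ∃ μ, F ∈ Lk L σ → Supp L (insert F σ) c μ := by
    intro F
    by_cases hF : F ∈ Lk L σ
    · obtain ⟨μ, hμ⟩ := hc.supp _ (hσ.insert hF).toIsFlag (Finset.subset_insert _ _)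
      exact ⟨μ, fun _ => hμ⟩
    · exact ⟨0, fun h => absurd h hF⟩
  choose μ hμ using hsup
  have hs : ∀ F, F ∈ Finset.univ.filter (fun F => F ∈ Lk L σ) ↔ F ∈ Lk L σ := by simp
  have hcard : ∀ F ∈ Lk L σ, N - (insert F σ).card = d := by
    intro F hF
    rw [Finset.card_insert_of_notMem hF.2.1]; omega
  have hμ0 : ∀ F ∈ Lk L σ, ∀ T ∈ σ, μ F T = 0 := by
    intro F hF T hT
    rw [(hμ F hF).eq T (Finset.mem_insert_of_mem hT), hc.zero T hT]
  refine hl_of_links (Finset.univ.filter (fun F => F ∈ Lk L σ)) (xx L σ)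
    (fun F => CR L (insert F σ)) (fun F => piece L (insert F σ)) (gys L σ) (ell L σ c)
    (ell_mem c) (fun F => ell L (insert F σ) (fun S => c S - μ F S)) hPA ?_ ?_ ?_ ?_ ?_ ?_ ?_ ?_
  · intro F hF
    rw [hs] at hF
    have := (ih F hF _ (hdeg.gys hF)).1
    rwa [hcard F hF] at this
  · intro F hF; exact ell_mem _
  · intro F hF
    rw [hs] at hF
    have := (ih F hF _ (hdeg.gys hF)).2 _ (hc.link (hμ F hF))
    rwa [hcard F hF] at this
  · intro F hF; exact gys_one F
  · intro F hF b
    rw [hs] at hF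
    rw [gys_ell_mul, ell_sub_aff (hμ F hF).aff (hμ0 F hF),
      (hμ F hF).eq F (Finset.mem_insert_self _ _), sub_self, zero_smul, sub_zero]
  · intro F hF k a ha
    rw [hs] at hF
    exact gys_lift hσ hF k a ha
  · intro F hF
    rw [hs] at hF
    obtain ⟨ν, hν, hlt⟩ := hc.strict σ hσ.toIsFlag (Finset.Subset.refl _) F hF
    refine ⟨fun S => c S - ν S, ?_, sub_pos.2 hlt, ?_⟩
    · intro S hS
      rw [hs] at hS
      exact sub_nonneg.2 (hν.le S hS)
    · rw [← ell_sub_aff hν.aff (fun T hT => by rw [hν.eq T hT, hc.zero T hT]) (c := c), ell]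
      refine (Finset.sum_subset (Finset.subset_univ _) fun S _ hS => ?_).symm
      rw [hs] at hS
      rw [xx_eq_zero hS, smul_zero]
  · intro k z hz
    exact piece_span k z hz _ fun S hS => (hs S).2 hS

theorem TT_of_nef {N : ℕ} (hσ : Base L σ)
    (ih : ∀ F ∈ Lk L σ, TT L (insert F σ) N)
    (h : ∀ deg, Nrm L σ N deg → PA (piece L σ) deg (N - σ.card) ∧
      ∃ c, Nef L σ c ∧ HR (piece L σ) deg (N - σ.card) (ell L σ c)) : TT L σ N := by
  intro deg hdeg
  obtain ⟨hPA, c0, hc0, hHR⟩ := h deg hdeg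
  refine ⟨hPA, fun c hc => ?_⟩
  refine hPA.hr_path (ell_mem c0) (ell_mem c) ?_ hHR
  rintro t ⟨ht0, ht1⟩
  rcases ht0.eq_or_lt with rfl | ht0
  · simpa using hHR.hl
  · have := HL_of_K hσ hdeg rfl hPA ih (hc0.mix hc ht0 ht1)
    rwa [ell_add, ell_smul, ell_smul] at this

/-! greedy lemma -/

theorem greedy {c : Finset E → ℝ} (hc : ∀ A B, c (A ∪ B) + c (A ∩ B) ≤ c A + c B) (n : ℕ) :
    ∀ U : Finset E, U.card = n → ∀ ρ : Finset (Finset E), (∀ T ∈ ρ, T ⊆ U) →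
    (∀ S ∈ ρ, ∀ T ∈ ρ, cmp S T) → ∃ w : E → ℝ, (∀ S ⊆ U, c ∅ + ∑ e ∈ S, w e ≤ c S) ∧
      ∀ T ∈ ρ, c ∅ + ∑ e ∈ T, w e = c T := by
  induction n with
  | zero =>
    intro U hU ρ hρ _
    rw [Finset.card_eq_zero] at hU
    subst hU
    refine ⟨0, ?_, ?_⟩
    · intro S hS; rw [Finset.subset_empty.1 hS]; simp
    · intro T hT; rw [Finset.subset_empty.1 (hρ T hT)]; simp
  | succ n ih =>
    intro U hU ρ hρ hch
    obtain ⟨e, heU, he⟩ : ∃ e ∈ U, ∀ T ∈ ρ.erase U, e ∉ T := by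
      by_cases hne : (ρ.erase U).Nonempty
      · obtain ⟨T, hT, hTm⟩ := chain_max (c := ρ.erase U) (fun S hS T hT =>
          hch S (Finset.mem_of_mem_erase hS) T (Finset.mem_of_mem_erase hT)) hne
        have hTU : T ⊂ U := lt_of_le_of_ne (hρ T (Finset.mem_of_mem_erase hT))
          (Finset.ne_of_mem_erase hT)
        obtain ⟨e, heU, heT⟩ := Finset.exists_of_ssubset hTU
        exact ⟨e, heU, fun T' hT' h => heT (hTm T' hT' h)⟩
      · have : U.Nonempty := Finset.card_pos.1 (by omega)
        obtain ⟨e, he⟩ := this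
        refine ⟨e, he, fun T hT => absurd ⟨T, hT⟩ hne⟩
    have hsub : ∀ T ∈ ρ.erase U, T ⊆ U.erase e := fun T hT a ha =>
      Finset.mem_erase.2 ⟨by rintro rfl; exact he T hT ha, hρ T (Finset.mem_of_mem_erase hT) ha⟩
    obtain ⟨w, hw1, hw2⟩ := ih (U.erase e) (by rw [Finset.card_erase_of_mem heU]; omega)
      (insert (U.erase e) (ρ.erase U)) (by
        intro T hT
        rcases Finset.mem_insert.1 hT with h | h
        · rw [h]
        · exact hsub T h) (by
        intro S hS T hT
        rcases Finset.mem_insert.1 hS with h | h <;> rcases Finset.mem_insert.1 hT with h' | h'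
        · rw [h, h']; exact cmp_refl _
        · rw [h]; exact Or.inr (hsub T h')
        · rw [h']; exact Or.inl (hsub S h)
        · exact hch S (Finset.mem_of_mem_erase h) T (Finset.mem_of_mem_erase h'))
    have hU' := hw2 _ (Finset.mem_insert_self _ _)
    refine ⟨Function.update w e (c U - c (U.erase e)), ?_, ?_⟩
    · intro S hS
      by_cases heS : e ∈ S
      · rw [Finset.sum_update_of_mem heS, Finset.sdiff_singleton_eq_erase]
        have h1 := hw1 (S.erase e) (Finset.erase_subset_erase _ hS)
        have h2 := hc S (U.erase e)
        have e1 : S ∪ U.erase e = U := by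
          ext a
          simp only [Finset.mem_union, Finset.mem_erase]
          constructor
          · rintro (h | h)
            · exact hS h
            · exact h.2
          · intro h
            by_cases hae : a = e
            · left; rwa [hae]
            · right; exact ⟨hae, h⟩
        have e2 : S ∩ U.erase e = S.erase e := by
          ext a
          simp only [Finset.mem_inter, Finset.mem_erase]
          exact ⟨fun h => ⟨h.2.1, h.1⟩, fun h => ⟨h.2, h.1, hS h.2⟩⟩
        rw [e1, e2] at h2
        linarith
      · rw [Finset.sum_update_of_notMem heS]
        exact hw1 S fun a ha => Finset.mem_erase.2 ⟨by rintro rfl; exact heS ha, hS ha⟩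
    · intro T hT
      by_cases hTU : T = U
      · rw [hTU, Finset.sum_update_of_mem heU, Finset.sdiff_singleton_eq_erase]
        linarith
      · have hTe : T ∈ ρ.erase U := Finset.mem_erase.2 ⟨hTU, hT⟩
        rw [Finset.sum_update_of_notMem (he T hTe)]
        exact hw2 T (Finset.mem_insert_of_mem hTe)

/-- strictly submodular functions -/
def SSub (c : Finset E → ℝ) : Prop :=
  ∀ A B : Finset E, ¬A ⊆ B → ¬B ⊆ A → c (A ∪ B) + c (A ∩ B) < c A + c B

theorem SSub.le {c : Finset E → ℝ} (h : SSub c) (A B : Finset E) :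
    c (A ∪ B) + c (A ∩ B) ≤ c A + c B := by
  by_cases h1 : A ⊆ B
  · rw [Finset.union_eq_right.2 h1, Finset.inter_eq_left.2 h1, add_comm]
  · by_cases h2 : B ⊆ A
    · rw [Finset.union_eq_left.2 h2, Finset.inter_eq_right.2 h2]
    · exact (h A B h1 h2).le

theorem SSub.greedy {c : Finset E → ℝ} (h : SSub c) (ρ : Finset (Finset E))
    (hρ : ∀ S ∈ ρ, ∀ T ∈ ρ, cmp S T) :
    ∃ μ, Aff μ ∧ (∀ T ∈ ρ, μ T = c T) ∧ ∀ S, μ S ≤ c S := by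
  obtain ⟨w, h1, h2⟩ := HRProof.greedy h.le _ Finset.univ rfl ρ (fun T _ => Finset.subset_univ T) hρ
  exact ⟨fun S => c ∅ + ∑ e ∈ S, w e, ⟨c ∅, w, fun S => rfl⟩, h2,
    fun S => h1 S (Finset.subset_univ S)⟩

theorem Aff.modular {μ : Finset E → ℝ} (h : Aff μ) (A B : Finset E) :
    μ (A ∪ B) + μ (A ∩ B) = μ A + μ B := by
  obtain ⟨c, w, h⟩ := h
  rw [h, h, h, h]
  have := Finset.sum_union_inter (s₁ := A) (s₂ := B) (f := w)
  linarith

theorem SSub.greedy_strict {c : Finset E → ℝ} (h : SSub c) (ρ : Finset (Finset E))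
    (hρ : ∀ S ∈ ρ, ∀ T ∈ ρ, cmp S T) (S : Finset E) (hS : S ∉ ρ) (hSc : ∀ T ∈ ρ, cmp S T)
    (hb : ∃ P ∈ ρ, P ⊆ S) (hu : Finset.univ ∈ ρ) :
    ∃ μ, Aff μ ∧ (∀ T ∈ ρ, μ T = c T) ∧ (∀ S, μ S ≤ c S) ∧ μ S < c S := by
  obtain ⟨P0, hP0, hP0S⟩ := hb
  obtain ⟨P, hP, hPm⟩ := chain_max (c := ρ.filter fun T => T ⊆ S)
    (fun S hS T hT => hρ S (Finset.mem_filter.1 hS).1 T (Finset.mem_filter.1 hT).1)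
    ⟨P0, by simp [hP0, hP0S]⟩
  obtain ⟨Q, hQ, hQm⟩ := chain_min (c := ρ.filter fun T => S ⊆ T)
    (fun S hS T hT => hρ S (Finset.mem_filter.1 hS).1 T (Finset.mem_filter.1 hT).1)
    ⟨Finset.univ, by simp [hu]⟩
  rw [Finset.mem_filter] at hP hQ
  have hPS : P ⊂ S := lt_of_le_of_ne hP.2 (by rintro rfl; exact hS hP.1)
  have hSQ : S ⊂ Q := lt_of_le_of_ne hQ.2 (by rintro rfl; exact hS hQ.1)
  set S' := P ∪ (Q \ S) with hS'
  have hPS' : P ⊆ S' := Finset.subset_union_left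
  have hS'Q : S' ⊆ Q := Finset.union_subset (hPS.1.trans hSQ.1) Finset.sdiff_subset
  have hcmp : ∀ T ∈ ρ, cmp S' T := by
    intro T hT
    rcases hSc T hT with h | h
    · exact Or.inl (hS'Q.trans (hQm T (by simp [hT, h])))
    · exact Or.inr ((hPm T (by simp [hT, h])).trans hPS')
  obtain ⟨μ, h1, h2, h3⟩ := h.greedy (insert S' ρ) (by
    intro A hA B hB
    rcases Finset.mem_insert.1 hA with hA | hA <;> rcases Finset.mem_insert.1 hB with hB | hB
    · rw [hA, hB]; exact cmp_refl _
    · rw [hA]; exact hcmp B hB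
    · rw [hB]; exact (hcmp A hA).symm
    · exact hρ A hA B hB)
  refine ⟨μ, h1, fun T hT => h2 T (Finset.mem_insert_of_mem hT), h3, ?_⟩
  have e1 : S ∪ S' = Q := by
    ext a
    simp only [hS', Finset.mem_union, Finset.mem_sdiff]
    constructor
    · rintro (h | h | h)
      · exact hSQ.1 h
      · exact hSQ.1 (hPS.1 h)
      · exact h.1
    · intro h; tauto
  have e2 : S ∩ S' = P := by
    ext a
    simp only [hS', Finset.mem_inter, Finset.mem_union, Finset.mem_sdiff]
    constructor
    · tauto
    · intro h; exact ⟨hPS.1 h, Or.inl h⟩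
  have h4 := h1.modular S S'
  have h5 := h S S' (by
    intro hsub
    obtain ⟨a, haS, haP⟩ := Finset.exists_of_ssubset hPS
    have := hsub haS
    simp [hS', haS, haP] at this) (by
    intro hsub
    obtain ⟨a, haQ, haS⟩ := Finset.exists_of_ssubset hSQ
    exact haS (hsub (by simp [hS', haQ, haS])))
  rw [e1, e2] at h4 h5
  rw [h2 P (Finset.mem_insert_of_mem hP.1), h2 Q (Finset.mem_insert_of_mem hQ.1),
    h2 S' (Finset.mem_insert_self _ _)] at h4
  linarith

/-- strictly submodular functions are ample -/
theorem SSub.Kc (hσ : Base L σ) {c : Finset E → ℝ} (h : SSub c) (h0 : ∀ T ∈ σ, c T = 0) :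
    Kc L σ c where
  zero := h0
  supp τ hτ hs := by
    obtain ⟨μ, h1, h2, h3⟩ := h.greedy τ hτ.chain
    exact ⟨μ, h1, h2, fun S _ => h3 S⟩
  strict τ hτ hs S hS := by
    obtain ⟨P, hP, hPm⟩ := hσ.bot
    obtain ⟨μ, h1, h2, h3, h4⟩ := h.greedy_strict τ hτ.chain S hS.2.1 hS.2.2
      ⟨P, hs hP, hPm S hS.1⟩ (hs hσ.univ_mem)
    exact ⟨μ, ⟨h1, h2, fun S _ => h3 S⟩, h4⟩

/-- a specific strictly submodular function -/
noncomputable def c0 (S : Finset E) : ℝ := (S.card : ℝ) * (Fintype.card E - S.card)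

theorem c0_ssub : SSub (c0 : Finset E → ℝ) := by
  intro A B h1 h2
  have e := Finset.card_union_add_card_inter A B
  have e' : ((A ∪ B).card : ℝ) + (A ∩ B).card = A.card + B.card := by exact_mod_cast e
  have l1 : (A ∩ B).card < A.card := by
    refine Finset.card_lt_card ⟨Finset.inter_subset_left, fun h => h1 fun a ha => ?_⟩
    exact (Finset.mem_inter.1 (h ha)).2
  have l2 : (A ∩ B).card < B.card := by
    refine Finset.card_lt_card ⟨Finset.inter_subset_right, fun h => h2 fun a ha => ?_⟩
    exact (Finset.mem_inter.1 (h ha)).1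
  have l1' : ((A ∩ B).card : ℝ) < A.card := by exact_mod_cast l1
  have l2' : ((A ∩ B).card : ℝ) < B.card := by exact_mod_cast l2
  unfold c0
  nlinarith [mul_pos (sub_pos.2 l1') (sub_pos.2 l2')]

noncomputable def ct (i : E) (S : Finset E) : ℝ := c0 (insert i S)

theorem image_chain {τ : Finset (Finset E)} (i : E) (hτ : ∀ S ∈ τ, ∀ T ∈ τ, cmp S T) :
    ∀ S ∈ τ.image (insert i), ∀ T ∈ τ.image (insert i), cmp S T := by
  intro S hS T hT
  obtain ⟨S, hS', rfl⟩ := Finset.mem_image.1 hS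
  obtain ⟨T, hT', rfl⟩ := Finset.mem_image.1 hT
  exact cmp_insert i (hτ S hS' T hT')

theorem ct_supp {τ : Finset (Finset E)} (i : E) (hτ : ∀ S ∈ τ, ∀ T ∈ τ, cmp S T) :
    ∃ μ : Finset E → ℝ, Aff μ ∧ (∀ T ∈ τ, μ T = ct i T) ∧ (∀ S, μ S ≤ ct i S) ∧
      ∀ S, μ (insert i S) = μ S := by
  obtain ⟨μ, h1, h2, h3⟩ := c0_ssub.greedy (τ.image (insert i)) (image_chain i hτ)
  refine ⟨fun S => μ (insert i S), h1.insert i, ?_, fun S => h3 _, fun S => by simp⟩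
  intro T hT
  exact h2 _ (Finset.mem_image_of_mem _ hT)

theorem ct_nef (i : E) {ν : Finset E → ℝ} (hν : Aff ν)
    (hν0 : ∀ T ∈ σ, ν T = ct i T) : Nef L σ (fun S => ct i S - ν S) where
  zero T hT := by simp only [hν0 T hT, sub_self]
  supp τ hτ hs := by
    obtain ⟨μ, h1, h2, h3, h4⟩ := ct_supp i hτ.chain
    exact ⟨_, Supp.sub ⟨h1, h2, fun S _ => h3 S⟩ hν⟩

theorem ct_Kc (hσ : Base L σ) (i : E) {ν : Finset E → ℝ} (hν : Aff ν)
    (hν0 : ∀ T ∈ σ, ν T = ct i T)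
    (hinj : ∀ S ∈ Lk L σ, ∀ T, T ∈ Lk L σ ∨ T ∈ σ → insert i S = insert i T → S = T) :
    Kc L σ (fun S => ct i S - ν S) where
  toNef := ct_nef i hν hν0
  strict τ hτ hs S hS := by
    have hSσ : S ∈ Lk L σ := ⟨hS.1, fun h => hS.2.1 (hs h), fun T hT => hS.2.2 T (hs hT)⟩
    obtain ⟨P, hP, hPm⟩ := hσ.bot
    obtain ⟨μ, h1, h2, h3, h4⟩ := c0_ssub.greedy_strict (τ.image (insert i))
      (image_chain i hτ.chain) (insert i S) (by
        intro h
        obtain ⟨T, hT, hTS⟩ := Finset.mem_image.1 h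
        have : S = T := by
          refine hinj S hSσ T ?_ hTS.symm
          by_cases hTσ : T ∈ σ
          · exact Or.inr hTσ
          · exact Or.inl ⟨hτ.mem T hT, hTσ, fun U hU => hτ.chain T hT U (hs hU)⟩
        exact hS.2.1 (this ▸ hT)) (by
        intro T hT
        obtain ⟨T, hT', rfl⟩ := Finset.mem_image.1 hT
        exact cmp_insert i (hS.2.2 T hT'))
      ⟨insert i P, Finset.mem_image_of_mem _ (hs hP), Finset.insert_subset_insert i (hPm S hS.1)⟩
      (Finset.mem_image.2 ⟨Finset.univ, hs hσ.univ_mem, by simp⟩)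
    refine ⟨_, Supp.sub ⟨h1.insert i, fun T hT => h2 _ (Finset.mem_image_of_mem _ hT),
      fun S _ => h3 _⟩ hν, ?_⟩
    exact sub_lt_sub_right h4 _

/-- the function defining `y` -/
noncomputable def cy (i j : E) (S : Finset E) : ℝ := if j ∈ S ∧ i ∉ S then 1 else 0

theorem cy_nef {i j : E} {P Q : Finset E} (g : Gap σ i P Q) (hj : j ∉ P) :
    Nef L σ (cy i j) where
  zero T hT := by
    unfold cy
    rw [if_neg]
    rintro ⟨h1, h2⟩
    exact hj (g.lo T hT h2 h1)
  supp τ hτ hs := by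
    by_cases h : ∃ T ∈ τ, j ∈ T ∧ i ∉ T
    · obtain ⟨T, hT, hjT, hiT⟩ := h
      refine ⟨dif j i, Aff.dif j i, ?_, ?_⟩
      · intro T' hT'
        unfold dif cy
        rcases hτ.chain T hT T' hT' with h | h
        · by_cases hi : i ∈ T' <;> simp [h hjT, hi]
        · have : i ∉ T' := fun hi => hiT (h hi)
          by_cases hj : j ∈ T' <;> simp [this, hj]
      · intro S _
        unfold dif cy
        by_cases hi : i ∈ S <;> by_cases hj : j ∈ S <;> simp [hi, hj]
    · push Not at h
      refine ⟨fun _ => 0, Aff.zero, ?_, ?_⟩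
      · intro T hT
        unfold cy
        rw [if_neg]
        rintro ⟨h1, h2⟩
        exact h2 (h T hT h1)
      · intro S _
        unfold cy
        split_ifs <;> simp

end ample

end HRProof


namespace HRProof

open MvPolynomial

section theta
variable {E : Type*} [Fintype E] [DecidableEq E] {L L0 : Set (Finset E)}
  {σ τ : Finset (Finset E)} {i : E}

noncomputable def YY (L : Set (Finset E)) (σ : Finset (Finset E)) (i : E) (U : Finset E) :
    CR L σ := xx L σ (insert i U) + xx L σ (U.erase i)

theorem YY_insert (U : Finset E) : YY L σ i (insert i U) = YY L σ i U := by
  unfold YY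
  rw [Finset.insert_idem, Finset.erase_insert_eq_erase]

theorem YY_congr {U V : Finset E} (h : insert i U = insert i V) : YY L σ i U = YY L σ i V := by
  rw [← YY_insert, h, YY_insert]

theorem insert_erase' (U : Finset E) : insert i (U.erase i) = insert i U := by
  ext a; simp only [Finset.mem_insert, Finset.mem_erase]; tauto

theorem YY_mem (U : Finset E) : YY L σ i U ∈ piece L σ 1 :=
  Submodule.add_mem _ (xx_mem _) (xx_mem _)

theorem sum_pair {M : Type*} [AddCommMonoid M] (i : E) (f : Finset E → M) :
    ∑ G, f G = ∑ U ∈ Finset.univ.filter (fun U => i ∈ U), (f U + f (U.erase i)) := by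
  rw [← Finset.sum_filter_add_sum_filter_not Finset.univ (fun U => i ∈ U), Finset.sum_add_distrib]
  congr 1
  refine Finset.sum_nbij' (fun U => insert i U) (fun U => U.erase i) ?_ ?_ ?_ ?_ ?_
  · intro U hU; simp
  · intro U hU; simp
  · intro U hU
    simp only [Finset.mem_filter, Finset.mem_univ, true_and] at hU
    exact Finset.erase_insert hU
  · intro U hU
    simp only [Finset.mem_filter, Finset.mem_univ, true_and] at hU
    exact Finset.insert_erase hU
  · intro U hU
    simp only [Finset.mem_filter, Finset.mem_univ, true_and] at hU
    rw [Finset.erase_insert hU]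

/-- conditions for the map `p ↦ w * p(Y)` to be well defined -/
structure Thet (L : Set (Finset E)) (σ : Finset (Finset E)) (L0 : Set (Finset E))
    (τ : Finset (Finset E)) (i : E) (w : CR L σ) : Prop where
  m1 : ∀ S ∈ Lk L0 τ, ∀ T ∈ Lk L0 τ, cmp (insert i S) (insert i T) → cmp S T
  inj : ∀ S ∈ Lk L0 τ, ∀ T ∈ Lk L0 τ, insert i S = insert i T → S = T
  cov : ∀ G ∈ Lk L σ, w * xx L σ G = 0 ∨ (∃ S ∈ Lk L0 τ, insert i G = insert i S) ∨
    ∃ T ∈ τ, insert i G = insert i T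
  aff : ∀ μ, Aff μ → (∀ T ∈ τ, μ T = 0) → (∀ S ∈ Lk L0 τ, μ (insert i S) = μ S) ∧
    (∀ T ∈ σ, μ (insert i T) = 0) ∧ ∀ T ∈ τ, μ (insert i T) = 0

open Classical in
noncomputable def yv (L : Set (Finset E)) (σ : Finset (Finset E)) (L0 : Set (Finset E))
    (τ : Finset (Finset E)) (i : E) (S : Finset E) : CR L σ :=
  if S ∈ Lk L0 τ then YY L σ i S else 0

theorem yv_of_mem {S : Finset E} (h : S ∈ Lk L0 τ) : yv L σ L0 τ i S = YY L σ i S := if_pos h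

theorem yv_of_not_mem {S : Finset E} (h : S ∉ Lk L0 τ) : yv L σ L0 τ i S = 0 := if_neg h

theorem yv_mem (S : Finset E) : yv L σ L0 τ i S ∈ piece L σ 1 := by
  unfold yv
  split_ifs
  · exact YY_mem S
  · exact Submodule.zero_mem _

theorem Thet.sum {w : CR L σ} (h : Thet L σ L0 τ i w) {c : Finset E → ℝ}
    (hc : ∀ S, c (insert i S) = c S) (h0 : ∀ T ∈ τ, c T = 0) :
    w * ∑ S, c S • yv L σ L0 τ i S = w * ell L σ c := by
  classical
  have e1 : ell L σ c = ∑ U ∈ Finset.univ.filter (fun U => i ∈ U), c U • YY L σ i U := by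
    rw [ell, sum_pair i]
    refine Finset.sum_congr rfl fun U hU => ?_
    simp only [Finset.mem_filter, Finset.mem_univ, true_and] at hU
    have : c (U.erase i) = c U := by rw [← hc, Finset.insert_erase hU]
    rw [this, YY, Finset.insert_eq_of_mem hU, smul_add]
  have e2 : ∑ S, c S • yv L σ L0 τ i S =
      ∑ U ∈ (Finset.univ.filter (fun S => S ∈ Lk L0 τ)).image (insert i), c U • YY L σ i U := by
    rw [Finset.sum_image]
    · rw [Finset.sum_filter]
      refine Finset.sum_congr rfl fun S _ => ?_
      split_ifs with hS
      · rw [yv_of_mem hS, hc, YY_insert]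
      · rw [yv_of_not_mem hS, smul_zero]
    · intro S hS T hT hST
      simp only [Finset.coe_filter, Finset.mem_univ, true_and, Set.mem_setOf_eq] at hS hT
      exact h.inj S hS T hT hST
  rw [e1, e2, Finset.mul_sum, Finset.mul_sum]
  refine Finset.sum_subset ?_ ?_
  · intro U hU
    obtain ⟨S, hS, rfl⟩ := Finset.mem_image.1 hU
    simp
  · intro U hU hU'
    simp only [Finset.mem_filter, Finset.mem_univ, true_and] at hU
    by_cases hcU : c U = 0
    · rw [hcU, zero_smul, mul_zero]
    · have key : ∀ G, insert i G = U → w * xx L σ G = 0 := by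
        intro G hG
        by_cases hGL : G ∈ Lk L σ
        · rcases h.cov G hGL with h1 | ⟨S, hS, h1⟩ | ⟨T, hT, h1⟩
          · exact h1
          · exact absurd (Finset.mem_image.2 ⟨S, by simp [hS], h1.symm.trans hG⟩) hU'
          · refine absurd ?_ hcU
            rw [← hG, h1, hc, h0 T hT]
        · rw [xx_eq_zero hGL, mul_zero]
      rw [mul_smul_comm, YY, mul_add, key _ (by simp [hU]),
        key _ (Finset.insert_erase hU), add_zero, smul_zero]

theorem Thet.rel {w : CR L σ} (h : Thet L σ L0 τ i w) :
    ∀ p ∈ rel L0 τ, w * aeval (yv L σ L0 τ i) p = 0 := by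
  rintro p (⟨S, hS, rfl⟩ | ⟨S, T, hST, rfl⟩ | ⟨μ, hμ, hμ0, rfl⟩)
  · rw [aeval_X, yv_of_not_mem hS, mul_zero]
  · rw [map_mul, aeval_X, aeval_X]
    by_cases hS : S ∈ Lk L0 τ
    · by_cases hT : T ∈ Lk L0 τ
      · rw [yv_of_mem hS, yv_of_mem hT, YY, YY]
        have key : ∀ A B : Finset E, insert i A = insert i S → insert i B = insert i T →
            xx L σ A * xx L σ B = 0 := by
          intro A B hA hB
          refine xx_mul_eq_zero fun hc => hST (h.m1 S hS T hT ?_)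
          rw [← hA, ← hB]
          exact cmp_insert i hc
        rw [mul_add, add_mul, add_mul, key _ _ (by simp) (by simp), key _ _ (by simp) (insert_erase' T),
          key _ _ (insert_erase' S) (by simp), key _ _ (insert_erase' S) (insert_erase' T)]
        simp
      · rw [yv_of_not_mem hT, mul_zero, mul_zero]
    · rw [yv_of_not_mem hS, zero_mul, mul_zero]
  · obtain ⟨h1, h2, h3⟩ := h.aff μ hμ hμ0
    have e := h.sum (c := fun S => μ (insert i S)) (fun S => by simp) h3
    rw [ell_aff (hμ.insert i) h2, mul_zero] at e
    refine Eq.trans ?_ e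
    rw [map_sum]
    congr 1
    refine Finset.sum_congr rfl fun S _ => ?_
    rw [map_mul, aeval_X, aeval_C, Algebra.algebraMap_eq_smul_one, smul_mul_assoc, one_mul]
    by_cases hS : S ∈ Lk L0 τ
    · rw [h1 S hS]
    · rw [yv_of_not_mem hS, smul_zero, smul_zero]

/-- the map `p ↦ w * p(Y)` -/
noncomputable def Thet.map {w : CR L σ} (h : Thet L σ L0 τ i w) : CR L0 τ →ₗ[ℝ] CR L σ :=
  push w (yv L σ L0 τ i) h.rel

variable {w : CR L σ} (h : Thet L σ L0 τ i w)

theorem Thet.map_one : h.map 1 = w := push_one _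

theorem Thet.map_mk (p : MvPolynomial (Finset E) ℝ) :
    h.map (HRProof.mk L0 τ p) = w * aeval (yv L σ L0 τ i) p := push_mk _ p

theorem Thet.map_dvd (b : CR L0 τ) : ∃ b', h.map b = w * b' := by
  obtain ⟨p, rfl⟩ := mk_surj _ _ b
  exact ⟨_, h.map_mk p⟩

theorem Thet.map_xx {S : Finset E} (hS : S ∈ Lk L0 τ) (b : CR L0 τ) :
    h.map (xx L0 τ S * b) = YY L σ i S * h.map b := by
  rw [Thet.map, push_xx_mul, yv_of_mem hS]

theorem Thet.map_mul (a b : CR L0 τ) : h.map a * h.map b = w * h.map (a * b) := by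
  obtain ⟨p, rfl⟩ := mk_surj _ _ a
  obtain ⟨q, rfl⟩ := mk_surj _ _ b
  rw [← _root_.map_mul (HRProof.mk L0 τ), h.map_mk, h.map_mk, h.map_mk, _root_.map_mul]; ring

theorem Thet.map_ell {c : Finset E → ℝ} (hc : ∀ S, c (insert i S) = c S)
    (h0 : ∀ T ∈ τ, c T = 0) (b : CR L0 τ) : h.map (ell L0 τ c * b) = ell L σ c * h.map b := by
  obtain ⟨b', hb'⟩ := h.map_dvd b
  have := h.sum hc h0
  rw [Thet.map, push_ell_mul]
  rw [Thet.map] at hb'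
  rw [hb', ← mul_assoc, mul_comm _ w, this]
  ring

theorem Thet.map_mem {n : ℕ} (hw : w ∈ piece L σ n) (k : ℕ) (a : CR L0 τ) (ha : a ∈ piece L0 τ k) :
    h.map a ∈ piece L σ (k + n) :=
  push_mem _ (piece L σ) piece_mul_mem hw yv_mem k a ha

/-- indicator of a pair -/
noncomputable def pind (i : E) (U : Finset E) (S : Finset E) : ℝ :=
  if insert i S = insert i U then 1 else 0

theorem ell_pind (U : Finset E) : ell L σ (pind i U) = YY L σ i U := by
  rw [ell, sum_pair i, Finset.sum_eq_single (insert i U)]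
  · rw [YY]
    simp [pind, insert_erase']
  · intro V hV hVU
    simp only [Finset.mem_filter, Finset.mem_univ, true_and] at hV
    have h1 : insert i V ≠ insert i U := by rwa [Finset.insert_eq_of_mem hV]
    have h2 : insert i (V.erase i) ≠ insert i U := by rwa [insert_erase']
    simp [pind, h1, h2, -Finset.insert_erase]
  · intro h; simp at h

end theta

/-! pairs `F, F ∪ i` in a gap -/

section pair
variable {E : Type*} [Fintype E] [DecidableEq E] {L : Set (Finset E)}
  {σ τ : Finset (Finset E)} {i : E} {P Q : Finset E}

/-- a flag `τ` containing `F` and `F ∪ i` -/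
structure Pr (L : Set (Finset E)) (τ : Finset (Finset E)) (i : E) (F : Finset E) : Prop where
  iF : i ∉ F
  F_mem : F ∈ τ
  F_mem' : insert i F ∈ τ

theorem Pr.dich {F : Finset E} (p : Pr L τ i F) {S : Finset E} (hS : S ∈ Lk L τ) :
    (S ⊂ F ∧ i ∉ S) ∨ (insert i F ⊂ S ∧ i ∈ S) := by
  have n1 : S ≠ F := by rintro rfl; exact hS.2.1 p.F_mem
  have n2 : S ≠ insert i F := by rintro rfl; exact hS.2.1 p.F_mem'
  rcases hS.2.2 F p.F_mem with h | h
  · left; exact ⟨lt_of_le_of_ne h n1, fun hi => p.iF (h hi)⟩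
  · right
    rcases hS.2.2 _ p.F_mem' with h' | h'
    · exfalso
      by_cases hi : i ∈ S
      · exact n2 (Finset.Subset.antisymm h' (Finset.insert_subset hi h))
      · refine n1 (Finset.Subset.antisymm (fun a ha => ?_) h)
        rcases Finset.mem_insert.1 (h' ha) with rfl | h''
        · exact absurd ha hi
        · exact h''
    · exact ⟨lt_of_le_of_ne h' n2.symm, h' (Finset.mem_insert_self _ _)⟩

theorem insert_sub_cancel {S T : Finset E} (hS : i ∉ S) (h : insert i S ⊆ insert i T) : S ⊆ T := by
  intro a ha
  rcases Finset.mem_insert.1 (h (Finset.mem_insert_of_mem ha)) with rfl | h'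
  · exact absurd ha hS
  · exact h'

theorem sub_insert_cancel {S T : Finset E} (hS : i ∉ S) (h : S ⊆ insert i T) : S ⊆ T := by
  intro a ha
  rcases Finset.mem_insert.1 (h ha) with rfl | h'
  · exact absurd ha hS
  · exact h'

theorem Pr.m1 {F : Finset E} (p : Pr L τ i F) : ∀ S ∈ Lk L τ, ∀ T ∈ Lk L τ,
    cmp (insert i S) (insert i T) → cmp S T := by
  intro S hS T hT hc
  rcases p.dich hS with ⟨h1, h2⟩ | ⟨h1, h2⟩ <;> rcases p.dich hT with ⟨h3, h4⟩ | ⟨h3, h4⟩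
  · exact hc.imp (insert_sub_cancel h2) (insert_sub_cancel h4)
  · exact Or.inl (h1.1.trans ((Finset.subset_insert _ _).trans h3.1))
  · exact Or.inr (h3.1.trans ((Finset.subset_insert _ _).trans h1.1))
  · rwa [Finset.insert_eq_of_mem h2, Finset.insert_eq_of_mem h4] at hc

theorem Pr.inj (hτ : IsFlag L τ) {F : Finset E} (p : Pr L τ i F) : ∀ S ∈ Lk L τ, ∀ T,
    T ∈ Lk L τ ∨ T ∈ τ → insert i S = insert i T → S = T := by
  intro S hS T hT he
  by_cases hiST : i ∈ S ↔ i ∈ T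
  · by_cases hi : i ∈ S
    · rwa [Finset.insert_eq_of_mem hi, Finset.insert_eq_of_mem (hiST.1 hi)] at he
    · exact Finset.Subset.antisymm (insert_sub_cancel hi he.le)
        (insert_sub_cancel (fun h => hi (hiST.2 h)) he.ge)
  · exfalso
    have hTF : cmp T F := by
      rcases hT with h | h
      · exact h.2.2 F p.F_mem
      · exact hτ.chain T h F p.F_mem
    have hTF' : cmp T (insert i F) := by
      rcases hT with h | h
      · exact h.2.2 _ p.F_mem'
      · exact hτ.chain T h _ p.F_mem'
    rcases p.dich hS with ⟨h1, h2⟩ | ⟨h1, h2⟩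
    · have hiT : i ∈ T := by tauto
      rw [Finset.insert_eq_of_mem hiT] at he
      have : F ⊆ T := by
        rcases hTF with h | h
        · exact absurd (h hiT) p.iF
        · exact h
      rw [← he] at this
      exact h1.2 (sub_insert_cancel p.iF this)
    · have hiT : i ∉ T := by tauto
      rw [Finset.insert_eq_of_mem h2] at he
      have : T ⊆ insert i F := by
        rcases hTF' with h | h
        · exact h
        · exact absurd (h (Finset.mem_insert_self _ _)) hiT
      have h3 : S ⊆ insert i F := by
        rw [he]; exact Finset.insert_subset (Finset.mem_insert_self _ _) this
      exact h1.2 h3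

theorem Pr.aff {F : Finset E} (p : Pr L τ i F) {μ : Finset E → ℝ} (hμ : Aff μ)
    (h0 : ∀ T ∈ τ, μ T = 0) : ∀ S, μ (insert i S) = μ S := by
  obtain ⟨c, w, h⟩ := hμ
  have h1 := h0 F p.F_mem
  have h2 := h0 _ p.F_mem'
  rw [h] at h1 h2
  rw [Finset.sum_insert p.iF] at h2
  have hw : w i = 0 := by linarith
  intro S
  rw [h, h]
  by_cases hi : i ∈ S
  · rw [Finset.insert_eq_of_mem hi]
  · rw [Finset.sum_insert hi, hw, zero_add]

theorem Pr.thet (hτ : IsFlag L τ) (hστ : σ ⊆ τ) {F : Finset E} (p : Pr L τ i F) {w : CR L σ}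
    (cov : ∀ G ∈ Lk L σ, w * xx L σ G = 0 ∨ (∃ S ∈ Lk L τ, insert i G = insert i S) ∨
      ∃ T ∈ τ, insert i G = insert i T) : Thet L σ L τ i w where
  m1 := p.m1
  inj S hS T hT := p.inj hτ S hS T (Or.inl hT)
  cov := cov
  aff μ hμ h0 := by
    have := p.aff hμ h0
    exact ⟨fun S _ => this S, fun T hT => by rw [this, h0 T (hστ hT)],
      fun T hT => by rw [this, h0 T hT]⟩

end pair

end HRProof


namespace HRProof

open MvPolynomial

section link
variable {E : Type*} [Fintype E] [DecidableEq E] {L : Set (Finset E)}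
  {σ : Finset (Finset E)} {i : E} {P Q : Finset E}

/-- the index set of the decomposition -/
structure InS (L : Set (Finset E)) (σ : Finset (Finset E)) (i : E) (F : Finset E) : Prop where
  mem : F ∈ Lk L σ
  iF : i ∉ F
  mem' : insert i F ∈ Lk L σ

/-- the flag attached to `F` -/
abbrev tau (σ : Finset (Finset E)) (i : E) (F : Finset E) : Finset (Finset E) :=
  insert F (insert (insert i F) σ)

def Closed (L : Set (Finset E)) (i : E) (P Q : Finset E) : Prop :=
  ∀ G ∈ L, i ∉ G → P ⊂ G → G ⊂ Q → insert i G ∈ L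

theorem link_notin (g : Gap σ i P Q) {G : Finset E} (hG : G ∈ Lk L σ) (hi : i ∈ G) : P ⊂ G := by
  rcases g.trichotomy hG with h | h | h
  · exact absurd (h.1 hi) g.iP
  · exact h.1
  · rcases hG.2.2 P g.P_mem with h' | h'
    · exact absurd (h' hi) g.iP
    · exact lt_of_le_of_ne h' fun h => hG.2.1 (h ▸ g.P_mem)

theorem link_notin' (g : Gap σ i P Q) {G : Finset E} (hG : G ∈ Lk L σ) (hi : i ∉ G) : G ⊂ Q := by
  rcases hG.2.2 Q g.Q_mem with h' | h'
  · exact lt_of_le_of_ne h' fun h => hG.2.1 (h ▸ g.Q_mem)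
  · exact absurd (h' g.iQ) hi

theorem InS.bd (g : Gap σ i P Q) {F : Finset E} (h : InS L σ i F) : P ⊂ F ∧ insert i F ⊂ Q := by
  have h1 := link_notin g h.mem' (Finset.mem_insert_self _ _)
  have h2 := link_notin' g h.mem h.iF
  refine ⟨lt_of_le_of_ne (sub_insert_cancel g.iP h1.1) fun hh => h.mem.2.1 (hh ▸ g.P_mem), ?_⟩
  exact lt_of_le_of_ne (Finset.insert_subset g.iQ h2.1) fun hh => h.mem'.2.1 (hh ▸ g.Q_mem)

theorem InS.ne {F : Finset E} (h : InS L σ i F) : insert i F ≠ F := fun hh => h.iF (by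
  rw [← hh]; exact Finset.mem_insert_self _ _)

theorem InS.link {F : Finset E} (h : InS L σ i F) : F ∈ Lk L (insert (insert i F) σ) :=
  mem_Lk_insert.2 ⟨h.mem, h.ne.symm, Or.inl (Finset.subset_insert _ _)⟩

theorem InS.base (hσ : Base L σ) {F : Finset E} (h : InS L σ i F) : Base L (tau σ i F) :=
  (hσ.insert h.mem').insert h.link

theorem InS.card {F : Finset E} (h : InS L σ i F) : (tau σ i F).card = σ.card + 2 := by
  rw [tau, Finset.card_insert_of_notMem h.link.2.1, Finset.card_insert_of_notMem h.mem'.2.1]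

theorem InS.pr {F : Finset E} (h : InS L σ i F) : Pr L (tau σ i F) i F where
  iF := h.iF
  F_mem := Finset.mem_insert_self _ _
  F_mem' := Finset.mem_insert_of_mem (Finset.mem_insert_self _ _)

theorem sub_tau {F : Finset E} : σ ⊆ tau σ i F := fun _ hT =>
  Finset.mem_insert_of_mem (Finset.mem_insert_of_mem hT)

theorem mem_tau {F S : Finset E} (hS : S ∈ Lk L σ) (h1 : S ≠ F) (h2 : S ≠ insert i F)
    (h3 : cmp S F) (h4 : cmp S (insert i F)) : S ∈ Lk L (tau σ i F) :=
  mem_Lk_insert.2 ⟨mem_Lk_insert.2 ⟨hS, h2, h4⟩, h1, h3⟩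

theorem tau_Lk {F S : Finset E} (hS : S ∈ Lk L (tau σ i F)) : S ∈ Lk L σ :=
  (Lk_of_insert (Lk_of_insert hS).1).1

theorem thet_link (hL : FlatFam L) (hσ : Base L σ) (g : Gap σ i P Q) {F W : Finset E}
    (h : InS L σ i F) (hW : W = insert i F ∨ (W = F ∧ Closed L i P Q)) :
    Thet L σ L (tau σ i F) i (xx L σ W) := by
  refine h.pr.thet (h.base hσ).toIsFlag sub_tau fun G hG => ?_
  have hF1 : F ∈ tau σ i F := h.pr.F_mem
  have bd := h.bd g
  by_cases hGF : insert i G = insert i F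
  · exact Or.inr (Or.inr ⟨F, hF1, hGF⟩)
  have n1 : G ≠ F := by rintro rfl; exact hGF rfl
  have n2 : G ≠ insert i F := by rintro rfl; simp at hGF
  by_cases hc : cmp W G
  swap
  · exact Or.inl (xx_mul_eq_zero hc)
  right
  rcases hc with hc | hc
  · have hFG : F ⊆ G := by
      rcases hW with rfl | ⟨rfl, -⟩
      · exact (Finset.subset_insert _ _).trans hc
      · exact hc
    by_cases hi : i ∈ G
    · exact Or.inl ⟨G, mem_tau hG n1 n2 (Or.inr hFG) (Or.inr (Finset.insert_subset hi hFG)), rfl⟩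
    · rcases hW with rfl | ⟨rfl, hcl⟩
      · exact absurd (hc (Finset.mem_insert_self _ _)) hi
      · have hGQ := link_notin' g hG hi
        have hPG : P ⊂ G := lt_of_lt_of_le bd.1 hFG
        have := hcl G hG.1 hi hPG hGQ
        by_cases hQ : insert i G = Q
        · right
          refine ⟨Q, sub_tau g.Q_mem, ?_⟩
          rw [hQ, Finset.insert_eq_of_mem g.iQ]
        · left
          refine ⟨insert i G, mem_tau (g.mem_link this (lt_of_lt_of_le hPG (Finset.subset_insert _ _))
            (lt_of_le_of_ne (Finset.insert_subset g.iQ hGQ.1) hQ)) ?_ hGF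
            (Or.inr (hFG.trans (Finset.subset_insert _ _)))
            (Or.inr (Finset.insert_subset_insert _ hFG)), by simp⟩
          intro hh; exact h.iF (hh ▸ Finset.mem_insert_self _ _)
  · by_cases hi : i ∈ G
    · rcases hW with rfl | ⟨rfl, hcl⟩
      swap
      · exact absurd (hc hi) h.iF
      have hPG := link_notin g hG hi
      have e1 : insert i (G ∩ F) = G := by
        ext a
        simp only [Finset.mem_insert, Finset.mem_inter]
        constructor
        · rintro (rfl | h) <;> tauto
        · intro ha
          rcases Finset.mem_insert.1 (hc ha) with rfl | h' <;> tauto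
      have e2 : insert i G = insert i (G ∩ F) := by rw [e1, Finset.insert_eq_of_mem hi]
      by_cases hP : G ∩ F = P
      · exact Or.inr ⟨P, sub_tau g.P_mem, by rw [e2, hP]⟩
      left
      have hm : G ∩ F ∈ L := hL.inter_mem _ hG.1 _ h.mem.1
      have hP' : P ⊂ G ∩ F := lt_of_le_of_ne (Finset.subset_inter hPG.1 bd.1.1) (Ne.symm hP)
      have hQ' : G ∩ F ⊂ Q := lt_of_le_of_lt (Finset.inter_subset_right.trans
        (Finset.subset_insert i F)) bd.2
      refine ⟨G ∩ F, mem_tau (g.mem_link hm hP' hQ') ?_ ?_ (Or.inl Finset.inter_subset_right)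
        (Or.inl (Finset.inter_subset_right.trans (Finset.subset_insert i F))), e2⟩
      · intro hh; rw [hh] at e2; exact hGF e2
      · intro hh
        have : i ∈ G ∩ F := hh ▸ Finset.mem_insert_self _ _
        exact h.iF (Finset.mem_inter.1 this).2
    · have hGF : G ⊆ F := by
        rcases hW with rfl | ⟨rfl, -⟩
        · exact sub_insert_cancel hi hc
        · exact hc
      exact Or.inl ⟨G, mem_tau hG n1 n2 (Or.inl hGF)
        (Or.inl (hGF.trans (Finset.subset_insert _ _))), rfl⟩

theorem dif_inv {j j' : E} (h : j ≠ i) (h' : j' ≠ i) (S : Finset E) :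
    dif j j' (insert i S) = dif j j' S := by
  simp [dif, h, h']

theorem lemE (g : Gap σ i P Q) {F : Finset E} (hF : InS L σ i F)
    {w : CR L σ} (h : Thet L σ L (tau σ i F) i w) {U : Finset E}
    (hU : ∀ T ∈ σ, insert i U ≠ insert i T) :
    ∃ c1 ∈ piece L (tau σ i F) 1, ∀ c, h.map (c1 * c) = YY L σ i U * h.map c := by
  have bd := hF.bd g
  by_cases h1 : insert i U = insert i F
  · obtain ⟨j, hjF, hjP⟩ := Finset.exists_of_ssubset bd.1
    obtain ⟨j', hj'Q, hj'F⟩ := Finset.exists_of_ssubset bd.2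
    have hji : j ≠ i := by rintro rfl; exact hF.iF hjF
    have hj'i : j' ≠ i := by rintro rfl; exact hj'F (Finset.mem_insert_self _ _)
    have hj'F' : j' ∉ F := fun h => hj'F (Finset.mem_insert_of_mem h)
    have hgap := dif_gap g hjP (bd.2.1 (Finset.mem_insert_of_mem hjF)) (fun h => hj'F' (bd.1.1 h)) hj'Q
    refine ⟨- ell L (tau σ i F) (fun S => dif j j' S - pind i F S),
      Submodule.neg_mem _ (ell_mem _), fun c => ?_⟩
    have e1 : ell L σ (fun S => dif j j' S - pind i F S) = - YY L σ i U := by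
      rw [ell_sub, ell_pind, ell_aff (Aff.dif j j') hgap, zero_sub, YY_congr h1]
    rw [neg_mul, map_neg, h.map_ell, e1]
    · ring
    · intro S; rw [dif_inv hji hj'i]; simp [pind]
    · intro T hT
      rcases Finset.mem_insert.1 hT with rfl | hT'
      · simp [dif, pind, hjF, hj'F']
      rcases Finset.mem_insert.1 hT' with rfl | hT''
      · rw [dif_inv hji hj'i]; simp [dif, pind, hjF, hj'F']
      · rw [hgap T hT'', pind, if_neg, sub_zero]
        intro hh; exact hU T hT'' (h1.trans hh.symm)
  · by_cases h2 : ∃ S ∈ Lk L (tau σ i F), insert i U = insert i S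
    · obtain ⟨S, hS, hUS⟩ := h2
      exact ⟨xx L _ S, xx_mem _, fun c => by rw [h.map_xx hS, YY_congr hUS]⟩
    · refine ⟨0, Submodule.zero_mem _, fun c => ?_⟩
      have key : ∀ G, insert i G = insert i U → w * xx L σ G = 0 := by
        intro G hG
        by_cases hGL : G ∈ Lk L σ
        · rcases h.cov G hGL with h3 | ⟨S, hS, h3⟩ | ⟨T, hT, h3⟩
          · exact h3
          · exact absurd ⟨S, hS, hG.symm.trans h3⟩ h2
          · exfalso
            have h4 := hG.symm.trans h3
            rcases Finset.mem_insert.1 hT with rfl | hT'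
            · exact h1 h4
            rcases Finset.mem_insert.1 hT' with rfl | hT''
            · apply h1; rw [h4]; simp
            · exact hU T hT'' h4
        · rw [xx_eq_zero hGL, mul_zero]
      obtain ⟨b', hb'⟩ := h.map_dvd c
      have : w * YY L σ i U = 0 := by
        rw [YY, mul_add, key _ (by simp), key _ (insert_erase' U), add_zero]
      rw [zero_mul, map_zero, hb', ← mul_assoc, mul_comm _ w, this, zero_mul]

/-- multiplication by the image of another theta map preserves the image -/
theorem lemE_map {L0 : Set (Finset E)} {ρ : Finset (Finset E)} (g : Gap σ i P Q) {F : Finset E}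
    (hF : InS L σ i F) {w : CR L σ} (h : Thet L σ L (tau σ i F) i w) {w0 : CR L σ}
    (h0 : Thet L σ L0 ρ i w0) (hρ : ∀ S ∈ Lk L0 ρ, ∀ T ∈ σ, insert i S ≠ insert i T)
    (k : ℕ) (b : CR L0 ρ) (hb : b ∈ piece L0 ρ k) :
    ∃ c1 ∈ piece L (tau σ i F) k, ∀ c, h0.map b * h.map c = w0 * h.map (c1 * c) := by
  obtain ⟨p, hp, rfl⟩ := hb
  obtain ⟨c1, hc1, hc⟩ := lift_mul (piece L (tau σ i F)) piece_one_mem piece_mul_mem h.map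
    (yv L σ L0 ρ i) (fun S => by
      by_cases hS : S ∈ Lk L0 ρ
      · rw [yv_of_mem hS]; exact lemE g hF h (hρ S hS)
      · rw [yv_of_not_mem hS]
        exact ⟨0, Submodule.zero_mem _, fun c => by simp⟩) k p hp
  refine ⟨c1, hc1, fun c => ?_⟩
  have e := h0.map_mk p
  rw [hc, ← mul_assoc, ← e]; rfl

theorem tau_ne (hσ : Base L σ) {F : Finset E} (hF : InS L σ i F) :
    ∀ S ∈ Lk L (tau σ i F), ∀ T ∈ σ, insert i S ≠ insert i T := by
  intro S hS T hT he
  have := hF.pr.inj (hF.base hσ).toIsFlag S hS T (Or.inr (sub_tau hT)) he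
  exact hS.2.1 (this ▸ sub_tau hT)

theorem F_ne (g : Gap σ i P Q) {F : Finset E} (hF : InS L σ i F) (hσ : Base L σ) :
    ∀ T ∈ σ, insert i F ≠ insert i T := by
  intro T hT he
  have bd := hF.bd g
  by_cases hi : i ∈ T
  · rw [Finset.insert_eq_of_mem hi] at he
    exact hF.mem'.2.1 (he ▸ hT)
  · refine hF.mem.2.1 ?_
    rwa [Finset.Subset.antisymm (insert_sub_cancel hF.iF he.le) (insert_sub_cancel hi he.ge)]

/-- the iterated Gysin map of the pair `F, F ∪ i` -/
noncomputable def gg (L : Set (Finset E)) (σ : Finset (Finset E)) (i : E) (F : Finset E) :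
    CR L (tau σ i F) →ₗ[ℝ] CR L σ :=
  (gys L σ (insert i F)) ∘ₗ (gys L (insert (insert i F) σ) F)

theorem gg_one {F : Finset E} (hF : InS L σ i F) :
    gg L σ i F 1 = xx L σ F * xx L σ (insert i F) := by
  show gys L σ (insert i F) (gys L (insert (insert i F) σ) F 1) = _
  rw [gys_one, ← mul_one (xx L (insert (insert i F) σ) F), gys_xx_mul hF.ne.symm, gys_one]

theorem gg_xx {F S : Finset E} (n1 : S ≠ F) (n2 : S ≠ insert i F) (p : CR L (tau σ i F)) :
    gg L σ i F (xx L (tau σ i F) S * p) = xx L σ S * gg L σ i F p :=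
  (congrArg (gys L σ (insert i F)) (gys_xx_mul n1 (p : CR L (insert F (insert (insert i F) σ))))).trans
    (gys_xx_mul n2 _)

theorem InS.nrm {F : Finset E} (h : InS L σ i F) {N : ℕ} {deg : CR L σ →ₗ[ℝ] ℝ}
    (hd : Nrm L σ N deg) : Nrm L (tau σ i F) N (deg ∘ₗ gg L σ i F) := by
  rw [gg, ← LinearMap.comp_assoc]
  exact (hd.gys h.mem').gys h.link

theorem xbar {F W : Finset E} (hF : InS L σ i F) (hW : W = insert i F ∨ W = F)
    (h : Thet L σ L (tau σ i F) i (xx L σ W)) : ∀ k, ∀ z ∈ piece L (tau σ i F) k,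
    (YY L σ i F - xx L σ W) * h.map z = gg L σ i F z := by
  have e0 : (YY L σ i F - xx L σ W) * xx L σ W = xx L σ F * xx L σ (insert i F) := by
    rw [YY, Finset.erase_eq_of_notMem hF.iF]
    rcases hW with rfl | rfl <;> ring
  refine piece_ind ?_ ?_ ?_ ?_ ?_
  · rw [h.map_one, gg_one hF, e0]
  · intro k; simp only [map_zero, mul_zero]
  · intro k p q hp hq; simp only [map_add, mul_add] at *; rw [hp, hq]
  · intro k r p hp; simp only [map_smul, mul_smul_comm] at *; rw [hp]
  · intro k p S hS hp
    have n1 : S ≠ F := by rintro rfl; exact hS.2.1 hF.pr.F_mem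
    have n2 : S ≠ insert i F := by rintro rfl; exact hS.2.1 hF.pr.F_mem'
    rw [h.map_xx hS, gg_xx n1 n2, ← hp]
    obtain ⟨b', hb'⟩ := h.map_dvd p
    have e1 : YY L σ i S * (xx L σ F * xx L σ (insert i F)) =
        xx L σ S * (xx L σ F * xx L σ (insert i F)) := by
      rw [YY]
      rcases hF.pr.dich hS with ⟨h1, h2⟩ | ⟨h1, h2⟩
      · rw [Finset.erase_eq_of_notMem h2, add_mul]
        rw [← mul_assoc (xx L σ (insert i S)), xx_mul_eq_zero (S := insert i S) (T := F), zero_mul,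
          zero_add]
        rintro (h3 | h3)
        · exact hF.iF (h3 (Finset.mem_insert_self _ _))
        · exact h1.2 (sub_insert_cancel hF.iF h3)
      · rw [Finset.insert_eq_of_mem h2, add_mul]
        rw [mul_left_comm (xx L σ (S.erase i)), xx_mul_eq_zero (S := S.erase i) (T := insert i F),
          mul_zero, add_zero]
        rintro (h3 | h3)
        · refine h1.2 fun a ha => ?_
          by_cases hai : a = i
          · subst hai; exact Finset.mem_insert_self _ _
          · exact h3 (Finset.mem_erase.2 ⟨hai, ha⟩)
        · simpa using h3 (Finset.mem_insert_self _ _)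
    calc (YY L σ i F - xx L σ W) * (YY L σ i S * h.map p)
        = YY L σ i S * ((YY L σ i F - xx L σ W) * xx L σ W) * b' := by rw [hb']; ring
      _ = xx L σ S * ((YY L σ i F - xx L σ W) * h.map p) := by rw [e0, e1, hb', ← e0]; ring

/-- self pairing on the `F` summand -/
theorem link_CC (g : Gap σ i P Q) (hσ : Base L σ) {F W : Finset E} (hF : InS L σ i F)
    (hW : W = insert i F ∨ W = F) (h : Thet L σ L (tau σ i F) i (xx L σ W)) {e : ℕ}
    (htop : ∀ z ∈ piece L (tau σ i F) (e + 1), z = 0) {a b : ℕ} (hab : a + b = e)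
    {c c' : CR L (tau σ i F)} (hc : c ∈ piece L (tau σ i F) a) (hc' : c' ∈ piece L (tau σ i F) b) :
    h.map c * h.map c' = - gg L σ i F (c * c') := by
  have hz : c * c' ∈ piece L (tau σ i F) e := hab ▸ piece_mul_mem _ _ _ _ hc hc'
  rw [h.map_mul, ← xbar hF hW h e _ hz]
  obtain ⟨c1, hc1, hc2⟩ := lemE g hF h (F_ne g hF hσ)
  have : YY L σ i F * h.map (c * c') = 0 := by
    have h3 : c1 * (c * c') ∈ piece L (tau σ i F) (e + 1) := by
      have := piece_mul_mem _ _ _ _ hc1 hz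
      rwa [add_comm] at this
    rw [← hc2, htop _ h3, map_zero]
  rw [sub_mul, this]; ring

/-- pairing between different summands when the product of the weights vanishes or lifts -/
theorem link_CC' (g : Gap σ i P Q) (hσ : Base L σ) {F F' : Finset E} (hF : InS L σ i F)
    (hF' : InS L σ i F') {w w' : CR L σ} (h : Thet L σ L (tau σ i F) i w)
    (h' : Thet L σ L (tau σ i F') i w') {e : ℕ}
    (htop : ∀ z ∈ piece L (tau σ i F) (e + 1), z = 0)
    (hww : ∃ c1 ∈ piece L (tau σ i F) 1, ∀ c, h.map (c1 * c) = w' * h.map c) {a b : ℕ}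
    (hab : a + b = e) {c : CR L (tau σ i F)} {c' : CR L (tau σ i F')}
    (hc : c ∈ piece L (tau σ i F) a) (hc' : c' ∈ piece L (tau σ i F') b) :
    h.map c * h'.map c' = 0 := by
  obtain ⟨c2, hc2, h2⟩ := lemE_map g hF h h' (tau_ne hσ hF') b c' hc'
  obtain ⟨c1, hc1, h1⟩ := hww
  have h3 : c1 * (c2 * c) ∈ piece L (tau σ i F) (e + 1) := by
    have := piece_mul_mem _ _ _ _ hc1 (piece_mul_mem _ _ _ _ hc2 hc)
    rwa [show 1 + (b + a) = e + 1 by omega] at this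
  rw [mul_comm, h2, ← h1, htop _ h3, map_zero]

theorem link_BC {L0 : Set (Finset E)} {ρ : Finset (Finset E)} (g : Gap σ i P Q) {F : Finset E}
    (hF : InS L σ i F) {w : CR L σ} (h : Thet L σ L (tau σ i F) i w) {w0 : CR L σ}
    (h0 : Thet L σ L0 ρ i w0) (hρ : ∀ S ∈ Lk L0 ρ, ∀ T ∈ σ, insert i S ≠ insert i T) {e : ℕ}
    (htop : ∀ z ∈ piece L (tau σ i F) (e + 1), z = 0) {a b : ℕ}
    (hab : a + b = e + 1) {c : CR L (tau σ i F)} {c' : CR L0 ρ}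
    (hc : c ∈ piece L (tau σ i F) a) (hc' : c' ∈ piece L0 ρ b) :
    h0.map c' * h.map c = 0 := by
  obtain ⟨c2, hc2, h2⟩ := lemE_map g hF h h0 hρ b c' hc'
  have h3 : c2 * c ∈ piece L (tau σ i F) (e + 1) := by
    have := piece_mul_mem _ _ _ _ hc2 hc
    rwa [show b + a = e + 1 by omega] at this
  rw [h2, htop _ h3, map_zero, mul_zero]

/-- the weight relations, upper type -/
theorem ww_upper {F F' : Finset E} (hF : InS L σ i F) (hF' : InS L σ i F') (hFF : F ⊂ F')
    (h : Thet L σ L (tau σ i F) i (xx L σ (insert i F))) :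
    ∃ c1 ∈ piece L (tau σ i F) 1, ∀ c, h.map (c1 * c) = xx L σ (insert i F') * h.map c := by
  have hm : insert i F' ∈ Lk L (tau σ i F) := by
    refine mem_tau hF'.mem' ?_ ?_ (Or.inr (hFF.1.trans (Finset.subset_insert _ _)))
      (Or.inr (Finset.insert_subset_insert _ hFF.1))
    · intro hh; exact hF.iF (hh ▸ Finset.mem_insert_self _ _)
    · intro hh; exact hFF.2 (insert_sub_cancel hF'.iF hh.le)
  refine ⟨xx L _ (insert i F'), xx_mem _, fun c => ?_⟩
  obtain ⟨b, hb⟩ := h.map_dvd c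
  rw [h.map_xx hm, hb, YY, Finset.insert_idem, Finset.erase_insert hF'.iF, ← mul_assoc, ← mul_assoc,
    add_mul, xx_mul_eq_zero (S := F') (T := insert i F), add_zero]
  rintro (h3 | h3)
  · exact hFF.2 (sub_insert_cancel hF'.iF h3)
  · exact hF'.iF (h3 (Finset.mem_insert_self _ _))

/-- the weight relations, lower type -/
theorem ww_lower {F F' : Finset E} (hF : InS L σ i F) (hF' : InS L σ i F') (hFF : F' ⊂ F)
    (h : Thet L σ L (tau σ i F) i (xx L σ F)) :
    ∃ c1 ∈ piece L (tau σ i F) 1, ∀ c, h.map (c1 * c) = xx L σ F' * h.map c := by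
  have hm : F' ∈ Lk L (tau σ i F) := by
    refine mem_tau hF'.mem hFF.ne ?_ (Or.inl hFF.1)
      (Or.inl (hFF.1.trans (Finset.subset_insert _ _)))
    rintro rfl; exact hF'.iF (Finset.mem_insert_self _ _)
  refine ⟨xx L _ F', xx_mem _, fun c => ?_⟩
  obtain ⟨b, hb⟩ := h.map_dvd c
  rw [h.map_xx hm, hb, YY, Finset.erase_eq_of_notMem hF'.iF, ← mul_assoc, ← mul_assoc,
    add_mul, xx_mul_eq_zero (S := insert i F') (T := F), zero_add]
  rintro (h3 | h3)
  · exact hF.iF (h3 (Finset.mem_insert_self _ _))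
  · exact hFF.2 (sub_insert_cancel hF.iF h3)

theorem ww_zero {F : Finset E} {w w' : CR L σ}
    (h : Thet L σ L (tau σ i F) i w) (hw : w * w' = 0) :
    ∃ c1 ∈ piece L (tau σ i F) 1, ∀ c, h.map (c1 * c) = w' * h.map c := by
  refine ⟨0, Submodule.zero_mem _, fun c => ?_⟩
  obtain ⟨b, hb⟩ := h.map_dvd c
  rw [zero_mul, map_zero, hb, ← mul_assoc, mul_comm w', hw, zero_mul]

end link

end HRProof


namespace HRProof

open MvPolynomial

section span
variable {E : Type*} [Fintype E] [DecidableEq E] {L : Set (Finset E)}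
  {σ : Finset (Finset E)} {i : E} {P Q : Finset E}

/-- classification of the link elements whose class mod `i` meets the flag -/
theorem special (g : Gap σ i P Q) {G T : Finset E} (hG : G ∈ Lk L σ) (hT : T ∈ σ)
    (h : insert i G = insert i T) : G = insert i P ∨ G = Q.erase i := by
  have hne : G ≠ T := by rintro rfl; exact hG.2.1 hT
  by_cases hi : i ∈ G
  · left
    have hiT : i ∉ T := fun hiT => hne (by
      rwa [Finset.insert_eq_of_mem hi, Finset.insert_eq_of_mem hiT] at h)
    rw [Finset.insert_eq_of_mem hi] at h
    have h1 := g.lo T hT hiT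
    have h2 := link_notin g hG hi
    rw [h] at h2 ⊢
    rw [Finset.Subset.antisymm h1 (sub_insert_cancel g.iP h2.1)]
  · right
    have hiT : i ∈ T := by
      by_contra hiT
      exact hne (Finset.Subset.antisymm (insert_sub_cancel hi h.le) (insert_sub_cancel hiT h.ge))
    rw [Finset.insert_eq_of_mem hiT] at h
    have h1 := g.hi T hT hiT
    have h2 := link_notin' g hG hi
    have : T ⊆ Q := by rw [← h]; exact Finset.insert_subset g.iQ h2.1
    rw [← Finset.Subset.antisymm this h1, ← h, Finset.erase_insert hi]

theorem unpaired {G : Finset E} (hG : G ∈ Lk L σ)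
    (h : ∀ F, InS L σ i F → insert i G ≠ insert i F) : YY L σ i G = xx L σ G := by
  by_cases hi : i ∈ G
  · rw [YY, Finset.insert_eq_of_mem hi, xx_eq_zero (S := G.erase i), add_zero]
    intro h1
    refine h (G.erase i) ⟨h1, by simp, by rwa [Finset.insert_erase hi]⟩ ?_
    rw [insert_erase']
  · rw [YY, Finset.erase_eq_of_notMem hi, xx_eq_zero (S := insert i G), zero_add]
    intro h1
    exact h G ⟨hG, hi, h1⟩ rfl

theorem pair_cases {G F : Finset E} (hiF : i ∉ F) (h : insert i G = insert i F) :
    G = F ∨ G = insert i F := by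
  by_cases hi : i ∈ G
  · right; rwa [Finset.insert_eq_of_mem hi] at h
  · left; exact Finset.Subset.antisymm (insert_sub_cancel hi h.le) (insert_sub_cancel hiF h.ge)

theorem span_abs (g : Gap σ i P Q) (hσ : Base L σ) {M : ℕ → Submodule ℝ (CR L σ)}
    {W : Finset E → Finset E} {y : CR L σ}
    (hW : ∀ F, InS L σ i F → W F = insert i F ∨ W F = F)
    (s1 : ∀ k, ∀ z ∈ M k, ∀ U, (∀ T ∈ σ, insert i U ≠ insert i T) → YY L σ i U * z ∈ M (k + 1))
    (s2 : ∀ F, InS L σ i F → xx L σ (W F) ∈ M 1)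
    (s3 : (1 : CR L σ) ∈ M 0)
    (s4 : ∀ F F', InS L σ i F → InS L σ i F' → F ≠ F' → xx L σ (W F') * xx L σ (W F) ∈ M 2)
    (s5 : Q.erase i ∈ Lk L σ → xx L σ (Q.erase i) ∈ M 1)
    (s6 : ∀ z ∈ M 1, y * z ∈ M 2)
    (gen : ∀ Pr : ℕ → CR L σ → Prop, Pr 0 1 → (∀ F, InS L σ i F → Pr 1 (xx L σ (W F))) → Pr 1 y →
      (∀ k, Pr k 0) → (∀ k p q, Pr k p → Pr k q → Pr k (p + q)) →
      (∀ k (r : ℝ) p, Pr k p → Pr k (r • p)) →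
      (∀ k z U, (∀ T ∈ σ, insert i U ≠ insert i T) → Pr k z → Pr (k + 1) (YY L σ i U * z)) →
      ∀ k, ∀ z ∈ M k, Pr k z) :
    ∀ k, ∀ z ∈ piece L σ k, z ∈ M k := by
  have hYF : ∀ F, InS L σ i F → YY L σ i F = xx L σ (insert i F) + xx L σ F := by
    intro F hF; rw [YY, Finset.erase_eq_of_notMem hF.iF]
  -- if one of a pair is in, so is the other
  have hpair : ∀ (k : ℕ) (v : CR L σ) (F G : Finset E), InS L σ i F → insert i G = insert i F →
      YY L σ i F * v ∈ M k → xx L σ (W F) * v ∈ M k → xx L σ G * v ∈ M k := by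
    intro k v F G hF hGF h1 h2
    rw [hYF F hF, add_mul] at h1
    rcases hW F hF with h | h <;> rw [h] at h2 <;> rcases pair_cases hF.iF hGF with rfl | rfl
    · simpa using Submodule.sub_mem _ h1 h2
    · exact h2
    · exact h2
    · simpa using Submodule.sub_mem _ h1 h2
  have hall : ∀ (k : ℕ) (v : CR L σ), v ∈ M k → ∀ G ∈ Lk L σ, (∀ T ∈ σ, insert i G ≠ insert i T) →
      (∀ F, InS L σ i F → insert i G = insert i F → xx L σ (W F) * v ∈ M (k + 1)) →
      xx L σ G * v ∈ M (k + 1) := by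
    intro k v hv G hG hGT hF
    by_cases hp : ∃ F, InS L σ i F ∧ insert i G = insert i F
    · obtain ⟨F, hF1, hF2⟩ := hp
      refine hpair (k + 1) v F G hF1 hF2 (s1 k v hv F ?_) (hF F hF1 hF2)
      intro T hT; rw [← hF2]; exact hGT T hT
    · rw [← unpaired (i := i) hG fun F h1 h2 => hp ⟨F, h1, h2⟩]
      exact s1 k v hv G hGT
  have A0 : ∀ G ∈ Lk L σ, G ≠ insert i P → xx L σ G ∈ M 1 := by
    intro G hG hGP
    by_cases hs : ∃ T ∈ σ, insert i G = insert i T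
    · obtain ⟨T, hT, he⟩ := hs
      rcases special g hG hT he with h | rfl
      · exact absurd h hGP
      · exact s5 hG
    · push Not at hs
      have := hall 0 1 s3 G hG hs fun F hF _ => by rw [mul_one]; exact s2 F hF
      rwa [mul_one] at this
  have A1 : ∀ G ∈ Lk L σ, xx L σ G ∈ M 1 := by
    intro G hG
    by_cases hGP : G = insert i P
    swap
    · exact A0 G hG hGP
    have hGQ : G ⊂ Q := by
      rcases g.trichotomy hG with h | h | h
      · exact absurd (h.1 (hGP ▸ Finset.mem_insert_self _ _)) g.iP
      · exact h.2
      · exfalso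
        have := Finset.insert_subset g.iQ (g.PQ hσ.toIsFlag)
        rw [← hGP] at this
        exact h.2 this
    obtain ⟨j, hjQ, hjG⟩ := Finset.exists_of_ssubset hGQ
    have hjP : j ∉ P := fun h => hjG (hGP ▸ Finset.mem_insert_of_mem h)
    have e := ell_aff (L := L) (Aff.dif i j) (dif_gap g g.iP g.iQ hjP hjQ)
    rw [ell, ← Finset.add_sum_erase _ _ (Finset.mem_univ G)] at e
    have hd : dif i j G = 1 := by
      have : i ∈ G := hGP ▸ Finset.mem_insert_self _ _
      simp [dif, this, hjG]
    rw [hd, one_smul] at e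
    rw [eq_neg_of_add_eq_zero_left e]
    refine Submodule.neg_mem _ (Submodule.sum_mem _ fun S hS => Submodule.smul_mem _ _ ?_)
    by_cases hSL : S ∈ Lk L σ
    · exact A0 S hSL (by rw [← hGP]; exact (Finset.mem_erase.1 hS).1)
    · rw [xx_eq_zero hSL]; exact Submodule.zero_mem _
  have A2' : ∀ F, InS L σ i F → ∀ G ∈ Lk L σ, insert i G ≠ insert i F →
      xx L σ G * xx L σ (W F) ∈ M 2 := by
    intro F hF G hG hGF
    have bd := hF.bd g
    by_cases hs : ∃ T ∈ σ, insert i G = insert i T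
    · obtain ⟨T, hT, he⟩ := hs
      have hz : YY L σ i F * xx L σ G ∈ M 2 := s1 1 _ (A1 G hG) F (F_ne g hF hσ)
      rw [hYF F hF] at hz
      rcases special g hG hT he with rfl | rfl
      · have e0 : xx L σ F * xx L σ (insert i P) = 0 := by
          refine xx_mul_eq_zero ?_
          rintro (h | h)
          · exact bd.1.2 (sub_insert_cancel hF.iF h)
          · exact hF.iF (h (Finset.mem_insert_self _ _))
        rcases hW F hF with h | h <;> rw [h, mul_comm]
        · rwa [add_mul, e0, add_zero] at hz
        · rw [e0]; exact Submodule.zero_mem _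
      · have e0 : xx L σ (insert i F) * xx L σ (Q.erase i) = 0 := by
          refine xx_mul_eq_zero ?_
          rintro (h | h)
          · simpa using h (Finset.mem_insert_self _ _)
          · refine bd.2.2 fun a ha => ?_
            by_cases hai : a = i
            · subst hai; exact Finset.mem_insert_self _ _
            · exact h (Finset.mem_erase.2 ⟨hai, ha⟩)
        rcases hW F hF with h | h <;> rw [h, mul_comm]
        · rw [e0]; exact Submodule.zero_mem _
        · rwa [add_mul, e0, zero_add] at hz
    · push Not at hs
      refine hall 1 _ (s2 F hF) G hG hs fun F' hF' he => s4 F F' hF hF' ?_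
      rintro rfl; exact hGF he
  have A2 : ∀ F, InS L σ i F → ∀ G ∈ Lk L σ, xx L σ G * xx L σ (W F) ∈ M 2 := by
    intro F hF G hG
    by_cases hGF : insert i G = insert i F
    swap
    · exact A2' F hF G hG hGF
    have bd := hF.bd g
    have hFm : xx L σ F * xx L σ (W F) ∈ M 2 := by
      obtain ⟨j, hjF, hjP⟩ := Finset.exists_of_ssubset bd.1
      have e := ell_aff (L := L) (Aff.dif j i) (dif_gap g hjP
        (bd.2.1 (Finset.mem_insert_of_mem hjF)) g.iP g.iQ)
      rw [ell, ← Finset.add_sum_erase _ _ (Finset.mem_univ F)] at e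
      have hd : dif j i F = 1 := by simp [dif, hjF, hF.iF]
      rw [hd, one_smul] at e
      rw [eq_neg_of_add_eq_zero_left e, neg_mul, Finset.sum_mul]
      refine Submodule.neg_mem _ (Submodule.sum_mem _ fun S hS => ?_)
      rw [smul_mul_assoc]
      by_cases hSL : S ∈ Lk L σ
      · by_cases hSF : insert i S = insert i F
        · rcases pair_cases hF.iF hSF with rfl | rfl
          · simp at hS
          · have : dif j i (insert i F) = 0 := by simp [dif, hjF]
            rw [this, zero_smul]; exact Submodule.zero_mem _
        · exact Submodule.smul_mem _ _ (A2' F hF S hSL hSF)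
      · rw [xx_eq_zero hSL, zero_mul, smul_zero]; exact Submodule.zero_mem _
    rcases pair_cases hF.iF hGF with rfl | rfl
    · exact hFm
    · have := s1 1 _ (s2 F hF) F (F_ne g hF hσ)
      rw [hYF F hF, add_mul] at this
      simpa using Submodule.sub_mem _ this hFm
  have A3 := gen (fun k z => ∀ G ∈ Lk L σ, xx L σ G * z ∈ M (k + 1))
    (fun G hG => by rw [mul_one]; exact A1 G hG) (fun F hF G hG => A2 F hF G hG)
    (fun G hG => by rw [mul_comm]; exact s6 _ (A1 G hG))
    (fun k G hG => by rw [mul_zero]; exact Submodule.zero_mem _)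
    (fun k p q hp hq G hG => by rw [mul_add]; exact Submodule.add_mem _ (hp G hG) (hq G hG))
    (fun k r p hp G hG => by rw [mul_smul_comm]; exact Submodule.smul_mem _ _ (hp G hG))
    (fun k z U hU hz G hG => by rw [mul_left_comm]; exact s1 _ _ (hz G hG) U hU)
  exact piece_ind s3 (fun k => Submodule.zero_mem _) (fun k p q => Submodule.add_mem _)
    (fun k r p => Submodule.smul_mem _ r) (fun k p S hS hp => A3 k p hp S hS)

end span

section MM
variable {A : Type*} [CommRing A] [Algebra ℝ A]
  {B : Type*} [CommRing B] [Algebra ℝ B] {ℬ : ℕ → Submodule ℝ B}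
  {ι : Type*} [DecidableEq ι] {s : Finset ι} {C : ι → Type*}
    [∀ F, CommRing (C F)] [∀ F, Algebra ℝ (C F)] {𝒞 : ∀ F, ℕ → Submodule ℝ (C F)}
    {φ : B →ₗ[ℝ] A} {g : ∀ F, C F →ₗ[ℝ] A}

/-- the span of the images -/
noncomputable def MM (ℬ : ℕ → Submodule ℝ B) (s : Finset ι) (𝒞 : ∀ F, ℕ → Submodule ℝ (C F))
    (φ : B →ₗ[ℝ] A) (g : ∀ F, C F →ₗ[ℝ] A) (k : ℕ) : Submodule ℝ A where
  carrier := {a | ∃ b ∈ ℬ k, ∃ c : ∀ F, C F, (∀ F ∈ s, c F ∈ shift (𝒞 F) k) ∧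
    a = φ b + ∑ F ∈ s, g F (c F)}
  zero_mem' := ⟨0, Submodule.zero_mem _, fun _ => 0, fun _ _ => Submodule.zero_mem _, by simp⟩
  add_mem' := by
    rintro _ _ ⟨b, hb, c, hc, rfl⟩ ⟨b', hb', c', hc', rfl⟩
    refine ⟨b + b', Submodule.add_mem _ hb hb', fun F => c F + c' F,
      fun F hF => Submodule.add_mem _ (hc F hF) (hc' F hF), ?_⟩
    simp only [map_add, Finset.sum_add_distrib]; ring
  smul_mem' := by
    rintro r _ ⟨b, hb, c, hc, rfl⟩
    refine ⟨r • b, Submodule.smul_mem _ _ hb, fun F => r • c F,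
      fun F hF => Submodule.smul_mem _ _ (hc F hF), ?_⟩
    simp only [map_smul, smul_add, Finset.smul_sum]

theorem MM_B {k : ℕ} {b : B} (hb : b ∈ ℬ k) : φ b ∈ MM ℬ s 𝒞 φ g k :=
  ⟨b, hb, fun _ => 0, fun _ _ => Submodule.zero_mem _, by simp⟩

theorem MM_C {k : ℕ} {F : ι} (hF : F ∈ s) {c : C F} (hc : c ∈ 𝒞 F k) :
    g F c ∈ MM ℬ s 𝒞 φ g (k + 1) := by
  refine ⟨0, Submodule.zero_mem _, Function.update (fun _ => 0) F c, ?_, ?_⟩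
  · intro F' hF'
    by_cases h : F' = F
    · subst h; rw [Function.update_self]; exact hc
    · simp [Function.update_of_ne h]
  · rw [map_zero, zero_add, Finset.sum_eq_single F]
    · simp
    · intro F' _ h; simp [Function.update_of_ne h]
    · intro h; exact absurd hF h

theorem MM_ind {k : ℕ} {Pr : A → Prop} (h0 : Pr 0) (hadd : ∀ p q, Pr p → Pr q → Pr (p + q))
    (hB : ∀ b ∈ ℬ k, Pr (φ b)) (hC : ∀ F ∈ s, ∀ k', k = k' + 1 → ∀ c ∈ 𝒞 F k', Pr (g F c)) :
    ∀ z ∈ MM ℬ s 𝒞 φ g k, Pr z := by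
  rintro _ ⟨b, hb, c, hc, rfl⟩
  refine hadd _ _ (hB b hb) ?_
  refine Finset.sum_induction _ Pr hadd h0 fun F hF => ?_
  have := hc F hF
  rcases k with _ | k
  · have h : c F = 0 := by simpa [shift] using this
    rw [h, map_zero]; exact h0
  · exact hC F hF k rfl _ this

end MM

end HRProof


namespace HRProof

open MvPolynomial

section build
variable {E : Type*} [Fintype E] [DecidableEq E] {L : Set (Finset E)}
  {σ : Finset (Finset E)} {i : E} {P Q : Finset E}

theorem thet_ct {L0 : Set (Finset E)} {τ : Finset (Finset E)} {w : CR L σ}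
    (h : Thet L σ L0 τ i w) {ν ν' : Finset E → ℝ} (hν : Aff ν) (hν0 : ∀ T ∈ σ, ν T = ct i T)
    (hν' : Aff ν') (hν0' : ∀ T ∈ τ, ν' T = ct i T) (hν0'' : ∀ T ∈ σ, ν' T = ct i T)
    (hi : ∀ S, ν' (insert i S) = ν' S) (b : CR L0 τ) :
    h.map (ell L0 τ (fun S => ct i S - ν' S) * b) = ell L σ (fun S => ct i S - ν S) * h.map b := by
  rw [h.map_ell]
  · congr 1
    rw [← ell_sub_aff (hν.sub hν') (c := fun S => ct i S - ν' S)]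
    · congr 1; funext S; ring
    · intro T hT; rw [hν0 T hT, hν0'' T hT, sub_self]
  · intro S; rw [hi]; simp [ct]
  · intro T hT; rw [hν0' T hT, sub_self]

theorem ww_all {F F' : Finset E} {W : Finset E → Finset E}
    (hW : ∀ F, InS L σ i F → W F = insert i F ∨ W F = F)
    (hmix : ∀ F F', InS L σ i F → InS L σ i F' → W F = F → W F' = insert i F' →
      ¬ cmp F (insert i F'))
    (hF : InS L σ i F) (hF' : InS L σ i F') (hne : F ≠ F')
    (h : Thet L σ L (tau σ i F) i (xx L σ (W F)))
    (h' : Thet L σ L (tau σ i F') i (xx L σ (W F'))) :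
    (∃ c1 ∈ piece L (tau σ i F) 1, ∀ c, h.map (c1 * c) = xx L σ (W F') * h.map c) ∨
    (∃ c1 ∈ piece L (tau σ i F') 1, ∀ c, h'.map (c1 * c) = xx L σ (W F) * h'.map c) := by
  rcases hW F hF with e | e <;> rcases hW F' hF' with e' | e'
  · by_cases hc : cmp (insert i F) (insert i F')
    · rcases hc with hc | hc
      · left
        have := lt_of_le_of_ne (insert_sub_cancel hF.iF hc) hne
        rw [e'] ; revert h; rw [e]; intro h
        exact ww_upper hF hF' this h
      · right
        have := lt_of_le_of_ne (insert_sub_cancel hF'.iF hc) hne.symm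
        rw [e] ; revert h'; rw [e']; intro h'
        exact ww_upper hF' hF this h'
    · left; exact ww_zero h (by rw [e, e']; exact xx_mul_eq_zero hc)
  · right; exact ww_zero h' (by rw [e, e']; exact xx_mul_eq_zero (hmix F' F hF' hF e' e))
  · left; exact ww_zero h (by rw [e, e']; exact xx_mul_eq_zero (hmix F F' hF hF' e e'))
  · by_cases hc : cmp F F'
    · rcases hc with hc | hc
      · right
        have := lt_of_le_of_ne hc hne
        rw [e] ; revert h'; rw [e']; intro h'
        exact ww_lower hF' hF this h'
      · left
        have := lt_of_le_of_ne hc hne.symm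
        rw [e'] ; revert h; rw [e]; intro h
        exact ww_lower hF hF' this h
    · left; exact ww_zero h (by rw [e, e']; exact xx_mul_eq_zero hc)

open Classical in
/-- the map of the `F` summand (junk value `0` outside the index set) -/
noncomputable def gF (L : Set (Finset E)) (σ : Finset (Finset E)) (i : E) (W : Finset E → Finset E)
    (F : Finset E) : CR L (tau σ i F) →ₗ[ℝ] CR L σ :=
  if h : Thet L σ L (tau σ i F) i (xx L σ (W F)) then h.map else 0

theorem gF_eq {W : Finset E → Finset E} {F : Finset E}
    (h : Thet L σ L (tau σ i F) i (xx L σ (W F))) : gF L σ i W F = h.map := dif_pos h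

theorem build (hL : FlatFam L) (hσ : Base L σ) (g : Gap σ i P Q) {N : ℕ} (hN : Graded L N)
    {deg : CR L σ →ₗ[ℝ] ℝ} (hdeg : Nrm L σ N deg) (ihτ : ∀ F, InS L σ i F → TT L (tau σ i F) N)
    {W : Finset E → Finset E} {y : CR L σ}
    (hW : ∀ F, InS L σ i F → W F = insert i F ∨ (W F = F ∧ Closed L i P Q))
    (hmix : ∀ F F', InS L σ i F → InS L σ i F' → W F = F → W F' = insert i F' →
      ¬ cmp F (insert i F'))
    {B : Type*} [CommRing B] [Algebra ℝ B] {ℬ : ℕ → Submodule ℝ B} {degB : B →ₗ[ℝ] ℝ}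
    {φ : B →ₗ[ℝ] CR L σ} (hB : PA ℬ degB (N - σ.card))
    (φ_mem : ∀ k, ∀ b ∈ ℬ k, φ b ∈ piece L σ k) (φ1 : φ 1 = 1)
    (BB : ∀ k l, k + l = N - σ.card → ∀ b ∈ ℬ k, ∀ b' ∈ ℬ l, deg (φ b * φ b') = degB (b * b'))
    (B1 : ∀ U, (∀ T ∈ σ, insert i U ≠ insert i T) → ∃ b1 ∈ ℬ 1, ∀ b, φ (b1 * b) = YY L σ i U * φ b)
    (By : ∃ b1 ∈ ℬ 1, ∀ b, φ (b1 * b) = y * φ b)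
    (hyW : ∀ F, InS L σ i F → y * xx L σ (W F) = 0)
    (s5 : Q.erase i ∈ Lk L σ → ∃ t : Finset (Finset E), (∀ F ∈ t, InS L σ i F) ∧
      xx L σ (Q.erase i) = y - ∑ F ∈ t, xx L σ (W F))
    (gen : ∀ Pr : ℕ → CR L σ → Prop, Pr 0 1 → Pr 1 y →
      (∀ k, Pr k 0) → (∀ k p q, Pr k p → Pr k q → Pr k (p + q)) →
      (∀ k (r : ℝ) p, Pr k p → Pr k (r • p)) →
      (∀ k z U, (∀ T ∈ σ, insert i U ≠ insert i T) → Pr k z → Pr (k + 1) (YY L σ i U * z)) →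
      ∀ k, ∀ b ∈ ℬ k, Pr k (φ b)) :
    PA (piece L σ) deg (N - σ.card) ∧ ∀ (ν : Finset E → ℝ), Aff ν → (∀ T ∈ σ, ν T = ct i T) →
      ∀ lB ∈ ℬ 1, HR ℬ degB (N - σ.card) lB →
      (∀ b, φ (lB * b) = (ell L σ (fun S => ct i S - ν S) + y) * φ b) →
      HR (piece L σ) deg (N - σ.card) (ell L σ (fun S => ct i S - ν S) + y) := by
  classical
  have hW' : ∀ F, InS L σ i F → W F = insert i F ∨ W F = F := fun F hF => (hW F hF).imp id And.left
  have hth : ∀ F, InS L σ i F → Thet L σ L (tau σ i F) i (xx L σ (W F)) := fun F hF =>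
    thet_link hL hσ g hF (hW F hF)
  set s : Finset (Finset E) := Finset.univ.filter (InS L σ i) with hs
  have hs' : ∀ F, F ∈ s → InS L σ i F := fun F hF => (Finset.mem_filter.1 hF).2
  have hs'' : ∀ F, InS L σ i F → F ∈ s := fun F hF => Finset.mem_filter.2 ⟨Finset.mem_univ _, hF⟩
  have hcard : ∀ F, InS L σ i F → σ.card + 2 ≤ N := fun F hF => by
    have := hN.card_le (hF.base hσ).toIsFlag
    rwa [hF.card] at this
  have hPC : ∀ F, InS L σ i F → PA (piece L (tau σ i F)) (deg ∘ₗ gg L σ i F) (N - σ.card - 2) := by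
    intro F hF
    have := (ihτ F hF _ (hF.nrm hdeg)).1
    rwa [hF.card, Nat.sub_add_eq] at this
  have htop : ∀ F, InS L σ i F → ∀ z ∈ piece L (tau σ i F) (N - σ.card - 2 + 1), z = 0 :=
    fun F hF z hz => (hPC F hF).top _ (Nat.lt_succ_self _) z hz
  have hyg : ∀ F, InS L σ i F → ∀ c, y * gF L σ i W F c = 0 := by
    intro F hF c
    rw [gF_eq (hth F hF)]
    obtain ⟨b', hb'⟩ := (hth F hF).map_dvd c
    rw [hb', ← mul_assoc, hyW F hF, zero_mul]
  have D : Decomp (piece L σ) deg (N - σ.card) ℬ degB s (fun F => piece L (tau σ i F))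
      (fun F => deg ∘ₗ gg L σ i F) (N - σ.card - 2) φ (gF L σ i W) := by
    refine ⟨piece_one_mem, piece_mul_mem, piece_fin, hB, fun F hF => hPC F (hs' F hF), ?_, φ_mem,
      ?_, BB, ?_, ?_, ?_, ?_⟩
    · intro F hF
      have := hcard F (hs' F hF)
      omega
    · intro F hF k c hc
      rw [gF_eq (hth F (hs' F hF))]
      exact (hth F (hs' F hF)).map_mem (xx_mem _) k c hc
    · intro k l hkl F hF b hb c hc
      have hF' := hs' F hF
      rw [gF_eq (hth F hF')]
      have := gen (fun k z => ∃ c1 ∈ piece L (tau σ i F) k, ∀ c,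
        z * (hth F hF').map c = (hth F hF').map (c1 * c))
        ⟨1, piece_one_mem, fun c => by simp⟩
        ⟨0, Submodule.zero_mem _, fun c => by
          have := hyg F hF' c
          rw [gF_eq (hth F hF')] at this
          rw [this]; simp⟩
        (fun k => ⟨0, Submodule.zero_mem _, fun c => by simp⟩)
        (by
          rintro k p q ⟨c1, h1, h2⟩ ⟨c1', h1', h2'⟩
          exact ⟨c1 + c1', Submodule.add_mem _ h1 h1', fun c => by
            rw [add_mul, add_mul, map_add, h2, h2']⟩)
        (by
          rintro k r p ⟨c1, h1, h2⟩
          exact ⟨r • c1, Submodule.smul_mem _ _ h1, fun c => by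
            rw [smul_mul_assoc, smul_mul_assoc, map_smul, h2]⟩)
        (by
          rintro k z U hU ⟨c1, h1, h2⟩
          obtain ⟨c2, h3, h4⟩ := lemE g hF' (hth F hF') hU
          refine ⟨c2 * c1, ?_, fun c => ?_⟩
          · have := piece_mul_mem _ _ _ _ h3 h1
            rwa [add_comm] at this
          · rw [mul_assoc, h2, ← h4, mul_assoc]) k b hb
      obtain ⟨c1, h1, h2⟩ := this
      have h3 : c1 * c ∈ piece L (tau σ i F) (N - σ.card - 2 + 1) := by
        have := piece_mul_mem _ _ _ _ h1 hc
        have h5 := hcard F hF'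
        rwa [show k + l = N - σ.card - 2 + 1 by omega] at this
      rw [h2, htop F hF' _ h3, map_zero, map_zero]
    · intro k l hkl F hF c hc c' hc'
      have hF' := hs' F hF
      rw [gF_eq (hth F hF'), link_CC g hσ hF' (hW' F hF') (hth F hF') (htop F hF') hkl hc hc', map_neg]
      rfl
    · intro k l hkl F hF F' hF' hne c hc c' hc'
      have h1 := hs' F hF
      have h2 := hs' F' hF'
      rw [gF_eq (hth F h1), gF_eq (hth F' h2)]
      rcases ww_all hW' hmix h1 h2 hne (hth F h1) (hth F' h2) with hw | hw
      · rw [link_CC' g hσ h1 h2 (hth F h1) (hth F' h2) (htop F h1) hw hkl hc hc', map_zero]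
      · rw [mul_comm, link_CC' g hσ h2 h1 (hth F' h2) (hth F h1) (htop F' h2) hw
          (by rw [add_comm]; exact hkl) hc' hc, map_zero]
    · -- spanning
      have hgW : ∀ F, InS L σ i F → xx L σ (W F) = gF L σ i W F 1 := fun F hF => by
        rw [gF_eq (hth F hF), Thet.map_one]
      have key := span_abs (M := MM ℬ s (fun F => piece L (tau σ i F)) φ (gF L σ i W)) (y := y) (W := W)
        g hσ hW' ?_ ?_ ?_ ?_ ?_ ?_ ?_
      · exact key
      · intro k z hz U hU
        obtain ⟨b1, hb1, hb⟩ := B1 U hU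
        revert z
        refine MM_ind ?_ ?_ ?_ ?_
        · rw [mul_zero]; exact Submodule.zero_mem _
        · intro p q hp hq; rw [mul_add]; exact Submodule.add_mem _ hp hq
        · intro b hb'
          rw [← hb]
          refine MM_B ?_
          have := hB.mul_mem _ _ _ _ hb1 hb'
          rwa [add_comm] at this
        · rintro F hF k' rfl c hc
          obtain ⟨c2, h3, h4⟩ := lemE g (hs' F hF) (hth F (hs' F hF)) hU
          have h5 : YY L σ i U * gF L σ i W F c = gF L σ i W F (c2 * c) := by
            rw [gF_eq (hth F (hs' F hF)), h4]
          rw [h5]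
          refine MM_C hF ?_
          have := piece_mul_mem _ _ _ _ h3 hc
          rwa [add_comm] at this
      · intro F hF
        rw [hgW F hF]
        exact MM_C (hs'' F hF) piece_one_mem
      · rw [← φ1]; exact MM_B hB.one_mem
      · intro F F' hF hF' hne
        rcases ww_all hW' hmix hF hF' hne (hth F hF) (hth F' hF') with ⟨c1, h1, h2⟩ | ⟨c1, h1, h2⟩
        · have := h2 1
          rw [Thet.map_one, mul_one, ← gF_eq (hth F hF)] at this
          rw [← this]
          exact MM_C (hs'' F hF) h1
        · have := h2 1
          rw [Thet.map_one, mul_one, ← gF_eq (hth F' hF')] at this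
          rw [mul_comm, ← this]
          exact MM_C (hs'' F' hF') h1
      · intro hQ
        obtain ⟨t, ht, e⟩ := s5 hQ
        rw [e]
        refine Submodule.sub_mem _ ?_ (Submodule.sum_mem _ fun F hF => ?_)
        · obtain ⟨b1, hb1, hb⟩ := By
          have := hb 1
          rw [mul_one, φ1, mul_one] at this
          rw [← this]
          exact MM_B hb1
        · rw [hgW F (ht F hF)]
          exact MM_C (hs'' F (ht F hF)) piece_one_mem
      · obtain ⟨b1, hb1, hb⟩ := By
        refine MM_ind ?_ ?_ ?_ ?_
        · rw [mul_zero]; exact Submodule.zero_mem _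
        · intro p q hp hq; rw [mul_add]; exact Submodule.add_mem _ hp hq
        · intro b hb'
          rw [← hb]
          exact MM_B (hB.mul_mem _ _ _ _ hb1 hb')
        · intro F hF k' _ c hc
          rw [hyg F (hs' F hF)]; exact Submodule.zero_mem _
      · intro Pr p1 pW py p0 padd psmul pY k
        refine MM_ind (p0 k) (padd k) (gen Pr p1 py p0 padd psmul pY k) ?_
        rintro F hF k' rfl c hc
        have h0 := hth F (hs' F hF)
        rw [gF_eq h0]
        revert c k'
        refine piece_ind ?_ ?_ ?_ ?_ ?_
        · rw [h0.map_one]; exact pW F (hs' F hF)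
        · intro k; rw [map_zero]; exact p0 _
        · intro k p q hp hq; rw [map_add]; exact padd _ _ _ hp hq
        · intro k r p hp; rw [map_smul]; exact psmul _ _ _ hp
        · intro k p S hS hp
          rw [h0.map_xx hS]
          exact pY _ _ S (tau_ne hσ (hs' F hF) S hS) hp
  refine ⟨D.pa, ?_⟩
  intro ν hν hν0 lB hlB hHB hφ
  have hsup : ∀ F : Finset E, ∃ μ : Finset E → ℝ, InS L σ i F → Aff μ ∧
      (∀ T ∈ tau σ i F, μ T = ct i T) ∧ ∀ S, μ (insert i S) = μ S := by
    intro F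
    by_cases hF : InS L σ i F
    · obtain ⟨μ, h1, h2, h3, h4⟩ := ct_supp i (hF.base hσ).chain
      exact ⟨μ, fun _ => ⟨h1, h2, h4⟩⟩
    · exact ⟨0, fun h => absurd h hF⟩
  choose μ hμ using hsup
  refine D.hr (lC := fun F => ell L (tau σ i F) (fun S => ct i S - μ F S)) hlB
    (fun F _ => ell_mem _) hφ ?_ hHB ?_
  · intro F hF c
    have hF' := hs' F hF
    obtain ⟨h1, h2, h3⟩ := hμ F hF'
    rw [add_mul, hyg F hF', add_zero, gF_eq (hth F hF')]
    exact thet_ct (hth F hF') hν hν0 h1 h2 (fun T hT => h2 T (sub_tau hT)) h3 c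
  · intro F hF
    have hF' := hs' F hF
    obtain ⟨h1, h2, h3⟩ := hμ F hF'
    have := (ihτ F hF' _ (hF'.nrm hdeg)).2 _ (ct_Kc (hF'.base hσ) i h1 h2
      (hF'.pr.inj (hF'.base hσ).toIsFlag))
    rwa [hF'.card, Nat.sub_add_eq] at this

end build

end HRProof


namespace HRProof

open MvPolynomial

section nc
variable {E : Type*} [Fintype E] [DecidableEq E] {L : Set (Finset E)}
  {σ : Finset (Finset E)} {i : E} {P Q : Finset E}

theorem nc_erase (hL : FlatFam L) (hσ : Base L σ) (g : Gap σ i P Q) (hnc : Q.erase i ∉ L) :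
    ∀ T ∈ σ, i ∈ T → T.erase i ∉ L := fun T hT hi h =>
  hnc (erase_mem_of_subset hL (g.hi T hT hi) (Or.inl (hσ.mem Q g.Q_mem)) h)

theorem nc_lift (hσ : Base L σ) (hnc : ∀ T ∈ σ, i ∈ T → T.erase i ∉ L) :
    ∀ T ∈ σ, lift L i (insert i T) = T := by
  intro T hT
  unfold lift
  by_cases hi : i ∈ T
  · rw [Finset.insert_eq_of_mem hi, if_neg (hnc T hT hi)]
  · rw [Finset.erase_insert hi, if_pos (hσ.mem T hT)]

theorem nc_card (hσ : Base L σ) (hnc : ∀ T ∈ σ, i ∈ T → T.erase i ∉ L) :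
    (σ.image (insert i)).card = σ.card := by
  refine Finset.card_image_of_injOn fun S hS T hT h => ?_
  rw [← nc_lift hσ hnc S hS, ← nc_lift hσ hnc T hT]
  exact congrArg _ h

theorem insert_mem_del {S : Finset E} (hS : S ∈ L) : insert i S ∈ del L i := by
  refine ⟨Finset.mem_insert_self _ _, ?_⟩
  by_cases hi : i ∈ S
  · rw [Finset.insert_eq_of_mem hi]; exact Or.inl hS
  · rw [Finset.erase_insert hi]; exact Or.inr hS

theorem nc_base (hσ : Base L σ) : Base (del L i) (σ.image (insert i)) where
  mem S hS := by
    obtain ⟨T, hT, rfl⟩ := Finset.mem_image.1 hS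
    exact insert_mem_del (hσ.mem T hT)
  chain := image_chain i hσ.chain
  univ_mem := Finset.mem_image.2 ⟨_, hσ.univ_mem, by simp⟩
  bot := by
    obtain ⟨P0, hP0, hb⟩ := hσ.bot
    refine ⟨_, Finset.mem_image_of_mem _ hP0, ?_⟩
    rintro S ⟨hi, hS | hS⟩
    · exact Finset.insert_subset hi (hb S hS)
    · exact Finset.insert_subset hi ((hb _ hS).trans (Finset.erase_subset _ _))

theorem nc_cov {G : Finset E} (hG : G ∈ Lk L σ) (h : insert i G ∉ σ.image (insert i)) :
    insert i G ∈ Lk (del L i) (σ.image (insert i)) := by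
  refine ⟨insert_mem_del hG.1, h, ?_⟩
  intro T hT
  obtain ⟨T, hT', rfl⟩ := Finset.mem_image.1 hT
  exact cmp_insert i (hG.2.2 T hT')

theorem nc_thet : Thet L σ (del L i) (σ.image (insert i)) i (1 : CR L σ) where
  m1 S hS T hT h := by
    rwa [Finset.insert_eq_of_mem hS.1.1, Finset.insert_eq_of_mem hT.1.1] at h
  inj S hS T hT h := by
    rwa [Finset.insert_eq_of_mem hS.1.1, Finset.insert_eq_of_mem hT.1.1] at h
  cov G hG := by
    right
    by_cases h : insert i G ∈ σ.image (insert i)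
    · exact Or.inr ⟨_, h, by simp⟩
    · exact Or.inl ⟨_, nc_cov hG h, by simp⟩
  aff μ hμ h0 := by
    refine ⟨fun S hS => by rw [Finset.insert_eq_of_mem hS.1.1],
      fun T hT => h0 _ (Finset.mem_image_of_mem _ hT), fun T hT => ?_⟩
    obtain ⟨T', hT', rfl⟩ := Finset.mem_image.1 hT
    rw [Finset.insert_idem]; exact h0 _ hT

theorem nc_lift_mem (hL : FlatFam L) (hσ : Base L σ) (hnc : ∀ T ∈ σ, i ∈ T → T.erase i ∉ L)
    {S : Finset E} (hS : S ∈ Lk (del L i) (σ.image (insert i))) : lift L i S ∈ Lk L σ := by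
  refine ⟨lift_mem hS.1, fun h => ?_, fun T hT => ?_⟩
  · apply hS.2.1
    rw [← insert_lift (L := L) hS.1.1]
    exact Finset.mem_image_of_mem _ h
  · rw [← nc_lift hσ hnc T hT]
    rcases hS.2.2 _ (Finset.mem_image_of_mem _ hT) with h | h
    · exact Or.inl (lift_mono hL hS.1 h)
    · exact Or.inr (lift_mono hL (insert_mem_del (hσ.mem T hT)) h)

theorem prod_ne_zero' {ι : Type*} [DecidableEq ι] {c : Finset ι} {f : ι → Finset E}
    (h : ∏ S ∈ c, xx L σ (f S) ≠ 0) :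
    (∀ S ∈ c, f S ∈ Lk L σ) ∧ ∀ S ∈ c, ∀ T ∈ c, cmp (f S) (f T) := by
  constructor
  · intro S hS
    by_contra hcon
    exact h (Finset.prod_eq_zero hS (xx_eq_zero hcon))
  · intro S hS T hT
    by_contra hcon
    have hne : T ≠ S := by rintro rfl; exact hcon (cmp_refl _)
    apply h
    rw [← Finset.mul_prod_erase _ _ hS, ← Finset.mul_prod_erase _ _ (Finset.mem_erase.2 ⟨hne, hT⟩),
      ← mul_assoc, xx_mul_eq_zero hcon, zero_mul]

theorem nc_prod_zero (hL : FlatFam L) (hσ : Base L σ) (hnc : ∀ T ∈ σ, i ∈ T → T.erase i ∉ L)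
    {N : ℕ} (hN : Graded L N) {c : Finset (Finset E)}
    (hc : ∀ S ∈ c, S ∈ Lk (del L i) (σ.image (insert i))) (hcc : ∀ S ∈ c, ∀ T ∈ c, cmp S T)
    (hcard : c.card + σ.card = N) {f : Finset E → Finset E}
    (hf : ∀ S ∈ c, f S = S ∨ f S = S.erase i) {S1 : Finset E} (hS1 : S1 ∈ c)
    (hS1f : f S1 ≠ lift L i S1) : ∏ S ∈ c, xx L σ (f S) = 0 := by
  classical
  by_contra hcon
  obtain ⟨h1, h2⟩ := prod_ne_zero' hcon
  have hins : ∀ S ∈ c, insert i (f S) = S := by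
    intro S hS
    rcases hf S hS with h | h <;> rw [h]
    · exact Finset.insert_eq_of_mem (hc S hS).1.1
    · exact Finset.insert_erase (hc S hS).1.1
  have hinj : Set.InjOn f c := by
    intro S hS T hT h
    rw [← hins S hS, ← hins T hT, h]
  -- the bad indices
  let D := c.filter fun S => S.erase i ∈ L ∧ f S = S
  have hD : D.Nonempty := by
    refine ⟨S1, Finset.mem_filter.2 ⟨hS1, ?_⟩⟩
    by_cases he : S1.erase i ∈ L
    · refine ⟨he, (hf S1 hS1).resolve_right fun h => hS1f ?_⟩
      rw [h, lift, if_pos he]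
    · exfalso
      rcases hf S1 hS1 with h | h
      · apply hS1f; rw [h, lift, if_neg he]
      · have := (h1 S1 hS1).1
        rw [h] at this; exact he this
  obtain ⟨S0, hS0, hmin⟩ := chain_min (c := D) (fun S hS T hT =>
    hcc S (Finset.mem_filter.1 hS).1 T (Finset.mem_filter.1 hT).1) hD
  obtain ⟨hS0c, hS0L, hS0f⟩ := Finset.mem_filter.1 hS0
  have hl : S0.erase i ∈ Lk L σ := by
    have := nc_lift_mem hL hσ hnc (hc S0 hS0c)
    rwa [lift, if_pos hS0L] at this
  have hcmp : ∀ T ∈ c, cmp (S0.erase i) (f T) := by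
    intro T hT
    rcases hcc S0 hS0c T hT with h | h
    · left
      rcases hf T hT with h' | h' <;> rw [h']
      · exact (Finset.erase_subset _ _).trans h
      · exact Finset.erase_subset_erase _ h
    · have hTL := erase_mem_of_subset hL h (hc T hT).1.2 hS0L
      rcases hf T hT with h' | h'
      · have := hmin T (Finset.mem_filter.2 ⟨hT, hTL, h'⟩)
        rw [h']; left; exact (Finset.erase_subset _ _).trans this
      · rw [h']; right; exact Finset.erase_subset_erase _ h
  have hnot : S0.erase i ∉ c.image f := by
    intro h
    obtain ⟨T, hT, he⟩ := Finset.mem_image.1 h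
    have e1 : T = S0 := by
      rw [← hins T hT, he]; exact Finset.insert_erase (hc S0 hS0c).1.1
    rw [e1, hS0f] at he
    have := (hc S0 hS0c).1.1
    rw [he] at this
    simp at this
  have := hN.card_union_le hσ (c := insert (S0.erase i) (c.image f)) ?_ ?_
  · rw [Finset.card_insert_of_notMem hnot, Finset.card_image_of_injOn hinj] at this
    omega
  · intro S hS
    rcases Finset.mem_insert.1 hS with rfl | hS'
    · exact hl
    · obtain ⟨T, hT, rfl⟩ := Finset.mem_image.1 hS'
      exact h1 T hT
  · intro S hS T hT
    rcases Finset.mem_insert.1 hS with rfl | hS' <;> rcases Finset.mem_insert.1 hT with rfl | hT'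
    · exact cmp_refl _
    · obtain ⟨T, k1, rfl⟩ := Finset.mem_image.1 hT'
      exact hcmp T k1
    · obtain ⟨S, k2, rfl⟩ := Finset.mem_image.1 hS'
      exact (hcmp S k2).symm
    · obtain ⟨T, k1, rfl⟩ := Finset.mem_image.1 hT'
      obtain ⟨S, k2, rfl⟩ := Finset.mem_image.1 hS'
      exact h2 S k2 T k1

theorem nc_prod (hL : FlatFam L) (hσ : Base L σ) (hnc : ∀ T ∈ σ, i ∈ T → T.erase i ∉ L)
    {N : ℕ} (hN : Graded L N) {c : Finset (Finset E)}
    (hc : ∀ S ∈ c, S ∈ Lk (del L i) (σ.image (insert i))) (hcc : ∀ S ∈ c, ∀ T ∈ c, cmp S T)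
    (hcard : c.card + σ.card = N) :
    ∏ S ∈ c, YY L σ i S = ∏ S ∈ c, xx L σ (lift L i S) := by
  classical
  have e1 : ∏ S ∈ c, YY L σ i S = ∏ S ∈ c, (xx L σ S + xx L σ (S.erase i)) := by
    refine Finset.prod_congr rfl fun S hS => ?_
    rw [YY, Finset.insert_eq_of_mem (hc S hS).1.1]
  have e2 : ∀ t ⊆ c, (∏ S ∈ t, xx L σ S) * ∏ S ∈ c \ t, xx L σ (S.erase i) =
      ∏ S ∈ c, xx L σ (if S ∈ t then S else S.erase i) := by
    intro t ht
    rw [← Finset.prod_sdiff ht, mul_comm]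
    congr 1
    · refine Finset.prod_congr rfl fun S hS => ?_
      rw [if_neg (Finset.mem_sdiff.1 hS).2]
    · refine Finset.prod_congr rfl fun S hS => ?_
      rw [if_pos hS]
  rw [e1, Finset.prod_add, Finset.sum_eq_single (c.filter fun S => S.erase i ∉ L)]
  · rw [e2 _ (Finset.filter_subset _ _)]
    refine Finset.prod_congr rfl fun S hS => ?_
    congr 1
    unfold lift
    by_cases h : S.erase i ∈ L <;> simp [h, hS]
  · intro t ht hne
    rw [e2 t (Finset.mem_powerset.1 ht)]
    have hex : ∃ S ∈ c, (if S ∈ t then S else S.erase i) ≠ lift L i S := by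
      by_contra hcon
      push Not at hcon
      apply hne
      ext S
      have hss : ∀ S ∈ c, S ≠ S.erase i := fun S hS h => by
        have := (hc S hS).1.1
        rw [h] at this; simp at this
      constructor
      · intro hS
        have hSc := Finset.mem_powerset.1 ht hS
        refine Finset.mem_filter.2 ⟨hSc, fun h => ?_⟩
        have := hcon S hSc
        rw [if_pos hS, lift, if_pos h] at this
        exact hss S hSc this
      · intro hS
        obtain ⟨hSc, h⟩ := Finset.mem_filter.1 hS
        by_contra hSt
        have := hcon S hSc
        rw [if_neg hSt, lift, if_neg h] at this
        exact hss S hSc this.symm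
    obtain ⟨S1, hS1, hS1f⟩ := hex
    refine nc_prod_zero hL hσ hnc hN hc hcc hcard ?_ hS1 hS1f
    intro S hS
    by_cases h : S ∈ t <;> simp [h]
  · intro h
    exact absurd (Finset.mem_powerset.2 (Finset.filter_subset _ _)) h

theorem nc_map_prod (c : Finset (Finset E))
    (hc : ∀ S ∈ c, S ∈ Lk (del L i) (σ.image (insert i))) :
    (nc_thet (L := L) (σ := σ) (i := i)).map (∏ S ∈ c, xx (del L i) (σ.image (insert i)) S) =
      ∏ S ∈ c, YY L σ i S := by
  induction c using Finset.induction_on with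
  | empty => simp [Thet.map_one]
  | insert S c hS ih =>
    rw [Finset.prod_insert hS, Finset.prod_insert hS, Thet.map_xx _ (hc S (by simp)),
      ih fun T hT => hc T (by simp [hT])]

theorem nc_nrm (hL : FlatFam L) (hσ : Base L σ) (hnc : ∀ T ∈ σ, i ∈ T → T.erase i ∉ L)
    {N : ℕ} (hN : Graded L N) {deg : CR L σ →ₗ[ℝ] ℝ} (hdeg : Nrm L σ N deg) :
    Nrm (del L i) (σ.image (insert i)) N (deg ∘ₗ (nc_thet (L := L) (σ := σ) (i := i)).map) := by
  classical
  intro c hc hcc hcard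
  rw [nc_card hσ hnc] at hcard
  have hinj : Set.InjOn (lift L i) c := by
    intro S hS T hT h
    rw [← insert_lift (L := L) (hc S hS).1.1, ← insert_lift (L := L) (hc T hT).1.1, h]
  rw [LinearMap.comp_apply, nc_map_prod c hc, nc_prod hL hσ hnc hN hc hcc hcard,
    ← Finset.prod_image (s := c) (g := lift L i) (f := fun S => xx L σ S) hinj]
  refine hdeg _ ?_ ?_ ?_
  · intro S hS
    obtain ⟨T, hT, rfl⟩ := Finset.mem_image.1 hS
    exact nc_lift_mem hL hσ hnc (hc T hT)
  · intro S hS S' hS'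
    obtain ⟨T, hT, rfl⟩ := Finset.mem_image.1 hS
    obtain ⟨T', hT', rfl⟩ := Finset.mem_image.1 hS'
    exact (hcc T hT T' hT').imp (lift_mono hL (hc T hT).1) (lift_mono hL (hc T' hT').1)
  · rw [Finset.card_image_of_injOn hinj, hcard]

theorem nc_case (hL : FlatFam L) (hσ : Base L σ) (g : Gap σ i P Q) {N : ℕ} (hN : Graded L N)
    (hQ : Q.erase i ∉ L) (ihτ : ∀ F, InS L σ i F → TT L (tau σ i F) N)
    (ih' : TT (del L i) (σ.image (insert i)) N)
    (deg : CR L σ →ₗ[ℝ] ℝ) (hdeg : Nrm L σ N deg) : PA (piece L σ) deg (N - σ.card) ∧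
      ∃ c, Nef L σ c ∧ HR (piece L σ) deg (N - σ.card) (ell L σ c) := by
  have hnc := nc_erase hL hσ g hQ
  set θ := nc_thet (L := L) (σ := σ) (i := i) with hθ
  have hpr := ih' _ (nc_nrm hL hσ hnc hN hdeg)
  rw [nc_card hσ hnc] at hpr
  obtain ⟨hB, hK⟩ := hpr
  have hmem : ∀ k, ∀ b ∈ piece (del L i) (σ.image (insert i)) k, θ.map b ∈ piece L σ k :=
    fun k b hb => by simpa using θ.map_mem (n := 0) piece_one_mem k b hb
  have hb := build hL hσ g hN hdeg ihτ (W := fun F => insert i F) (y := 0)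
    (fun F _ => Or.inl rfl)
    (fun F F' hF _ h _ => absurd (h ▸ Finset.mem_insert_self i F) hF.iF) hB (φ := θ.map)
    hmem θ.map_one
    (fun k l _ b _ b' _ => by rw [θ.map_mul, one_mul]; rfl)
    (by
      intro U hU
      by_cases h : insert i U ∈ Lk (del L i) (σ.image (insert i))
      · exact ⟨_, xx_mem _, fun b => by rw [θ.map_xx h, YY_insert]⟩
      · refine ⟨0, Submodule.zero_mem _, fun b => ?_⟩
        have hU' : insert i U ∉ σ.image (insert i) := by
          intro h
          obtain ⟨T, hT, he⟩ := Finset.mem_image.1 h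
          exact hU T hT he.symm
        have h1 : xx L σ (insert i U) = 0 := xx_eq_zero fun hG => h <| by
          have := nc_cov (i := i) hG
          rw [Finset.insert_idem] at this
          exact this hU'
        have h2 : xx L σ (U.erase i) = 0 := xx_eq_zero fun hG => h <| by
          have := nc_cov (i := i) hG
          rw [insert_erase'] at this
          exact this hU'
        rw [YY, h1, h2]; simp)
    ⟨0, Submodule.zero_mem _, fun b => by simp⟩ (fun F _ => zero_mul _)
    (fun h => absurd h.1 hQ)
    (by
      intro Pr p1 _ p0 padd psm pY
      refine piece_ind (Pr := fun k b => Pr k (θ.map b)) ?_ ?_ ?_ ?_ ?_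
      · rw [θ.map_one]; exact p1
      · intro k; rw [map_zero]; exact p0 k
      · intro k p q hp hq; rw [map_add]; exact padd k _ _ hp hq
      · intro k r p hp; rw [map_smul]; exact psm k r _ hp
      · intro k p S hS hp
        rw [θ.map_xx hS]
        refine pY k _ S ?_ hp
        intro T hT he
        rw [Finset.insert_eq_of_mem hS.1.1] at he
        exact hS.2.1 (he ▸ Finset.mem_image_of_mem _ hT))
  refine ⟨hb.1, ?_⟩
  obtain ⟨ν, hν, hν0, -, hνi⟩ := ct_supp i hσ.chain
  have hν' : ∀ T ∈ σ.image (insert i), ν T = ct i T := by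
    intro T hT
    obtain ⟨T, hT', rfl⟩ := Finset.mem_image.1 hT
    rw [hνi, hν0 T hT']; simp [ct]
  have hk := hK _ (ct_Kc (nc_base (i := i) hσ) i hν hν' ?_)
  · refine ⟨_, ct_nef i hν hν0, ?_⟩
    have := hb.2 ν hν hν0 _ (ell_mem _) hk ?_
    · rwa [add_zero] at this
    · intro b
      rw [add_zero]
      exact thet_ct θ hν hν0 hν hν' hν0 hνi b
  · intro S hS T hT he
    have hiT : i ∈ T := by
      rcases hT with h | h
      · exact h.1.1
      · exact ((nc_base hσ).mem T h).1
    rwa [Finset.insert_eq_of_mem hS.1.1, Finset.insert_eq_of_mem hiT] at he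

end nc
end HRProof


namespace HRProof

open MvPolynomial

section cc
variable {E : Type*} [Fintype E] [DecidableEq E] {L : Set (Finset E)}
  {σ : Finset (Finset E)} {i j : E} {P Q : Finset E}

theorem ell_mul_xx_zero {c : Finset E → ℝ} {W : Finset E} (h : ∀ G, c G ≠ 0 → ¬ cmp G W) :
    ell L σ c * xx L σ W = 0 := by
  rw [ell, Finset.sum_mul]
  refine Finset.sum_eq_zero fun G _ => ?_
  by_cases hG : c G = 0
  · rw [hG, zero_smul, zero_mul]
  · rw [smul_mul_assoc, xx_mul_eq_zero (h G hG), smul_zero]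

theorem cy_ne {G : Finset E} (h : cy i j G ≠ 0) : j ∈ G ∧ i ∉ G := by
  unfold cy at h
  by_contra hcon
  rw [if_neg hcon] at h
  exact h rfl

theorem cy_swap (g : Gap σ i P Q) (hjP : j ∉ P) (hjQ : j ∈ Q) :
    ell L σ (cy i j) = ell L σ (cy j i) := by
  have h := ell_aff (L := L) (Aff.dif j i) (dif_gap g hjP hjQ g.iP g.iQ)
  have e : dif j i = fun S => cy i j S - cy j i S := by
    funext S
    unfold dif cy
    by_cases h1 : j ∈ S <;> by_cases h2 : i ∈ S <;> simp [h1, h2]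
  rw [e, ell_sub] at h
  exact sub_eq_zero.1 h

theorem cy_sq (g : Gap σ i P Q) (hjP : j ∉ P) (hjQ : j ∈ Q) :
    ell L σ (cy i j) * ell L σ (cy i j) = 0 := by
  nth_rewrite 2 [cy_swap g hjP hjQ]
  rw [ell, ell, Finset.mul_sum]
  refine Finset.sum_eq_zero fun G _ => ?_
  by_cases hG : cy j i G = 0
  · rw [hG, zero_smul, mul_zero]
  · rw [mul_smul_comm]
    have : ell L σ (cy i j) * xx L σ G = 0 := by
      refine ell_mul_xx_zero fun G' hG' hc => ?_
      have h1 := cy_ne hG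
      have h2 := cy_ne hG'
      rcases hc with hc | hc
      · exact h1.2 (hc h2.1)
      · exact h2.2 (hc h1.1)
    rw [ell] at this
    rw [this, smul_zero]

theorem c_closed (hL : FlatFam L) (hσ : Base L σ) (g : Gap σ i P Q) (hH : Q.erase i ∈ L) :
    Closed L i P Q := by
  intro G hG hi _ hGQ
  obtain ⟨G', hG', hs, hi', hmin⟩ := hL.cover G hG i hi
  have h1 : G' ⊆ Q := hmin Q (hσ.mem Q g.Q_mem) hGQ.1 i g.iQ hi' hi
  have h2 : G' = insert i G := by
    refine Finset.Subset.antisymm (fun b hb => ?_) (Finset.insert_subset hi' hs)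
    by_contra hcon
    rw [Finset.mem_insert, not_or] at hcon
    have := hmin _ hH (fun a ha => Finset.mem_erase.2 ⟨by rintro rfl; exact hi ha, hGQ.1 ha⟩) b
      (Finset.mem_erase.2 ⟨hcon.1, h1 hb⟩) hb hcon.2
    have := this hi'
    simp at this
  rwa [← h2]

theorem c_pr (g : Gap σ i P Q) : Pr L (insert (Q.erase i) σ) i (Q.erase i) where
  iF := by simp
  F_mem := Finset.mem_insert_self _ _
  F_mem' := by
    rw [Finset.insert_erase g.iQ]
    exact Finset.mem_insert_of_mem g.Q_mem

theorem c_thet (hL : FlatFam L) (hσ : Base L σ) (g : Gap σ i P Q) (hH : Q.erase i ∈ Lk L σ) :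
    Thet L σ L (insert (Q.erase i) σ) i (1 : CR L σ) := by
  refine (c_pr g).thet (hσ.insert hH).toIsFlag (Finset.subset_insert _ _) fun G hG => Or.inr ?_
  by_cases h1 : G = Q.erase i
  · exact Or.inr ⟨_, Finset.mem_insert_self _ _, by rw [h1]⟩
  by_cases h2 : cmp G (Q.erase i)
  · exact Or.inl ⟨G, mem_Lk_insert.2 ⟨hG, h1, h2⟩, rfl⟩
  have hGQ : G ⊆ Q := by
    rcases hG.2.2 Q g.Q_mem with h | h
    · exact h
    · exact absurd (Or.inr ((Finset.erase_subset _ _).trans h)) h2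
  have hi : i ∈ G := by
    by_contra hi
    exact h2 (Or.inl fun a ha => Finset.mem_erase.2 ⟨by rintro rfl; exact hi ha, hGQ ha⟩)
  have hPG := link_notin g hG hi
  have hPe : P ⊆ G.erase i := fun a ha =>
    Finset.mem_erase.2 ⟨by rintro rfl; exact g.iP ha, hPG.1 ha⟩
  by_cases h3 : P = G.erase i
  · exact Or.inr ⟨P, Finset.mem_insert_of_mem g.P_mem, by rw [h3, insert_erase']⟩
  · left
    have hGe : G.erase i ⊆ Q.erase i := Finset.erase_subset_erase _ hGQ
    have hmem : G.erase i ∈ L := erase_mem_of_subset hL hGQ (Or.inl hG.1) hH.1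
    have hlk : G.erase i ∈ Lk L σ := g.mem_link hmem (lt_of_le_of_ne hPe h3)
      (lt_of_le_of_lt hGe (Finset.erase_ssubset g.iQ))
    refine ⟨G.erase i, mem_Lk_insert.2 ⟨hlk, ?_, Or.inl hGe⟩, (insert_erase' G).symm⟩
    intro he
    exact h2 (Or.inr (he ▸ Finset.erase_subset _ _))

theorem c_allowed (hσ : Base L σ) (g : Gap σ i P Q) (hH : Q.erase i ∈ Lk L σ) :
    ∀ S ∈ Lk L (insert (Q.erase i) σ), ∀ T ∈ σ, insert i S ≠ insert i T := by
  intro S hS T hT he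
  have hT' : T ∈ insert (Q.erase i) σ := Finset.mem_insert_of_mem hT
  have := (c_pr (L := L) g).inj (hσ.insert hH).toIsFlag S hS T (Or.inr hT') he
  exact hS.2.1 (this ▸ hT')

theorem c_gys (hσ : Base L σ) (g : Gap σ i P Q) (hH : Q.erase i ∈ Lk L σ)
    (θ : Thet L σ L (insert (Q.erase i) σ) i (1 : CR L σ)) :
    ∀ k, ∀ b ∈ piece L (insert (Q.erase i) σ) k,
      xx L σ (Q.erase i) * θ.map b = gys L σ (Q.erase i) b := by
  refine piece_ind ?_ ?_ ?_ ?_ ?_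
  · rw [θ.map_one, gys_one, mul_one]
  · intro k; simp only [map_zero, mul_zero]
  · intro k p q hp hq; simp only [map_add, mul_add] at *; rw [hp, hq]
  · intro k r p hp; simp only [map_smul, mul_smul_comm] at *; rw [hp]
  · intro k p S hS hp
    have hlk := Lk_of_insert hS
    rw [θ.map_xx hS, gys_xx_mul hlk.2.1, ← hp]
    have e : xx L σ (Q.erase i) * YY L σ i S = xx L σ (Q.erase i) * xx L σ S := by
      rcases (c_pr (L := L) g).dich hS with ⟨h1, h2⟩ | ⟨h1, h2⟩
      · rw [YY, Finset.erase_eq_of_notMem h2, mul_add, xx_mul_eq_zero, zero_add]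
        rintro (h | h)
        · exact h1.2 (sub_insert_cancel (by simp) h)
        · have := h (Finset.mem_insert_self _ _)
          simp at this
      · rw [Finset.insert_erase g.iQ] at h1
        rw [YY, Finset.insert_eq_of_mem h2, xx_eq_zero (S := S.erase i), add_zero]
        intro h
        have h3 := link_notin' g h (by simp)
        refine h1.2 fun a ha => ?_
        by_cases hai : a = i
        · rw [hai]; exact g.iQ
        · exact h3.1 (Finset.mem_erase.2 ⟨hai, ha⟩)
    rw [← mul_assoc, e]; ring

open Classical in
/-- index set of pairs through `j` -/
noncomputable def tj (L : Set (Finset E)) (σ : Finset (Finset E)) (i j : E) : Finset (Finset E) :=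
  Finset.univ.filter fun F => InS L σ i F ∧ j ∈ F

theorem mem_tj {F : Finset E} : F ∈ tj L σ i j ↔ InS L σ i F ∧ j ∈ F := by
  simp [tj]

theorem c_y (hL : FlatFam L) (hσ : Base L σ) (g : Gap σ i P Q) (hH : Q.erase i ∈ Lk L σ)
    (hjP : j ∉ P) (hjH : j ∈ Q.erase i) :
    ell L σ (cy i j) = xx L σ (Q.erase i) + ∑ F ∈ tj L σ i j, xx L σ F := by
  classical
  have hHt : Q.erase i ∉ tj L σ i j := by
    intro h
    have := (mem_tj.1 h).1.mem'.2.1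
    rw [Finset.insert_erase g.iQ] at this
    exact this g.Q_mem
  rw [← Finset.sum_insert (f := fun F => xx L σ F) hHt, ell,
    ← Finset.sum_subset (Finset.subset_univ (insert (Q.erase i) (tj L σ i j)))]
  · refine Finset.sum_congr rfl fun S hS => ?_
    have : cy i j S = 1 := by
      unfold cy
      rw [if_pos]
      rcases Finset.mem_insert.1 hS with h | h
      · rw [h]; exact ⟨hjH, by simp⟩
      · exact ⟨(mem_tj.1 h).2, (mem_tj.1 h).1.iF⟩
    rw [this, one_smul]
  · intro S _ hS
    by_cases hc : cy i j S = 0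
    · rw [hc, zero_smul]
    obtain ⟨hj, hi⟩ := cy_ne hc
    rw [xx_eq_zero, smul_zero]
    intro hlk
    have h1 := link_notin' g hlk hi
    have h2 : P ⊂ S := by
      rcases hlk.2.2 P g.P_mem with h | h
      · exact absurd (h hj) hjP
      · exact lt_of_le_of_ne h fun h' => hjP (h' ▸ hj)
    have h3 := c_closed hL hσ g hH.1 S hlk.1 hi h2 h1
    apply hS
    rw [Finset.mem_insert]
    by_cases he : insert i S = Q
    · left; rw [← he, Finset.erase_insert hi]
    · right
      refine mem_tj.2 ⟨⟨hlk, hi, g.mem_link h3 (lt_of_lt_of_le h2 (Finset.subset_insert _ _))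
        (lt_of_le_of_ne (Finset.insert_subset g.iQ h1.1) he)⟩, hj⟩

theorem c_case (hL : FlatFam L) (hσ : Base L σ) (g : Gap σ i P Q) {N : ℕ} (hN : Graded L N)
    (hH : Q.erase i ∈ Lk L σ) (ihτ : ∀ F, InS L σ i F → TT L (tau σ i F) N)
    (ihH : TT L (insert (Q.erase i) σ) N)
    (deg : CR L σ →ₗ[ℝ] ℝ) (hdeg : Nrm L σ N deg) : PA (piece L σ) deg (N - σ.card) ∧
      ∃ c, Nef L σ c ∧ HR (piece L σ) deg (N - σ.card) (ell L σ c) := by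
  classical
  have hcl := c_closed hL hσ g hH.1
  obtain ⟨j, hjH, hjP⟩ : ∃ j ∈ Q.erase i, j ∉ P := by
    by_contra hcon
    push Not at hcon
    have hPH : P ⊆ Q.erase i := fun a ha =>
      Finset.mem_erase.2 ⟨by rintro rfl; exact g.iP ha, g.PQ hσ.toIsFlag ha⟩
    exact hH.2.1 (Finset.Subset.antisymm hPH hcon ▸ g.P_mem)
  have hji : j ≠ i := (Finset.mem_erase.1 hjH).1
  have hjQ : j ∈ Q := (Finset.mem_erase.1 hjH).2
  set H := Q.erase i with hHdef
  have hiH : insert i H = Q := Finset.insert_erase g.iQ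
  set θ := c_thet hL hσ g hH with hθ
  set y := ell L σ (cy i j) with hy
  have hyy : y * y = 0 := cy_sq g hjP hjQ
  have hysum : y = xx L σ (Q.erase i) + ∑ F ∈ tj L σ i j, xx L σ F :=
    c_y hL hσ g hH hjP hjH
  have hall := c_allowed hσ g hH
  have hcardH : (insert H σ).card = σ.card + 1 := Finset.card_insert_of_notMem hH.2.1
  have hlt := hN.card_lt hσ hH
  obtain ⟨e, he⟩ : ∃ e, N - σ.card = e + 1 := ⟨N - σ.card - 1, by omega⟩
  have he' : N - (insert H σ).card = e := by omega
  have hpr := ihH _ (hdeg.gys hH)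
  rw [he'] at hpr
  obtain ⟨hB0, hK⟩ := hpr
  have θmul : ∀ a b, θ.map (a * b) = θ.map a * θ.map b := fun a b => by rw [θ.map_mul, one_mul]
  -- the base map
  set φ : DualNumber (CR L (insert H σ)) →ₗ[ℝ] CR L σ :=
    θ.map ∘ₗ fstL _ + (LinearMap.mulLeft ℝ y ∘ₗ θ.map) ∘ₗ sndL _ with hφ
  have φap : ∀ z, φ z = θ.map z.fst + y * θ.map z.snd := fun z => rfl
  have φmul : ∀ z w, φ (z * w) = φ z * φ w := by
    intro z w
    rw [φap, φap, φap, snd_mul', TrivSqZeroExt.fst_mul, map_add, θmul, θmul, θmul]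
    linear_combination (- θ.map z.snd * θ.map w.snd) * hyy
  have hmem0 : ∀ k, ∀ b ∈ piece L (insert H σ) k, θ.map b ∈ piece L σ k :=
    fun k b hb => by simpa using θ.map_mem (n := 0) piece_one_mem k b hb
  -- degree of the top class
  have hxF : ∀ F ∈ tj L σ i j, ∀ b ∈ piece L (insert H σ) e, xx L σ F * θ.map b = 0 := by
    intro F hF b hb
    have hIn := (mem_tj.1 hF).1
    have hT : Thet L σ L (tau σ i F) i (xx L σ F) := thet_link hL hσ g hIn (Or.inr ⟨rfl, hcl⟩)
    have hPA := (ihτ F hIn _ (hIn.nrm hdeg)).1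
    have hle := hN.card_le (hIn.base hσ).toIsFlag
    have hc := hIn.card
    obtain ⟨e2, he2⟩ : ∃ e2, e = e2 + 1 := ⟨e - 1, by omega⟩
    have htop : ∀ z ∈ piece L (tau σ i F) (e2 + 1), z = 0 := fun z hz =>
      hPA.top (e2 + 1) (by omega) z hz
    have := link_BC g hIn hT θ hall htop (a := 0) (b := e) (by omega) piece_one_mem hb
    rw [hT.map_one] at this
    rw [mul_comm]; exact this
  have hdegy : ∀ b ∈ piece L (insert H σ) e, deg (y * θ.map b) = deg (gys L σ H b) := by
    intro b hb
    rw [hysum, add_mul, Finset.sum_mul, Finset.sum_eq_zero fun F hF => hxF F hF b hb, add_zero,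
      c_gys hσ g hH θ e b hb]
  have hBd := hB0.dual
  rw [← he] at hBd
  have hWne : ∀ F, InS L σ i F → F ≠ insert i F := fun F hF h => hF.ne h.symm
  have hY0 : ∀ U, (∀ T ∈ σ, insert i U ≠ insert i T) →
      (¬ ∃ S ∈ Lk L (insert H σ), insert i U = insert i S) → xx L σ U = 0 := by
    intro U hU hS
    by_contra hcon
    have hlk : U ∈ Lk L σ := by
      by_contra h; exact hcon (xx_eq_zero h)
    rcases θ.cov U hlk with h | h | ⟨T, hT, hUT⟩
    · rw [one_mul] at h; exact hcon h
    · exact hS h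
    · rcases Finset.mem_insert.1 hT with rfl | hT'
      · apply hU Q g.Q_mem
        rw [hUT, hiH, Finset.insert_eq_of_mem g.iQ]
      · exact hU T hT' hUT
  have hb := build hL hσ g hN hdeg ihτ (W := fun F => if j ∈ F then F else insert i F) (y := y)
    (fun F _ => by by_cases h : j ∈ F <;> simp [h, hcl])
    (by
      intro F F' hF hF' h h'
      have h1 : j ∈ F := by
        by_contra hj; simp only [hj, if_false] at h; exact hF.ne h
      have h2 : j ∉ F' := by
        intro hj; simp only [hj, if_true] at h'; exact hWne F' hF' h'
      rintro (hc | hc)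
      · rcases Finset.mem_insert.1 (hc h1) with h | h
        · exact hji h
        · exact h2 h
      · exact hF.iF (hc (Finset.mem_insert_self _ _)))
    hBd (φ := φ)
    (by
      intro k z hz
      obtain ⟨h1, h2⟩ := mem_dualPiece.1 hz
      rw [φap]
      refine Submodule.add_mem _ (hmem0 k _ h1) ?_
      cases k with
      | zero =>
        have h2' : z.snd = 0 := h2
        rw [h2', map_zero, mul_zero]; exact Submodule.zero_mem _
      | succ k =>
        rw [add_comm k 1]
        exact piece_mul_mem _ _ _ _ (ell_mem _) (hmem0 k _ h2))
    (by rw [φap, TrivSqZeroExt.fst_one, TrivSqZeroExt.snd_one, map_zero, mul_zero, add_zero,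
          θ.map_one])
    (by
      intro k l hkl b hb b' hb'
      have hz := hBd.mul_mem k l b b' hb hb'
      rw [← φmul, φap]
      rw [hkl, he] at hz
      obtain ⟨h1, h2⟩ := mem_dualPiece.1 hz
      have h1' := hB0.top (e + 1) (by omega) _ h1
      rw [h1', map_zero, zero_add, hdegy _ h2]
      rfl)
    (by
      intro U hU
      by_cases h : ∃ S ∈ Lk L (insert H σ), insert i U = insert i S
      · obtain ⟨S, hS, hUS⟩ := h
        refine ⟨TrivSqZeroExt.inl (xx L (insert H σ) S), mem_dualPiece.2 ⟨?_, ?_⟩, fun b => ?_⟩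
        · rw [TrivSqZeroExt.fst_inl]; exact xx_mem S
        · rw [TrivSqZeroExt.snd_inl]; exact Submodule.zero_mem _
        · rw [φmul, φap (TrivSqZeroExt.inl _), TrivSqZeroExt.fst_inl, TrivSqZeroExt.snd_inl,
            map_zero, mul_zero, add_zero, ← mul_one (xx L (insert H σ) S), θ.map_xx hS,
            θ.map_one, mul_one, YY_congr hUS]
      · refine ⟨0, Submodule.zero_mem _, fun b => ?_⟩
        have h1 : xx L σ (insert i U) = 0 := hY0 _ (by rwa [Finset.insert_idem])
          (by rwa [Finset.insert_idem])
        have h2 : xx L σ (U.erase i) = 0 := hY0 _ (by rwa [insert_erase'])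
          (by rwa [insert_erase'])
        rw [YY, h1, h2]; simp)
    (by
      refine ⟨TrivSqZeroExt.inr 1, mem_dualPiece.2 ⟨?_, ?_⟩, fun b => ?_⟩
      · rw [TrivSqZeroExt.fst_inr]; exact Submodule.zero_mem _
      · rw [TrivSqZeroExt.snd_inr]; exact piece_one_mem
      · rw [φmul, φap (TrivSqZeroExt.inr _), TrivSqZeroExt.fst_inr, TrivSqZeroExt.snd_inr,
          map_zero, zero_add, θ.map_one, mul_one])
    (by
      intro F hF
      by_cases hj : j ∈ F
      · simp only [hj, if_true]
        rw [hy, cy_swap g hjP hjQ]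
        refine ell_mul_xx_zero fun G hG hc => ?_
        have := cy_ne hG
        rcases hc with hc | hc
        · exact hF.iF (hc this.1)
        · exact this.2 (hc hj)
      · simp only [hj, if_false]
        rw [hy]
        refine ell_mul_xx_zero fun G hG hc => ?_
        have := cy_ne hG
        rcases hc with hc | hc
        · rcases Finset.mem_insert.1 (hc this.1) with h | h
          · exact hji h
          · exact hj h
        · exact this.2 (hc (Finset.mem_insert_self _ _)))
    (by
      intro _
      refine ⟨tj L σ i j, fun F hF => (mem_tj.1 hF).1, ?_⟩
      have : ∑ F ∈ tj L σ i j, xx L σ (if j ∈ F then F else insert i F) =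
          ∑ F ∈ tj L σ i j, xx L σ F :=
        Finset.sum_congr rfl fun F hF => by rw [if_pos (mem_tj.1 hF).2]
      rw [this, hysum, add_sub_cancel_right])
    (by
      intro Pr p1 py p0 padd psm pY
      have q1 : ∀ k, ∀ b ∈ piece L (insert H σ) k, Pr k (θ.map b) := by
        refine piece_ind (Pr := fun k b => Pr k (θ.map b)) ?_ ?_ ?_ ?_ ?_
        · rw [θ.map_one]; exact p1
        · intro k; rw [map_zero]; exact p0 k
        · intro k p q hp hq; rw [map_add]; exact padd k _ _ hp hq
        · intro k r p hp; rw [map_smul]; exact psm k r _ hp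
        · intro k p S hS hp
          rw [θ.map_xx hS]
          exact pY k _ S (hall S hS) hp
      have q2 : ∀ k, ∀ b ∈ piece L (insert H σ) k, Pr (k + 1) (y * θ.map b) := by
        refine piece_ind (Pr := fun k b => Pr (k + 1) (y * θ.map b)) ?_ ?_ ?_ ?_ ?_
        · rw [θ.map_one, mul_one]; exact py
        · intro k; rw [map_zero, mul_zero]; exact p0 _
        · intro k p q hp hq; rw [map_add, mul_add]; exact padd _ _ _ hp hq
        · intro k r p hp; rw [map_smul, mul_smul_comm]; exact psm _ r _ hp
        · intro k p S hS hp
          rw [θ.map_xx hS, mul_left_comm]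
          exact pY _ _ S (hall S hS) hp
      intro k z hz
      obtain ⟨h1, h2⟩ := mem_dualPiece.1 hz
      rw [φap]
      refine padd k _ _ (q1 k _ h1) ?_
      cases k with
      | zero =>
        have h2' : z.snd = 0 := h2
        rw [h2', map_zero, mul_zero]; exact p0 _
      | succ k => exact q2 k _ h2)
  refine ⟨hb.1, ?_⟩
  obtain ⟨ν, hν, hν0, -, hνi⟩ := ct_supp i (hσ.insert hH).chain
  have hν' : ∀ T ∈ σ, ν T = ct i T := fun T hT => hν0 T (Finset.mem_insert_of_mem hT)
  have hk := hK _ (ct_Kc (hσ.insert hH) i hν hν0 ((c_pr (L := L) g).inj (hσ.insert hH).toIsFlag))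
  have hk2 := HR.dual hB0 (ell_mem _) hk
  rw [← he] at hk2
  refine ⟨_, (ct_nef i hν hν').add (cy_nef g hjP), ?_⟩
  rw [ell_add]
  refine hb.2 ν hν hν' _ ?_ hk2 ?_
  · refine mem_dualPiece.2 ⟨?_, ?_⟩
    · rw [TrivSqZeroExt.fst_add, TrivSqZeroExt.fst_inl, TrivSqZeroExt.fst_inr, add_zero]
      exact ell_mem _
    · rw [TrivSqZeroExt.snd_add, TrivSqZeroExt.snd_inl, TrivSqZeroExt.snd_inr, zero_add]
      exact piece_one_mem
  · intro b
    rw [φmul]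
    congr 1
    have := thet_ct θ hν hν' hν hν0 hν' hνi 1
    rw [mul_one, θ.map_one, mul_one] at this
    rw [φap, TrivSqZeroExt.fst_add, TrivSqZeroExt.fst_inl, TrivSqZeroExt.fst_inr, add_zero,
      TrivSqZeroExt.snd_add, TrivSqZeroExt.snd_inl, TrivSqZeroExt.snd_inr, zero_add, this,
      θ.map_one, mul_one]

/-- base case -/
theorem base_case (hσ : Base L σ) {N : ℕ} (hN : Graded L N) (h : Lk L σ = ∅) : TT L σ N := by
  have hcard := hN.card_eq hσ.toIsFlag h
  intro deg hdeg
  have h1 : deg 1 = 1 := by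
    have := hdeg ∅ (by simp) (by simp) (by simpa using hcard)
    simpa using this
  have hsucc : ∀ k, ∀ a ∈ piece L σ k, 0 < k → a = 0 := by
    refine piece_ind (Pr := fun k a => 0 < k → a = 0) ?_ ?_ ?_ ?_ ?_
    · intro h; omega
    · intros; rfl
    · intro k p q hp hq hk; rw [hp hk, hq hk, add_zero]
    · intro k r p hp hk; rw [hp hk, smul_zero]
    · intro k p S hS; rw [h] at hS; exact absurd hS (Set.notMem_empty _)
  have h0 : N - σ.card = 0 := by omega
  rw [h0]
  refine ⟨⟨piece_one_mem, piece_mul_mem, piece_fin, fun k hk a ha => hsucc k a ha hk, ?_⟩, ?_⟩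
  · intro k k' hk a ha hb
    obtain rfl : k = 0 := by omega
    obtain rfl : k' = 0 := by omega
    obtain ⟨r, rfl⟩ := Submodule.mem_span_singleton.1 (piece_zero_le ha)
    have := hb 1 piece_one_mem
    rw [mul_one, map_smul, h1, smul_eq_mul, mul_one] at this
    rw [this, zero_smul]
  · intro c _ k m hk a ha _ hne
    obtain rfl : k = 0 := by omega
    obtain rfl : m = 0 := by omega
    obtain ⟨r, rfl⟩ := Submodule.mem_span_singleton.1 (piece_zero_le ha)
    have hr : r ≠ 0 := by rintro rfl; exact hne (zero_smul _ _)
    have e : (r • (1 : CR L σ)) * (r • 1) * ell L σ c ^ 0 = (r * r) • 1 := by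
      rw [pow_zero, mul_one, smul_mul_smul_comm, mul_one]
    rw [e, map_smul, h1]
    simp only [pow_zero, one_mul, smul_eq_mul, mul_one]
    exact mul_self_pos.2 hr

open Classical in
theorem main_TT (n : ℕ) : ∀ (m : ℕ) (L : Set (Finset E)) (σ : Finset (Finset E)) (N : ℕ),
    FlatFam L → Graded L N → Base L σ → N - σ.card = n →
    (Finset.univ.filter fun e => ∃ T ∈ σ, e ∉ T).card = m → TT L σ N := by
  induction n using Nat.strong_induction_on with
  | _ n ihn =>
  intro m
  induction m using Nat.strong_induction_on with
  | _ m ihm =>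
  intro L σ N hL hN hσ hn hm
  by_cases hlk : Lk L σ = ∅
  · exact base_case hσ hN hlk
  obtain ⟨F, hF⟩ := Set.nonempty_iff_ne_empty.2 hlk
  obtain ⟨i, P, Q, g, hiF, hPF, hFQ⟩ := exists_gap_of_link hσ hF
  have ih1 : ∀ F ∈ Lk L σ, TT L (insert F σ) N := by
    intro F hF
    have hlt := hN.card_lt hσ hF
    have hc : (insert F σ).card = σ.card + 1 := Finset.card_insert_of_notMem hF.2.1
    exact ihn (N - (insert F σ).card) (by omega) _ L _ N hL hN (hσ.insert hF) rfl rfl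
  have ihτ : ∀ F, InS L σ i F → TT L (tau σ i F) N := by
    intro F hF
    have hlt := hN.card_lt hσ hF.mem
    have hc := hF.card
    exact ihn (N - (tau σ i F).card) (by omega) _ L _ N hL hN (hF.base hσ) rfl rfl
  refine TT_of_nef hσ ih1 fun deg hdeg => ?_
  by_cases hQ : Q.erase i ∈ L
  · have hH : Q.erase i ∈ Lk L σ := by
      refine g.mem_link hQ ?_ (Finset.erase_ssubset g.iQ)
      have hPH : P ⊆ Q.erase i := fun a ha =>
        Finset.mem_erase.2 ⟨by rintro rfl; exact g.iP ha, g.PQ hσ.toIsFlag ha⟩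
      refine lt_of_le_of_ne hPH fun he => hFQ.2 ?_
      rw [← Finset.insert_erase g.iQ, ← he]
      exact Finset.insert_subset hiF hPF.1
    exact c_case hL hσ g hN hH ihτ (ih1 _ hH) deg hdeg
  · have hnc := nc_erase hL hσ g hQ
    have hc := nc_card hσ hnc
    refine nc_case hL hσ g hN hQ ihτ ?_ deg hdeg
    refine ihm _ ?_ (del L i) _ N (hL.del i)
      (hN.del hL (hnc _ hσ.univ_mem (Finset.mem_univ _))) (nc_base hσ) (by rw [hc, hn]) rfl
    rw [← hm]
    refine Finset.card_lt_card ⟨?_, fun hsub => ?_⟩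
    · intro e he
      obtain ⟨-, T, hT, heT⟩ := Finset.mem_filter.1 he
      obtain ⟨T, hT', rfl⟩ := Finset.mem_image.1 hT
      exact Finset.mem_filter.2 ⟨Finset.mem_univ _, T, hT',
        fun h => heT (Finset.mem_insert_of_mem h)⟩
    · have := hsub (Finset.mem_filter.2 ⟨Finset.mem_univ i, P, g.P_mem, g.iP⟩)
      obtain ⟨-, T, hT, hiT⟩ := Finset.mem_filter.1 this
      obtain ⟨T, hT', rfl⟩ := Finset.mem_image.1 hT
      exact hiT (Finset.mem_insert_self _ _)

theorem TT_all {N : ℕ} (hL : FlatFam L) (hN : Graded L N) (hσ : Base L σ) : TT L σ N :=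
  main_TT _ _ L σ N hL hN hσ rfl rfl

end cc
end HRProof


namespace HRProof

section matroid

variable {E : Type*} [Fintype E] [DecidableEq E]
variable {M : FinMatroid E}

theorem le_rank {I A : Finset E} (hI : M.Indep I) (hIA : I ⊆ A) : I.card ≤ M.rank A := by
  classical
  unfold FinMatroid.rank
  exact Finset.le_sup (f := Finset.card)
    (Finset.mem_filter.2 ⟨Finset.mem_powerset.2 hIA, hI⟩)

theorem rank_le {A : Finset E} {n : ℕ} (h : ∀ I, M.Indep I → I ⊆ A → I.card ≤ n) :
    M.rank A ≤ n := by
  classical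
  unfold FinMatroid.rank
  refine Finset.sup_le fun I hI => ?_
  obtain ⟨h1, h2⟩ := Finset.mem_filter.1 hI
  exact h I h2 (Finset.mem_powerset.1 h1)

theorem exists_basis (M : FinMatroid E) (A : Finset E) :
    ∃ I, M.Indep I ∧ I ⊆ A ∧ I.card = M.rank A := by
  by_contra hcon
  push Not at hcon
  have h0 : 0 < M.rank A := by
    have h1 := hcon ∅ M.indep_empty (Finset.empty_subset _)
    rw [Finset.card_empty] at h1; omega
  have : M.rank A ≤ M.rank A - 1 := rank_le fun I hI hIA => by
    have h1 := hcon I hI hIA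
    have h2 := le_rank hI hIA
    omega
  omega

theorem exists_ext (A : Finset E) : ∀ (n : ℕ) (I : Finset E), M.Indep I → I ⊆ A →
    M.rank A - I.card = n → ∃ J, M.Indep J ∧ I ⊆ J ∧ J ⊆ A ∧ J.card = M.rank A := by
  intro n
  induction n with
  | zero =>
    intro I hI hIA h
    have := le_rank hI hIA
    exact ⟨I, hI, Finset.Subset.refl _, hIA, by omega⟩
  | succ n ih =>
    intro I hI hIA h
    obtain ⟨B, hB, hBA, hBc⟩ := exists_basis M A
    obtain ⟨e, he, heI, hins⟩ := M.indep_exchange hI hB (by omega)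
    obtain ⟨J, hJ, h1, h2, h3⟩ := ih (insert e I) hins
      (Finset.insert_subset (hBA he) hIA)
      (by rw [Finset.card_insert_of_notMem heI]; omega)
    exact ⟨J, hJ, (Finset.subset_insert _ _).trans h1, h2, h3⟩

theorem rank_mono {A B : Finset E} (h : A ⊆ B) : M.rank A ≤ M.rank B :=
  rank_le fun _ hI hIA => le_rank hI (hIA.trans h)

theorem rank_insert_le (x : E) (A : Finset E) : M.rank (insert x A) ≤ M.rank A + 1 := by
  refine rank_le fun I hI hIA => ?_
  have h1 : (I.erase x).card ≤ M.rank A :=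
    le_rank (M.indep_subset hI (Finset.erase_subset _ _)) (by
      intro a ha
      obtain ⟨h1, h2⟩ := Finset.mem_erase.1 ha
      exact (Finset.mem_insert.1 (hIA h2)).resolve_left h1)
  have := Finset.pred_card_le_card_erase (s := I) (a := x)
  omega

theorem rank_insert_eq {x : E} {A B : Finset E} (h : M.rank (insert x A) = M.rank A)
    (hAB : A ⊆ B) : M.rank (insert x B) = M.rank B := by
  refine le_antisymm ?_ (rank_mono (Finset.subset_insert _ _))
  by_contra hlt
  push Not at hlt
  have hxB : x ∉ B := by
    intro hx; rw [Finset.insert_eq_of_mem hx] at hlt; exact lt_irrefl _ hlt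
  obtain ⟨I, hI, hIA, hIc⟩ := exists_basis M A
  obtain ⟨J, hJ, hIJ, hJB, hJc⟩ := exists_ext B _ I hI (hIA.trans hAB) rfl
  obtain ⟨J', hJ', hJJ', hJB', hJc'⟩ :=
    exists_ext (insert x B) _ J hJ (hJB.trans (Finset.subset_insert _ _)) rfl
  have hx : x ∈ J' := by
    by_contra hx
    have : J' ⊆ B := fun a ha => (Finset.mem_insert.1 (hJB' ha)).resolve_left (by
      rintro rfl; exact hx ha)
    have := le_rank hJ' this
    omega
  have hxI : x ∉ I := fun hxI => hxB (hAB (hIA hxI))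
  have := le_rank (M.indep_subset hJ' (Finset.insert_subset hx (hIJ.trans hJJ')))
    (Finset.insert_subset_insert x hIA)
  rw [Finset.card_insert_of_notMem hxI] at this
  omega

theorem mem_cl {x : E} {A : Finset E} : x ∈ M.closure A ↔ M.rank (insert x A) = M.rank A := by
  simp [FinMatroid.closure]

theorem subset_cl (A : Finset E) : A ⊆ M.closure A := fun x hx =>
  mem_cl.2 (by rw [Finset.insert_eq_of_mem hx])

theorem rank_cl (A : Finset E) : M.rank (M.closure A) = M.rank A := by
  have key : ∀ s : Finset E, s ⊆ M.closure A → M.rank (s ∪ A) = M.rank A := by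
    intro s
    induction s using Finset.induction_on with
    | empty => intro _; rw [Finset.empty_union]
    | insert a s ha ih =>
      intro h
      rw [Finset.insert_union, rank_insert_eq (mem_cl.1 (h (Finset.mem_insert_self _ _)))
        Finset.subset_union_right]
      exact ih ((Finset.subset_insert _ _).trans h)
  have := key _ (Finset.Subset.refl _)
  rwa [Finset.union_eq_left.2 (subset_cl A)] at this

theorem cl_mono {A B : Finset E} (h : A ⊆ B) : M.closure A ⊆ M.closure B := fun _ hx =>
  mem_cl.2 (rank_insert_eq (mem_cl.1 hx) h)

theorem cl_flat (A : Finset E) : M.IsFlat (M.closure A) := by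
  refine Finset.Subset.antisymm (fun x hx => ?_) (subset_cl _)
  rw [mem_cl, rank_cl] at hx
  rw [mem_cl]
  refine le_antisymm ?_ (rank_mono (Finset.subset_insert _ _))
  rw [← hx]
  exact rank_mono (Finset.insert_subset_insert _ (subset_cl A))

theorem cl_sub {A F : Finset E} (hF : M.IsFlat F) (h : A ⊆ F) : M.closure A ⊆ F := by
  have := cl_mono (M := M) h
  rwa [hF] at this

theorem rank_flat_lt {F G : Finset E} (hF : M.IsFlat F) (h : F ⊂ G) : M.rank F < M.rank G := by
  obtain ⟨h1, h2⟩ := h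
  obtain ⟨a, ha, haF⟩ := Finset.not_subset.1 h2
  refine lt_of_lt_of_le ?_ (rank_mono (Finset.insert_subset ha h1))
  refine lt_of_le_of_ne (rank_mono (Finset.subset_insert _ _)) fun h => haF ?_
  have : a ∈ M.closure F := mem_cl.2 h.symm
  rwa [hF] at this

/-- flats form a flat family -/
theorem flats_fam (M : FinMatroid E) : FlatFam {F | M.IsFlat F} where
  univ_mem := Finset.Subset.antisymm (Finset.subset_univ _) (subset_cl _)
  inter_mem S hS T hT := Finset.Subset.antisymm
    (Finset.subset_inter (cl_sub hS Finset.inter_subset_left)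
      (cl_sub hT Finset.inter_subset_right)) (subset_cl _)
  cover F hF a ha := by
    refine ⟨M.closure (insert a F), cl_flat _, (Finset.subset_insert _ _).trans (subset_cl _),
      subset_cl _ (Finset.mem_insert_self _ _), fun H hH hFH b hbH hb hbF x hx => ?_⟩
    have h1 : M.rank F < M.rank (insert b F) :=
      rank_flat_lt hF (Finset.ssubset_insert hbF)
    have h2 := rank_insert_le (M := M) a F
    have h3 : M.rank (insert x (insert b F)) ≤ M.rank (insert a F) := by
      rw [← rank_cl (insert a F)]
      exact rank_mono (Finset.insert_subset hx (Finset.insert_subset hb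
        ((Finset.subset_insert _ _).trans (subset_cl _))))
    have h4 : x ∈ M.closure (insert b F) :=
      mem_cl.2 (le_antisymm (by omega) (rank_mono (Finset.subset_insert _ _)))
    exact cl_sub hH (Finset.insert_subset hbH hFH) h4

theorem flats_graded (hM : M.Loopless) {d : ℕ} (hrk : M.rk = d + 1) :
    Graded {F | M.IsFlat F} (d + 2) := by
  classical
  intro σ hσ hmax
  have hu : Finset.univ ∈ σ := hmax _ (flats_fam M).univ_mem fun T _ => Or.inr (Finset.subset_univ _)
  have h0 : ∅ ∈ σ := hmax _ hM fun T _ => Or.inl (Finset.empty_subset _)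
  have hr0 : M.rank ∅ = 0 := Nat.le_zero.1 (rank_le fun I _ hI => by
    rw [Finset.subset_empty.1 hI]; rfl)
  have hinj : Set.InjOn M.rank (σ : Set (Finset E)) := by
    intro S hS T hT h
    by_contra hne
    rcases hσ.chain S hS T hT with h1 | h1
    · exact (rank_flat_lt (hσ.mem S hS) (h1.ssubset_of_ne hne)).ne h
    · exact (rank_flat_lt (hσ.mem T hT) (h1.ssubset_of_ne (Ne.symm hne))).ne h.symm
  have hsurj : ∀ n, n ≤ d + 1 → ∃ F ∈ σ, M.rank F = n := by
    intro n
    induction n with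
    | zero => intro _; exact ⟨∅, h0, hr0⟩
    | succ n ih =>
      intro hn
      obtain ⟨F, hF, hFr⟩ := ih (by omega)
      have hFu : F ⊂ Finset.univ := by
        refine (Finset.subset_univ F).ssubset_of_ne ?_
        rintro rfl
        have : M.rank Finset.univ = d + 1 := hrk
        omega
      obtain ⟨G, hG, hmin⟩ := Finset.exists_min_image (σ.filter fun G => F ⊂ G) Finset.card
        ⟨_, Finset.mem_filter.2 ⟨hu, hFu⟩⟩
      obtain ⟨hGσ, hFG⟩ := Finset.mem_filter.1 hG
      obtain ⟨a, haG, haF⟩ := Finset.not_subset.1 hFG.2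
      have hHG : M.closure (insert a F) ⊆ G :=
        cl_sub (hσ.mem G hGσ) (Finset.insert_subset haG hFG.1)
      have hFH : F ⊆ M.closure (insert a F) := (Finset.subset_insert _ _).trans (subset_cl _)
      refine ⟨M.closure (insert a F), hmax _ (cl_flat _) fun T hT => ?_, ?_⟩
      · by_cases hTF : T ⊆ F
        · exact Or.inr (hTF.trans hFH)
        · have hFT : F ⊂ T := ⟨(hσ.chain T hT F hF).resolve_left hTF, hTF⟩
          left
          refine hHG.trans ?_
          have hle := hmin T (Finset.mem_filter.2 ⟨hT, hFT⟩)
          rcases hσ.chain G hGσ T hT with h | h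
          · exact h
          · exact (Finset.eq_of_subset_of_card_le h hle).symm.subset
      · rw [rank_cl]
        have h1 := rank_insert_le (M := M) a F
        have h2 : M.rank F < M.rank (insert a F) :=
          rank_flat_lt (hσ.mem F hF) (Finset.ssubset_insert haF)
        omega
  have him : σ.image M.rank = Finset.range (d + 2) := by
    ext n
    rw [Finset.mem_image, Finset.mem_range]
    constructor
    · rintro ⟨F, -, rfl⟩
      have h1 := rank_mono (M := M) (Finset.subset_univ F)
      have : M.rank Finset.univ = d + 1 := hrk
      omega
    · intro h; exact hsurj n (by omega)
  rw [← Finset.card_image_of_injOn hinj, him, Finset.card_range]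

/-- the trivial flag -/
def sig0 (E : Type*) [Fintype E] [DecidableEq E] : Finset (Finset E) := {∅, Finset.univ}

theorem sig0_base (hM : M.Loopless) : Base {F | M.IsFlat F} (sig0 E) where
  mem S hS := by
    rcases Finset.mem_insert.1 hS with rfl | h
    · exact hM
    · rw [Finset.mem_singleton.1 h]; exact (flats_fam M).univ_mem
  chain S hS T hT := by
    rcases Finset.mem_insert.1 hS with rfl | h
    · exact Or.inl (Finset.empty_subset _)
    · rw [Finset.mem_singleton.1 h]; exact Or.inr (Finset.subset_univ _)
  univ_mem := Finset.mem_insert_of_mem (Finset.mem_singleton_self _)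
  bot := ⟨∅, Finset.mem_insert_self _ _, fun _ _ => Finset.empty_subset _⟩

theorem mem_Lk0 {S : Finset E} : S ∈ Lk {F | M.IsFlat F} (sig0 E) ↔
    M.IsFlat S ∧ S ≠ ∅ ∧ S ≠ Finset.univ := by
  constructor
  · rintro ⟨h1, h2, -⟩
    refine ⟨h1, ?_, ?_⟩
    · rintro rfl; exact h2 (Finset.mem_insert_self _ _)
    · rintro rfl; exact h2 (Finset.mem_insert_of_mem (Finset.mem_singleton_self _))
  · rintro ⟨h1, h2, h3⟩
    refine ⟨h1, ?_, ?_⟩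
    · intro h
      rcases Finset.mem_insert.1 h with h | h
      · exact h2 h
      · exact h3 (Finset.mem_singleton.1 h)
    · intro T hT
      rcases Finset.mem_insert.1 hT with rfl | h
      · exact Or.inr (Finset.empty_subset _)
      · rw [Finset.mem_singleton.1 h]; exact Or.inl (Finset.subset_univ _)

end matroid
end HRProof


namespace HRProof

open MvPolynomial FinMatroid

section transfer

variable {E : Type*} [Fintype E] [DecidableEq E]

/-- flats of a matroid -/
abbrev FF (M : FinMatroid E) : Set (Finset E) := {F | M.IsFlat F}

open Classical in
/-- image of a variable in the Chow ring of the matroid -/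
noncomputable def yvM (M : FinMatroid E) (S : Finset E) : ChowRing ℝ M :=
  if h : M.IsFlat S ∧ S ≠ ∅ ∧ S ≠ Finset.univ then chowMk ℝ M (X ⟨S, h⟩) else 0

theorem yvM_val (M : FinMatroid E) (F : ProperFlat M) : yvM M F.1 = chowMk ℝ M (X F) := by
  unfold yvM
  rw [dif_pos F.2]
  rfl

theorem yvM_zero {M : FinMatroid E} {S : Finset E}
    (h : ¬ (M.IsFlat S ∧ S ≠ ∅ ∧ S ≠ Finset.univ)) : yvM M S = 0 := by
  unfold yvM
  rw [dif_neg h]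

theorem sum_flats {M : FinMatroid E} {R : Type*} [AddCommMonoid R] (f : Finset E → R)
    (h : ∀ S, ¬ (M.IsFlat S ∧ S ≠ ∅ ∧ S ≠ Finset.univ) → f S = 0) :
    ∑ F : ProperFlat M, f F.1 = ∑ S, f S := by
  refine Finset.sum_of_injOn (fun F : ProperFlat M => F.1) ?_ ?_ ?_ ?_
  · intro F _ G _ h; exact Subtype.ext h
  · intro F _; exact Finset.mem_coe.2 (Finset.mem_univ _)
  · intro S _ hS
    refine h S fun hc => hS ⟨⟨S, hc⟩, Finset.mem_coe.2 (Finset.mem_univ _), rfl⟩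
  · intro F _; rfl

theorem chow_ch1 (M : FinMatroid E) (a b : E) :
    (∑ F : ProperFlat M, if a ∈ F.1 then chowMk ℝ M (X F) else 0) =
      ∑ F : ProperFlat M, if b ∈ F.1 then chowMk ℝ M (X F) else 0 := by
  have : chowMk ℝ M ((∑ F : ProperFlat M, if a ∈ F.1 then X F else 0) -
      (∑ F : ProperFlat M, if b ∈ F.1 then X F else 0)) = 0 :=
    Ideal.Quotient.eq_zero_iff_mem.2 (Ideal.subset_span (Or.inl ⟨(a, b), rfl⟩))
  rw [map_sub, map_sum, map_sum, sub_eq_zero] at this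
  simpa only [apply_ite (chowMk ℝ M), map_zero] using this

theorem chow_ch2 (M : FinMatroid E) (F G : ProperFlat M) (h : ¬ cmp F.1 G.1) :
    chowMk ℝ M (X F) * chowMk ℝ M (X G) = 0 := by
  rw [← map_mul]
  exact Ideal.Quotient.eq_zero_iff_mem.2 (Ideal.subset_span (Or.inr
    ⟨F, G, fun h1 => h (Or.inl h1), fun h1 => h (Or.inr h1), rfl⟩))

theorem rel_yvM (M : FinMatroid E) : ∀ p ∈ rel (FF M) (sig0 E),
    (1 : ChowRing ℝ M) * aeval (yvM M) p = 0 := by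
  rintro p (⟨S, hS, rfl⟩ | ⟨S, T, hST, rfl⟩ | ⟨μ, ⟨c, w, hμ⟩, h0, rfl⟩)
  · rw [one_mul, aeval_X]
    exact yvM_zero fun h => hS (mem_Lk0.2 h)
  · rw [one_mul, map_mul, aeval_X, aeval_X]
    by_cases h : M.IsFlat S ∧ S ≠ ∅ ∧ S ≠ Finset.univ
    · by_cases h' : M.IsFlat T ∧ T ≠ ∅ ∧ T ≠ Finset.univ
      · exact (congrArg₂ (· * ·) (yvM_val M ⟨S, h⟩) (yvM_val M ⟨T, h'⟩)).trans
          (chow_ch2 M _ _ hST)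
      · rw [yvM_zero h', mul_zero]
    · rw [yvM_zero h, zero_mul]
  · have hc : c = 0 := by
      have := h0 ∅ (Finset.mem_insert_self _ _)
      rw [hμ, Finset.sum_empty, add_zero] at this; exact this
    have hw : ∑ e, w e = 0 := by
      have := h0 Finset.univ (Finset.mem_insert_of_mem (Finset.mem_singleton_self _))
      rw [hμ, hc, zero_add] at this; exact this
    have e1 : aeval (yvM M) (∑ S, C (μ S) * X S) =
        ∑ F : ProperFlat M, μ F.1 • chowMk ℝ M (X F) := by
      rw [map_sum]
      have : ∀ F : ProperFlat M, μ F.1 • chowMk ℝ M (X F) =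
          (fun S => μ S • yvM M S) F.1 := fun F => by simp only [yvM_val]
      rw [Finset.sum_congr rfl fun F _ => this F,
        sum_flats (M := M) (fun S => μ S • yvM M S) fun S hS => by simp only [yvM_zero hS, smul_zero]]
      refine Finset.sum_congr rfl fun S _ => ?_
      rw [C_mul', map_smul, aeval_X]
    rw [one_mul, e1]
    have e2 : ∀ F : ProperFlat M, μ F.1 • chowMk ℝ M (X F) =
        ∑ e, w e • (if e ∈ F.1 then chowMk ℝ M (X F) else 0) := by
      intro F
      rw [hμ, hc, zero_add, Finset.sum_smul]
      simp only [smul_ite, smul_zero]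
      rw [Finset.sum_ite_mem, Finset.univ_inter]
    rw [Finset.sum_congr rfl fun F _ => e2 F, Finset.sum_comm]
    simp only [← Finset.smul_sum]
    rcases isEmpty_or_nonempty E with hE | ⟨⟨b⟩⟩
    · exact Finset.sum_eq_zero fun e _ => hE.elim e
    · rw [Finset.sum_congr rfl fun a _ => by rw [chow_ch1 M a b], ← Finset.sum_smul, hw, zero_smul]

/-- from the flag Chow ring to the matroid Chow ring -/
noncomputable def psi (M : FinMatroid E) : CR (FF M) (sig0 E) →ₗ[ℝ] ChowRing ℝ M :=
  push 1 (yvM M) (rel_yvM M)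

theorem psi_mk (M : FinMatroid E) (p : MvPolynomial (Finset E) ℝ) :
    psi M (mk (FF M) (sig0 E) p) = aeval (yvM M) p := by
  unfold psi
  rw [push_mk, one_mul]

/-- lift of the variables -/
noncomputable def phi0 (M : FinMatroid E) :
    MvPolynomial (ProperFlat M) ℝ →ₐ[ℝ] CR (FF M) (sig0 E) :=
  aeval fun F => xx (FF M) (sig0 E) F.1

theorem phi0_lin (M : FinMatroid E) (c : Finset E → ℝ) :
    ∑ F : ProperFlat M, c F.1 • xx (FF M) (sig0 E) F.1 = ell (FF M) (sig0 E) c := by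
  unfold ell
  exact sum_flats (M := M) (fun S => c S • xx (FF M) (sig0 E) S) fun S hS => by
    rw [xx_eq_zero fun h => hS (mem_Lk0.1 h), smul_zero]

theorem phi0_ker (M : FinMatroid E) : ∀ p ∈ chowIdeal ℝ M, phi0 M p = 0 := by
  have : chowIdeal ℝ M ≤ RingHom.ker (phi0 M) := by
    refine Ideal.span_le.2 ?_
    rintro p (⟨⟨a, b⟩, rfl⟩ | ⟨F, G, h1, h2, rfl⟩)
    · change phi0 M _ = 0
      rw [map_sub, map_sum, map_sum]
      have e : ∀ a : E, ∑ F : ProperFlat M, phi0 M (if a ∈ F.1 then X F else 0) =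
          ell (FF M) (sig0 E) fun S => if a ∈ S then (1 : ℝ) else 0 := by
        intro a
        rw [← phi0_lin]
        refine Finset.sum_congr rfl fun F _ => ?_
        by_cases h : a ∈ F.1
        · rw [if_pos h, if_pos h, one_smul, phi0, aeval_X]
        · rw [if_neg h, if_neg h, zero_smul, map_zero]
      change ∑ F : ProperFlat M, phi0 M (if a ∈ F.1 then X F else 0) -
        ∑ F : ProperFlat M, phi0 M (if b ∈ F.1 then X F else 0) = 0
      rw [e, e, ← ell_sub]
      refine ell_aff (Aff.dif a b) fun T hT => ?_
      rcases Finset.mem_insert.1 hT with rfl | h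
      · simp
      · rw [Finset.mem_singleton.1 h]; simp
    · change phi0 M _ = 0
      rw [map_mul, phi0, aeval_X, aeval_X]
      exact xx_mul_eq_zero fun h => h.elim h1 h2
  exact this

/-- from the matroid Chow ring to the flag Chow ring -/
noncomputable def phi (M : FinMatroid E) : ChowRing ℝ M →ₐ[ℝ] CR (FF M) (sig0 E) :=
  Ideal.Quotient.liftₐ (chowIdeal ℝ M) (phi0 M) (phi0_ker M)

theorem phi_mk (M : FinMatroid E) (p : MvPolynomial (ProperFlat M) ℝ) :
    phi M (chowMk ℝ M p) = phi0 M p :=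
  Ideal.Quotient.liftₐ_apply _ _ _ _

theorem phi0_rename (M : FinMatroid E) (p : MvPolynomial (ProperFlat M) ℝ) :
    phi0 M p = mk (FF M) (sig0 E) (rename (fun F : ProperFlat M => F.1) p) := by
  have : phi0 M = (mk (FF M) (sig0 E)).comp (rename (fun F : ProperFlat M => F.1)) := by
    refine MvPolynomial.algHom_ext fun F => ?_
    rw [phi0, aeval_X, AlgHom.comp_apply, rename_X]
    rfl
  rw [this]; rfl

theorem psi_phi (M : FinMatroid E) (a : ChowRing ℝ M) : psi M (phi M a) = a := by
  obtain ⟨p, rfl⟩ : ∃ p, chowMk ℝ M p = a := Ideal.Quotient.mk_surjective a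
  rw [phi_mk, phi0_rename, psi_mk, aeval_rename]
  have : aeval (yvM M ∘ fun F : ProperFlat M => F.1) = chowMk ℝ M := by
    refine MvPolynomial.algHom_ext fun F => ?_
    rw [aeval_X, Function.comp_apply, yvM_val]
  rw [this]

theorem phi_mem (M : FinMatroid E) {k : ℕ} {a : ChowRing ℝ M} (ha : a ∈ FinMatroid.piece ℝ M k) :
    phi M a ∈ piece (FF M) (sig0 E) k := by
  obtain ⟨p, hp, rfl⟩ := ha
  change phi M (chowMk ℝ M p) ∈ _
  rw [phi_mk, phi0_rename]
  exact mk_mem (IsHomogeneous.rename_isHomogeneous ((mem_homogeneousSubmodule _ _).1 hp))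

/-- a chain of proper flats can be listed increasingly -/
theorem chain_flag {M : FinMatroid E} {d : ℕ} (c : Finset (Finset E))
    (hc : ∀ S ∈ c, M.IsFlat S ∧ S ≠ ∅ ∧ S ≠ Finset.univ)
    (hch : ∀ S ∈ c, ∀ T ∈ c, cmp S T) (hd : c.card = d) :
    ∃ flag : Fin d → ProperFlat M, (∀ i j, i < j → (flag i).1 ⊂ (flag j).1) ∧
      Finset.univ.image (fun i => (flag i).1) = c := by
  have hinj : Set.InjOn Finset.card (c : Set (Finset E)) := by
    intro S hS T hT h
    rcases hch S hS T hT with h1 | h1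
    · exact Finset.eq_of_subset_of_card_le h1 h.ge
    · exact (Finset.eq_of_subset_of_card_le h1 h.le).symm
  have hcard : (c.image Finset.card).card = d := by
    rw [Finset.card_image_of_injOn hinj, hd]
  have hex : ∀ i : Fin d, ∃ S ∈ c, S.card = (c.image Finset.card).orderEmbOfFin hcard i := by
    intro i
    exact Finset.mem_image.1 (Finset.orderEmbOfFin_mem (c.image Finset.card) hcard i)
  choose g hg hgc using hex
  have hlt : ∀ i j, i < j → g i ⊂ g j := by
    intro i j hij
    have : (g i).card < (g j).card := by
      rw [hgc, hgc]; exact ((c.image Finset.card).orderEmbOfFin hcard).strictMono hij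
    rcases hch _ (hg i) _ (hg j) with h | h
    · refine h.ssubset_of_ne fun h' => ?_
      rw [h'] at this; exact lt_irrefl _ this
    · exact absurd (Finset.card_le_card h) (not_le.2 this)
  have hgi : Function.Injective g := by
    intro i j h
    rcases lt_trichotomy i j with h1 | h1 | h1
    · exact absurd h (hlt i j h1).ne
    · exact h1
    · exact absurd h.symm (hlt j i h1).ne
  refine ⟨fun i => ⟨g i, hc _ (hg i)⟩, hlt, ?_⟩
  refine Finset.eq_of_subset_of_card_le ?_ ?_
  · intro S hS
    obtain ⟨i, -, rfl⟩ := Finset.mem_image.1 hS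
    exact hg i
  · change c.card ≤ (Finset.univ.image g).card
    rw [Finset.card_image_of_injective _ hgi, hd, Finset.card_univ, Fintype.card_fin]

theorem sig0_card {M : FinMatroid E} {d : ℕ} (hrk : M.rk = d + 1) : (sig0 E).card = 2 := by
  refine Finset.card_pair fun h => ?_
  have h1 : M.rank Finset.univ = d + 1 := hrk
  rw [← h] at h1
  have : M.rank ∅ ≤ 0 := rank_le fun I _ hI => by rw [Finset.subset_empty.1 hI]; rfl
  omega

/-- main theorem, in terms of an extended degree map -/
theorem hr_main (M : FinMatroid E) (hM : M.Loopless) (d : ℕ) (hrk : M.rk = d + 1)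
    (l : ChowRing ℝ M) (hl : M.Ample l) (k : ℕ) (hk : 2 * k ≤ d)
    (deg : ChowRing ℝ M →ₗ[ℝ] ℝ)
    (hdeg : ∀ flag : Fin d → ProperFlat M, (∀ i j : Fin d, i < j → (flag i).1 ⊂ (flag j).1) →
      deg (chowMk ℝ M (∏ i, X (flag i))) = 1)
    (a : ChowRing ℝ M) (ha : a ∈ FinMatroid.piece ℝ M k) (h0 : l ^ (d - 2 * k + 1) * a = 0)
    (hne : a ≠ 0) : 0 < (-1 : ℝ) ^ k * deg (a * l ^ (d - 2 * k) * a) := by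
  have h2 := sig0_card hrk
  have hN : Nrm (FF M) (sig0 E) (d + 2) (deg ∘ₗ psi M) := by
    intro c hc hch hcd
    obtain ⟨flag, hf, him⟩ := chain_flag c (fun S hS => mem_Lk0.1 (hc S hS)) hch
      (d := d) (by omega)
    rw [← hdeg flag hf]
    change deg (psi M _) = _
    congr 1
    rw [← psi_phi M (chowMk ℝ M _), phi_mk]
    congr 1
    rw [map_prod (phi0 M)]
    rw [← him, Finset.prod_image]
    · refine Finset.prod_congr rfl fun i _ => ?_
      rw [phi0, aeval_X]
    · intro i _ j _ h
      rcases lt_trichotomy i j with h1 | h1 | h1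
      · exact absurd h (hf i j h1).ne
      · exact h1
      · exact absurd h.symm (hf j i h1).ne
  obtain ⟨c, hc, rfl⟩ := hl
  have hB := sig0_base (M := M) hM
  have hK : Kc (FF M) (sig0 E) c := SSub.Kc hB hc.2.2.2 (by
    intro T hT
    rcases Finset.mem_insert.1 hT with rfl | h
    · exact hc.2.1
    · rw [Finset.mem_singleton.1 h]; exact hc.2.2.1)
  have hHR := (TT_all (flats_fam M) (flats_graded hM hrk) hB _ hN).2 c hK
  have hphil : phi M (chowMk ℝ M (∑ F : ProperFlat M, C (c F.1) * X F)) =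
      ell (FF M) (sig0 E) c := by
    rw [phi_mk, map_sum, ← phi0_lin]
    refine Finset.sum_congr rfl fun F _ => ?_
    rw [C_mul', map_smul, phi0, aeval_X]
  have := hHR k (d - 2 * k) (by omega) (phi M a) (phi_mem M ha)
    (by rw [← hphil, ← map_pow, ← map_mul, h0, map_zero])
    (fun h => hne (by rw [← psi_phi M a, h, map_zero]))
  rw [← hphil, ← map_pow, ← map_mul, ← map_mul] at this
  rw [LinearMap.comp_apply, psi_phi] at this
  rw [mul_right_comm]
  exact this

end transfer
end HRProof

set_option synthInstance.maxHeartbeats 1000000 in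
set_option maxHeartbeats 1000000 in
open FinMatroid in
/-- **Adiprasito–Huh–Katz, Hodge–Riemann relations.** Let `M` be a loopless matroid of rank
`d+1`, let `l ∈ A¹(M)_ℝ` be ample, let `0 ≤ k ≤ d/2`, and let `deg : A^d(M)_ℝ ≅ ℝ` be the
degree isomorphism (sending each flag monomial to `1`). Then the bilinear form
`Q(a,b) = (-1)^k deg(a · l^{d-2k} · b)` is positive definite on the subspace of primitive
classes `{a ∈ A^k(M)_ℝ : l^{d-2k+1} · a = 0}`. -/
theorem chow_hodge_riemann {E : Type*} [Fintype E] [DecidableEq E]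
    (M : FinMatroid E) (hM : M.Loopless) (d : ℕ) (hrk : M.rk = d + 1)
    (l : ChowRing ℝ M) (hl : M.Ample l) (k : ℕ) (hk : 2 * k ≤ d)
    (deg : (piece ℝ M d) →ₗ[ℝ] ℝ) (hdeg_bij : Function.Bijective deg)
    (hdeg : ∀ flag : Fin d → ProperFlat M, (∀ i j : Fin d, i < j → (flag i).1 ⊂ (flag j).1) →
      deg ⟨chowMk ℝ M (∏ i, MvPolynomial.X (flag i)), flagMonomial_mem ℝ M d flag⟩ = 1) :
    ∀ a : piece ℝ M k,
      l ^ (d - 2 * k + 1) * (a : ChowRing ℝ M) = 0 → a ≠ 0 →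
      0 < (-1 : ℝ) ^ k *
        deg ⟨(a : ChowRing ℝ M) * l ^ (d - 2 * k) * (a : ChowRing ℝ M), by
          have h := mul_mem_piece ℝ
            (mul_mem_piece ℝ a.2 (pow_mem_piece ℝ hl.mem_piece_one (d - 2 * k))) a.2
          have hd : k + (d - 2 * k) + k = d := by omega
          rwa [hd] at h⟩ := by
  obtain ⟨deg', hdeg'⟩ := deg.exists_extend
  intro a h0 hne
  have key := HRProof.hr_main M hM d hrk l hl k hk deg'
    (fun flag hf => by
      rw [← hdeg flag hf, ← hdeg']
      rfl)
    a.1 a.2 h0 (fun h => hne (Subtype.ext h))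
  have e : ∀ z : piece ℝ M d, deg z = deg' z.1 := fun z => by rw [← hdeg']; rfl
  rw [e]
  exact key
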